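/- arXiv:2109.02932 — 5 statements merged into one kernel-verified Lean document; each statement's English description precedes it below -/
import Mathlib

section
/- For every nonzero integer D, there exists a finite set S of monic polynomials in ℤ[X] such that every monic polynomial f ∈ ℤ[X] (of any degree) with discriminant D(f) = D is ℤ-equivalent to some polynomial in S. (Equivalently: the monic polynomials in ℤ[X] with given nonzero discriminant D, with no bound imposed on the degree, lie in only finitely many ℤ-equivalence classes.) -/
open Polynomial

/-- The Hermite form `[f]` of an integer polynomial viewed as degree `n`:
`f₀^(n-1) · ∏ᵢ (αᵢ^(n-1) X₁ + αᵢ^(n-2) X₂ + ⋯ + X_n)`, where the `αᵢ` are the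
complex roots of `f` counted with multiplicity. -/
noncomputable def hermiteForm (n : ℕ) (f : Polynomial ℤ) : MvPolynomial (Fin n) ℂ :=
  MvPolynomial.C ((f.leadingCoeff : ℂ) ^ (n - 1)) *
    (Multiset.map
      (fun α : ℂ => ∑ j : Fin n, MvPolynomial.C (α ^ (n - 1 - (j : ℕ))) * MvPolynomial.X j)
      ((f.map (Int.castRingHom ℂ)).roots)).prod

/-- `f` and `g`, viewed as degree-`n` polynomials, are Hermite equivalent if there are
`U ∈ GL_n(ℤ)` and `ε ∈ {1,-1}` with `[g](U·X) = ε·[f](X)`. -/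
def HermiteEquiv (n : ℕ) (f g : Polynomial ℤ) : Prop :=
  ∃ (U : Matrix (Fin n) (Fin n) ℤ) (ε : ℤ), IsUnit U.det ∧ (ε = 1 ∨ ε = -1) ∧
    MvPolynomial.bind₁
        (fun i : Fin n => ∑ j : Fin n, MvPolynomial.C ((U i j : ℂ)) * MvPolynomial.X j)
        (hermiteForm n g)
      = MvPolynomial.C ((ε : ℂ)) * hermiteForm n f

/-- The translate `(f∘M)(X) = ∑ₖ f_k (aX+b)^k (cX+d)^(n-k)` of `f`, viewed as a
degree-`n` polynomial, by the matrix `M = (a b; c d)`. -/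
noncomputable def glTranslate (n : ℕ) (f : Polynomial ℤ) (M : Matrix (Fin 2) (Fin 2) ℤ) : Polynomial ℤ :=
  ∑ k ∈ Finset.range (n + 1),
    Polynomial.C (f.coeff k) * (Polynomial.C (M 0 0) * Polynomial.X + Polynomial.C (M 0 1)) ^ k *
      (Polynomial.C (M 1 0) * Polynomial.X + Polynomial.C (M 1 1)) ^ (n - k)

/-- `f` and `g`, viewed as degree-`n` polynomials, are `GL₂(ℤ)`-equivalent if
`g = ±(f∘M)` for some `M ∈ GL₂(ℤ)`. -/
def GL2Equiv (n : ℕ) (f g : Polynomial ℤ) : Prop :=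
  ∃ M : Matrix (Fin 2) (Fin 2) ℤ, IsUnit M.det ∧
    (g = glTranslate n f M ∨ g = -glTranslate n f M)

/-- The list of complex roots of `f`, counted with multiplicity (in some order). -/
noncomputable def rootList (f : Polynomial ℤ) : List ℂ :=
  ((f.map (Int.castRingHom ℂ)).roots).toList

/-- The discriminant `D(f) = f₀^(2n-2) ∏_{i<j} (αᵢ - α_j)²` of `f` (as a complex number;
it is independent of the ordering of the roots since the product is symmetric). -/
noncomputable def discC (f : Polynomial ℤ) : ℂ :=
  (f.leadingCoeff : ℂ) ^ (2 * f.natDegree - 2) *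
    ∏ p : Fin (rootList f).length × Fin (rootList f).length,
      if (p.1 : ℕ) < (p.2 : ℕ) then ((rootList f).get p.1 - (rootList f).get p.2) ^ 2 else 1

/-- `K_f := ℚ[X]/(f)`. -/
abbrev Kf (f : Polynomial ℤ) : Type := AdjoinRoot (f.map (Int.castRingHom ℚ))

/-- The residue class `α` of `X` in `K_f`. -/
noncomputable def rootOf (f : Polynomial ℤ) : Kf f := AdjoinRoot.root _

/-- `ζᵢ = f₀ αⁱ + f₁ α^(i-1) + ⋯ + f_{i-1} α`, where `f_j` is the coefficient of
`X^(n-j)` in `f`. -/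
noncomputable def zeta (f : Polynomial ℤ) (i : ℕ) : Kf f :=
  ∑ j ∈ Finset.range i, ((f.coeff (f.natDegree - j) : ℤ) : Kf f) * rootOf f ^ (i - j)

/-- The invariant module `I_f(k)`: the ℤ-span of `1, α, …, α^k, ζ_{k+1}, …, ζ_{n-1}`
inside `K_f`.  In particular `R_f = I_f(0)` and `I_f = I_f(1)`. -/
noncomputable def invModule (f : Polynomial ℤ) (k : ℕ) : Submodule ℤ (Kf f) :=
  Submodule.span ℤ
    ({x | ∃ j ≤ k, x = rootOf f ^ j} ∪
     {x | ∃ i, k + 1 ≤ i ∧ i ≤ f.natDegree - 1 ∧ x = zeta f i})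

/-- `f` and `g` are ℤ-equivalent: `g(X) = εⁿ f(εX + a)` with `ε = ±1`, `a ∈ ℤ`. -/
def ZEquiv (f g : Polynomial ℤ) : Prop :=
  ∃ ε a : ℤ, (ε = 1 ∨ ε = -1) ∧
    g = Polynomial.C (ε ^ f.natDegree) * f.comp (Polynomial.C ε * Polynomial.X + Polynomial.C a)

/-- The `(n-2)`-th partial sum `a⁽ⁿ⁾(X) = ∑_{i=0}^{n-2} Cᵢ Xⁱ` of the Catalan
generating function. -/
noncomputable def aPoly (n : ℕ) : Polynomial ℤ :=
  ∑ i ∈ Finset.range (n - 1), Polynomial.C ((catalan i : ℤ)) * Polynomial.X ^ i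

open NumberField

theorem integral_pow_mul_sub_pow (u : ℝ) (p q : ℕ) :
    ∫ t in (0 : ℝ)..u, t ^ p * (u - t) ^ q =
      u ^ (p + q + 1) * (p.factorial * q.factorial / (p + q + 1).factorial) := by
  induction q generalizing p with
  | zero =>
    have : ((p + 1 : ℕ).factorial : ℝ) = (p + 1) * p.factorial := by
      rw [Nat.factorial_succ]; push_cast; ring
    have h := Nat.cast_ne_zero (R := ℝ).mpr p.factorial_ne_zero
    simp [this]
    field_simp
  | succ q ih =>
    have hd : ∀ t : ℝ, HasDerivAt (fun t : ℝ => t ^ (p + 1) * (u - t) ^ (q + 1))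
        ((p + 1) * (t ^ p * (u - t) ^ (q + 1)) - (q + 1) * (t ^ (p + 1) * (u - t) ^ q)) t := by
      intro t
      have h1 := (hasDerivAt_pow (p + 1) t).mul (((hasDerivAt_id t).const_sub u).pow (q + 1))
      refine h1.congr_deriv ?_
      simp
      ring
    have h0 := intervalIntegral.integral_eq_sub_of_hasDerivAt (a := 0) (b := u)
      (fun t _ => hd t) (Continuous.intervalIntegrable (by fun_prop) _ _)
    rw [intervalIntegral.integral_sub (Continuous.intervalIntegrable (by fun_prop) _ _)
      (Continuous.intervalIntegrable (by fun_prop) _ _),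
      intervalIntegral.integral_const_mul, intervalIntegral.integral_const_mul, ih (p + 1)] at h0
    simp only [sub_self, ne_eq, Nat.add_eq_zero_iff, one_ne_zero, and_false, not_false_eq_true,
      zero_pow, mul_zero, zero_mul] at h0
    have e1 : p + 1 + q + 1 = p + (q + 1) + 1 := by ring
    rw [e1] at h0
    have e2 : ((p + 1 : ℕ).factorial : ℝ) = (p + 1) * p.factorial := by
      rw [Nat.factorial_succ]; push_cast; ring
    have e3 : ((q + 1 : ℕ).factorial : ℝ) = (q + 1) * q.factorial := by
      rw [Nat.factorial_succ]; push_cast; ring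
    have hp : (p + 1 : ℝ) ≠ 0 := by positivity
    apply mul_left_cancel₀ hp
    rw [e3]
    rw [e2] at h0
    linear_combination h0

/-- The binary form `∑ₖ (-1)ᵏ C(a+k, k) C(2a+c+1, n-k) xᵏ zⁿ⁻ᵏ`. -/
def padeForm {R : Type*} [CommRing R] (a c n : ℕ) (x z : R) : R :=
  ∑ k ∈ Finset.range (n + 1),
    (-1) ^ k * ((a + k).choose k : R) * ((2 * a + c + 1).choose (n - k) : R) * x ^ k * z ^ (n - k)

theorem map_padeForm {R S : Type*} [CommRing R] [CommRing S] (φ : R →+* S) (a c n : ℕ) (x z : R) :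
    φ (padeForm a c n x z) = padeForm a c n (φ x) (φ z) := by
  simp [padeForm]

theorem integral_padeForm_left (a c : ℕ) (x z : ℝ) :
    (2 * a + c + 1).factorial * ∫ t in (0 : ℝ)..x, t ^ a * (z - t) ^ a * (x - t) ^ c =
      a.factorial * a.factorial * c.factorial * (x ^ (a + c + 1) * padeForm a c a x z) := by
  have h1 : ∀ t : ℝ, t ^ a * (z - t) ^ a * (x - t) ^ c =
      ∑ k ∈ Finset.range (a + 1), ((-1) ^ k * a.choose k * z ^ (a - k)) *
        (t ^ (a + k) * (x - t) ^ c) := by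
    intro t
    rw [show z - t = -t + z by ring, add_pow, Finset.mul_sum, Finset.sum_mul]
    refine Finset.sum_congr rfl fun k _ => ?_
    rw [neg_pow t k]
    ring
  simp_rw [h1]
  rw [intervalIntegral.integral_finsetSum
    (fun k _ => Continuous.intervalIntegrable (by fun_prop) _ _), padeForm]
  simp_rw [intervalIntegral.integral_const_mul, integral_pow_mul_sub_pow, Finset.mul_sum]
  refine Finset.sum_congr rfl fun k hk => ?_
  have hk' : k ≤ a := Nat.lt_succ_iff.mp (Finset.mem_range.mp hk)
  rw [Nat.cast_choose ℝ hk', Nat.cast_choose ℝ (show k ≤ a + k by omega),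
    Nat.cast_choose ℝ (show a - k ≤ 2 * a + c + 1 by omega),
    show 2 * a + c + 1 - (a - k) = a + k + c + 1 by omega, Nat.add_sub_cancel]
  field_simp
  ring

theorem integral_padeForm_right (a c : ℕ) (x z : ℝ) :
    (2 * a + c + 1).factorial * ∫ t in (0 : ℝ)..z, t ^ a * (z - t) ^ a * (x - t) ^ c =
      a.factorial * a.factorial * c.factorial * (z ^ (2 * a + 1) * padeForm a c c z x) := by
  have h1 : ∀ t : ℝ, t ^ a * (z - t) ^ a * (x - t) ^ c =
      ∑ k ∈ Finset.range (c + 1), ((-1) ^ k * c.choose k * x ^ (c - k)) *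
        (t ^ (a + k) * (z - t) ^ a) := by
    intro t
    rw [show x - t = -t + x by ring, add_pow, Finset.mul_sum]
    refine Finset.sum_congr rfl fun k _ => ?_
    rw [neg_pow t k]
    ring
  simp_rw [h1]
  rw [intervalIntegral.integral_finsetSum
    (fun k _ => Continuous.intervalIntegrable (by fun_prop) _ _), padeForm]
  simp_rw [intervalIntegral.integral_const_mul, integral_pow_mul_sub_pow, Finset.mul_sum]
  refine Finset.sum_congr rfl fun k hk => ?_
  have hk' : k ≤ c := Nat.lt_succ_iff.mp (Finset.mem_range.mp hk)
  rw [Nat.cast_choose ℝ hk', Nat.cast_choose ℝ (show k ≤ a + k by omega),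
    Nat.cast_choose ℝ (show c - k ≤ 2 * a + c + 1 by omega),
    show 2 * a + c + 1 - (c - k) = a + k + a + 1 by omega, Nat.add_sub_cancel]
  field_simp
  ring

theorem padeForm_identity_real (a c : ℕ) (x z : ℝ) :
    x ^ (a + c + 1) * padeForm a c a x z +
      (-1) ^ c * ((z - x) ^ (a + c + 1) * padeForm a c a (z - x) z) =
      z ^ (2 * a + 1) * padeForm a c c z x := by
  have h1 := integral_padeForm_left a c x z
  have h2 := integral_padeForm_left a c (z - x) z
  have h3 := integral_padeForm_right a c x z
  have h4 : ∫ t in (0 : ℝ)..(z - x), t ^ a * (z - t) ^ a * (z - x - t) ^ c =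
      (-1) ^ c * ∫ t in x..z, t ^ a * (z - t) ^ a * (x - t) ^ c := by
    rw [← intervalIntegral.integral_const_mul]
    have := intervalIntegral.integral_comp_sub_left (a := x) (b := z)
      (fun t => t ^ a * (z - t) ^ a * (z - x - t) ^ c) z
    rw [sub_self] at this
    rw [← this]
    congr 1
    ext t
    rw [← mul_assoc, show z - x - (z - t) = -1 * (x - t) by ring, mul_pow]
    ring
  have h5 := intervalIntegral.integral_add_adjacent_intervals (μ := MeasureTheory.volume)
    (a := 0) (b := x) (c := z) (f := fun t : ℝ => t ^ a * (z - t) ^ a * (x - t) ^ c)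
    (Continuous.intervalIntegrable (by fun_prop) _ _)
    (Continuous.intervalIntegrable (by fun_prop) _ _)
  have hs : ((-1 : ℝ) ^ c) * (-1) ^ c = 1 := by rw [← mul_pow]; simp
  rw [h4] at h2
  have hne : (a.factorial * a.factorial * c.factorial : ℝ) ≠ 0 := by positivity
  apply mul_left_cancel₀ hne
  rw [mul_add]
  rw [← h3, ← h5, ← h1]
  linear_combination (-(-1) ^ c) * h2 + (((2 * a + c + 1).factorial : ℝ) *
    ∫ t in x..z, t ^ a * (z - t) ^ a * (x - t) ^ c) * hs

theorem padeForm_identity {R : Type*} [CommRing R] (a c : ℕ) (x z : R) :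
    x ^ (a + c + 1) * padeForm a c a x z +
      (-1) ^ c * ((z - x) ^ (a + c + 1) * padeForm a c a (z - x) z) =
      z ^ (2 * a + 1) * padeForm a c c z x := by
  have key : (MvPolynomial.X 0 : MvPolynomial (Fin 2) ℤ) ^ (a + c + 1) *
      padeForm a c a (MvPolynomial.X 0) (MvPolynomial.X 1) +
      (-1) ^ c * ((MvPolynomial.X 1 - MvPolynomial.X 0) ^ (a + c + 1) *
        padeForm a c a (MvPolynomial.X 1 - MvPolynomial.X 0) (MvPolynomial.X 1)) =
      MvPolynomial.X 1 ^ (2 * a + 1) * padeForm a c c (MvPolynomial.X 1) (MvPolynomial.X 0) := by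
    apply MvPolynomial.map_injective (Int.castRingHom ℝ) Int.cast_injective
    apply MvPolynomial.funext
    intro v
    simpa [map_padeForm] using padeForm_identity_real a c (v 0) (v 1)
  have := congrArg (MvPolynomial.eval₂Hom (Int.castRingHom R) ![x, z]) key
  simp only [map_add, map_sub, map_mul, map_padeForm, map_pow, map_neg, map_one,
    MvPolynomial.eval₂Hom_X'] at this
  exact this

theorem natDegree_padeForm_X_one_le (a c n : ℕ) :
    (padeForm a c n (X : ℤ[X]) 1).natDegree ≤ n := by
  refine natDegree_sum_le_of_forall_le _ _ fun k hk => ?_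
  have hk' : k ≤ n := Nat.lt_succ_iff.mp (Finset.mem_range.mp hk)
  have : ((-1) ^ k * ((a + k).choose k : ℤ[X]) * ((2 * a + c + 1).choose (n - k) : ℤ[X]) * X ^ k *
      1 ^ (n - k)) = C ((-1) ^ k * ((a + k).choose k : ℤ) * ((2 * a + c + 1).choose (n - k) : ℤ)) *
      X ^ k := by simp
  rw [this]
  exact (natDegree_C_mul_X_pow_le _ _).trans hk'

theorem natDegree_padeForm_one_X_le (a c n : ℕ) :
    (padeForm a c n 1 (X : ℤ[X])).natDegree ≤ n := by
  refine natDegree_sum_le_of_forall_le _ _ fun k hk => ?_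
  have : ((-1) ^ k * ((a + k).choose k : ℤ[X]) * ((2 * a + c + 1).choose (n - k) : ℤ[X]) * 1 ^ k *
      X ^ (n - k)) = C ((-1) ^ k * ((a + k).choose k : ℤ) * ((2 * a + c + 1).choose (n - k) : ℤ)) *
      X ^ (n - k) := by simp
  rw [this]
  exact (natDegree_C_mul_X_pow_le _ _).trans (Nat.sub_le _ _)

theorem coeff_padeForm_X_one (a c n : ℕ) :
    (padeForm a c n (X : ℤ[X]) 1).coeff n = (-1) ^ n * ((a + n).choose n : ℤ) := by
  rw [padeForm, finsetSum_coeff, Finset.sum_eq_single n]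
  · have : ((-1) ^ n * ((a + n).choose n : ℤ[X]) * ((2 * a + c + 1).choose (n - n) : ℤ[X]) * X ^ n *
      1 ^ (n - n)) = C ((-1) ^ n * ((a + n).choose n : ℤ)) * X ^ n := by simp
    rw [this, coeff_C_mul_X_pow, if_pos rfl]
  · intro k hk hkn
    have : ((-1) ^ k * ((a + k).choose k : ℤ[X]) * ((2 * a + c + 1).choose (n - k) : ℤ[X]) * X ^ k *
      1 ^ (n - k)) = C ((-1) ^ k * ((a + k).choose k : ℤ) * ((2 * a + c + 1).choose (n - k) : ℤ)) *
      X ^ k := by simp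
    rw [this, coeff_C_mul_X_pow, if_neg (Ne.symm hkn)]
  · simp

theorem coeff_padeForm_one_X (a c n : ℕ) :
    (padeForm a c n 1 (X : ℤ[X])).coeff n = ((2 * a + c + 1).choose n : ℤ) := by
  rw [padeForm, finsetSum_coeff, Finset.sum_eq_single 0]
  · have : ((-1) ^ 0 * ((a + 0).choose 0 : ℤ[X]) * ((2 * a + c + 1).choose (n - 0) : ℤ[X]) * 1 ^ 0 *
      X ^ (n - 0)) = C ((2 * a + c + 1).choose n : ℤ) * X ^ n := by simp
    rw [this, coeff_C_mul_X_pow, if_pos rfl]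
  · intro k hk hkn
    have hk' : k ≤ n := Nat.lt_succ_iff.mp (Finset.mem_range.mp hk)
    have : ((-1) ^ k * ((a + k).choose k : ℤ[X]) * ((2 * a + c + 1).choose (n - k) : ℤ[X]) * 1 ^ k *
      X ^ (n - k)) = C ((-1) ^ k * ((a + k).choose k : ℤ) * ((2 * a + c + 1).choose (n - k) : ℤ)) *
      X ^ (n - k) := by simp
    rw [this, coeff_C_mul_X_pow, if_neg (by omega)]
  · simp

/-- The two Padé triples with exponent `2 (N + 1)` are nowhere proportional outside `x = 1`. -/
theorem padeForm_det_ne_zero {F : Type*} [Field F] [CharZero F] (N : ℕ) (x : F) (hx : x ≠ 1) :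
    padeForm (N + 1) N (N + 1) x 1 * padeForm N (N + 1) (N + 1) 1 x -
      padeForm N (N + 1) N x 1 * padeForm (N + 1) N N 1 x ≠ 0 := by
  set A₁ : ℤ[X] := padeForm (N + 1) N (N + 1) X 1
  set C₁ : ℤ[X] := padeForm (N + 1) N N 1 X
  set A₂ : ℤ[X] := padeForm N (N + 1) N X 1
  set C₂ : ℤ[X] := padeForm N (N + 1) (N + 1) 1 X
  have h1 := padeForm_identity (N + 1) N (X : ℤ[X]) 1
  have h2 := padeForm_identity N (N + 1) (X : ℤ[X]) 1
  simp only [one_pow, one_mul] at h1 h2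
  obtain ⟨F', hF⟩ : ∃ F' : ℤ[X], A₁ * C₂ - A₂ * C₁ = (1 - X) ^ (2 * N + 2) * F' := by
    refine ⟨(-1) ^ (N + 1) * (A₁ * padeForm N (N + 1) N (1 - X) 1 +
      A₂ * padeForm (N + 1) N (N + 1) (1 - X) 1), ?_⟩
    change _ = padeForm (N + 1) N N 1 X at h1
    simp only [C₁, C₂]
    rw [← h1, ← h2]
    ring
  have hA₁ : A₁.natDegree ≤ N + 1 := natDegree_padeForm_X_one_le _ _ _
  have hC₁ : C₁.natDegree ≤ N := natDegree_padeForm_one_X_le _ _ _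
  have hA₂ : A₂.natDegree ≤ N := natDegree_padeForm_X_one_le _ _ _
  have hC₂ : C₂.natDegree ≤ N + 1 := natDegree_padeForm_one_X_le _ _ _
  have hdeg : (A₁ * C₂ - A₂ * C₁).natDegree ≤ 2 * N + 2 := by
    refine (natDegree_sub_le _ _).trans (max_le (natDegree_mul_le.trans ?_)
      (natDegree_mul_le.trans ?_)) <;> omega
  have hcoeff : (A₁ * C₂ - A₂ * C₁).coeff (2 * N + 2) ≠ 0 := by
    have e : (A₂ * C₁).coeff (2 * N + 2) = 0 := by
      apply coeff_eq_zero_of_natDegree_lt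
      exact natDegree_mul_le.trans_lt (by omega)
    rw [coeff_sub, e, show 2 * N + 2 = (N + 1) + (N + 1) by ring,
      coeff_mul_add_eq_of_natDegree_le hA₁ hC₂, coeff_padeForm_X_one, coeff_padeForm_one_X, sub_zero]
    have p1 : 0 < (N + 1 + (N + 1)).choose (N + 1) := Nat.choose_pos (by omega)
    have p2 : 0 < (2 * N + (N + 1) + 1).choose (N + 1) := Nat.choose_pos (by omega)
    simp only [ne_eq, mul_eq_zero, pow_eq_zero_iff', neg_eq_zero, one_ne_zero, false_and,
      Int.natCast_eq_zero, false_or, not_or]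
    exact ⟨p1.ne', p2.ne'⟩
  have hF0 : F' ≠ 0 := by
    rintro rfl
    rw [hF] at hcoeff
    simp at hcoeff
  have hdX : (1 - X : ℤ[X]).natDegree = 1 := by
    rw [← natDegree_neg, neg_sub]; exact natDegree_X_sub_C 1
  have hX0 : (1 - X : ℤ[X]) ≠ 0 := by
    intro h; rw [h] at hdX; simp at hdX
  rw [hF, natDegree_mul (pow_ne_zero _ hX0) hF0, natDegree_pow, hdX] at hdeg
  obtain ⟨κ, rfl⟩ := natDegree_eq_zero.mp (show F'.natDegree = 0 by omega)
  have hκ : κ ≠ 0 := by rintro rfl; simp at hF0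
  have := congrArg (eval₂RingHom (Int.castRingHom F) x) hF
  simp only [A₁, A₂, C₁, C₂, map_sub, map_mul, map_padeForm, map_pow, map_one] at this
  simp only [coe_eval₂RingHom, eval₂_X, eval₂_C] at this
  rw [this]
  simp [hκ, sub_eq_zero, hx.symm]

theorem padeForm_mul_mul {R : Type*} [CommRing R] (a c n : ℕ) (g x z : R) :
    padeForm a c n (g * x) (g * z) = g ^ n * padeForm a c n x z := by
  rw [padeForm, padeForm, Finset.mul_sum]
  refine Finset.sum_congr rfl fun k hk => ?_
  have hk' : k ≤ n := Nat.lt_succ_iff.mp (Finset.mem_range.mp hk)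
  conv_rhs => rw [← Nat.add_sub_cancel' hk', pow_add]
  rw [mul_pow, mul_pow, Nat.add_sub_cancel' hk']
  ring

theorem isIntegral_padeForm {R : Type*} [CommRing R] (a c n : ℕ) {x z : R}
    (hx : IsIntegral ℤ x) (hz : IsIntegral ℤ z) : IsIntegral ℤ (padeForm a c n x z) := by
  refine IsIntegral.sum _ fun k _ => ?_
  exact ((((isIntegral_one.neg.pow k).mul (isIntegral_natCast _)).mul (isIntegral_natCast _)).mul (hx.pow k)).mul (hz.pow _)

theorem isIntegral_pow_mul_padeForm {R : Type*} [CommRing R] (a c : ℕ) {n m : ℕ} (hn : n ≤ m)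
    {g x z : R} (hg : IsIntegral ℤ g) (hx : IsIntegral ℤ (g * x)) (hz : IsIntegral ℤ (g * z)) :
    IsIntegral ℤ (g ^ m * padeForm a c n x z) := by
  have : g ^ m * padeForm a c n x z = g ^ (m - n) * padeForm a c n (g * x) (g * z) := by
    rw [padeForm_mul_mul, ← mul_assoc, ← pow_add, Nat.sub_add_cancel hn]
  rw [this]
  exact (hg.pow _).mul (isIntegral_padeForm _ _ _ hx hz)

theorem norm_padeForm_le {N a c n : ℕ} (ha : a ≤ N + 1) (hac : a + c ≤ 2 * N + 1) (hn : n ≤ N + 1)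
    {x z : ℂ} {M : ℝ} (hM : 1 ≤ M) (hx : ‖x‖ ≤ M) (hz : ‖z‖ ≤ M) :
    ‖padeForm a c n x z‖ ≤ (64 * M) ^ (N + 1) := by
  have hterm : ∀ k ∈ Finset.range (n + 1),
      ‖(-1 : ℂ) ^ k * ((a + k).choose k : ℂ) * ((2 * a + c + 1).choose (n - k) : ℂ) * x ^ k *
        z ^ (n - k)‖ ≤ 2 ^ (2 * (N + 1)) * 2 ^ (3 * (N + 1)) * M ^ (N + 1) := by
    intro k hk
    have hk' : k ≤ n := Nat.lt_succ_iff.mp (Finset.mem_range.mp hk)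
    have h1 : (((a + k).choose k : ℕ) : ℝ) ≤ 2 ^ (2 * (N + 1)) := by
      have : (a + k).choose k ≤ 2 ^ (2 * (N + 1)) :=
        (Nat.choose_le_two_pow _ _).trans (Nat.pow_le_pow_right (by norm_num) (by omega))
      exact_mod_cast this
    have h2 : (((2 * a + c + 1).choose (n - k) : ℕ) : ℝ) ≤ 2 ^ (3 * (N + 1)) := by
      have : (2 * a + c + 1).choose (n - k) ≤ 2 ^ (3 * (N + 1)) :=
        (Nat.choose_le_two_pow _ _).trans (Nat.pow_le_pow_right (by norm_num) (by omega))
      exact_mod_cast this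
    have h3 : ‖x‖ ^ k * ‖z‖ ^ (n - k) ≤ M ^ (N + 1) := by
      calc ‖x‖ ^ k * ‖z‖ ^ (n - k) ≤ M ^ k * M ^ (n - k) := by gcongr
        _ = M ^ n := by rw [← pow_add, Nat.add_sub_cancel' hk']
        _ ≤ M ^ (N + 1) := pow_le_pow_right₀ hM hn
    simp only [norm_mul, norm_pow, norm_neg, norm_one, one_pow, one_mul, Complex.norm_natCast]
    rw [mul_assoc (_ * _)]
    gcongr
  refine (norm_sum_le _ _).trans ((Finset.sum_le_card_nsmul _ _ _ hterm).trans ?_)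
  have h4 : ((n + 1 : ℕ) : ℝ) ≤ 2 ^ (N + 1) := by
    have : n + 1 ≤ 2 ^ (N + 1) := (by omega : n + 1 ≤ N + 1 + 1).trans Nat.lt_two_pow_self
    exact_mod_cast this
  rw [Finset.card_range, nsmul_eq_mul]
  calc _ ≤ (2 : ℝ) ^ (N + 1) * (2 ^ (2 * (N + 1)) * 2 ^ (3 * (N + 1)) * M ^ (N + 1)) := by
        gcongr
    _ = (64 * M) ^ (N + 1) := by
        rw [mul_pow, show (64 : ℝ) = 2 ^ 6 by norm_num, ← pow_mul, ← mul_assoc, ← pow_add, ← pow_add]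
        congr 2
        ring

/-- A non-proportional Padé relation at a given point. -/
theorem exists_pade_relation {F : Type*} [Field F] [CharZero F] (N : ℕ) {z₁ z₂ : F}
    (hz : z₁ + z₂ = 1) (hz₂ : z₂ ≠ 0) (w : F) :
    ∃ a c n₁ n₂ : ℕ, a ≤ N + 1 ∧ a + c ≤ 2 * N + 1 ∧ n₁ ≤ N + 1 ∧ n₂ ≤ N + 1 ∧
      padeForm a c n₁ z₁ 1 * z₁ ^ (2 * N + 2) +
        (-1) ^ c * padeForm a c n₁ z₂ 1 * z₂ ^ (2 * N + 2) = padeForm a c n₂ 1 z₁ ∧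
      padeForm a c n₁ z₁ 1 - padeForm a c n₂ 1 z₁ * w ≠ 0 := by
  obtain rfl : z₂ = 1 - z₁ := by rw [← hz]; ring
  have hne : z₁ ≠ 1 := by rintro rfl; simp at hz₂
  have hdet := padeForm_det_ne_zero N z₁ hne
  have h1 := padeForm_identity (N + 1) N z₁ 1
  have h2 := padeForm_identity N (N + 1) z₁ 1
  by_cases h : padeForm (N + 1) N (N + 1) z₁ 1 - padeForm (N + 1) N N 1 z₁ * w = 0
  · refine ⟨N, N + 1, N, N + 1, by omega, by omega, by omega, by omega, ?_, ?_⟩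
    · rw [one_pow, one_mul] at h2
      rw [← h2]; ring
    · intro h'
      apply hdet
      linear_combination padeForm N (N + 1) (N + 1) 1 z₁ * h - padeForm (N + 1) N N 1 z₁ * h'
  · refine ⟨N + 1, N, N + 1, N, by omega, by omega, by omega, by omega, ?_, h⟩
    rw [one_pow, one_mul] at h1
    rw [← h1]; ring

theorem norm_mul_pow_le_of_relation {N : ℕ} {c₀ M T : ℝ} (hc₀ : 1 ≤ c₀) {a b u₁ u₂ s t l A B C : ℂ}
    (ha : a ≠ 0) (hb : b ≠ 0) (ha' : ‖a⁻¹‖ ≤ c₀) (hb' : ‖b⁻¹‖ ≤ c₀)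
    (hM : M = max 1 (max ‖u₁‖ ‖u₂‖)) (hT : T = max 1 (max ‖s‖ ‖t‖))
    (hA : ‖A‖ ≤ (64 * (c₀ * M)) ^ (N + 1)) (hB : ‖B‖ ≤ (64 * (c₀ * M)) ^ (N + 1))
    (hC : ‖C‖ ≤ (64 * (c₀ * M)) ^ (N + 1))
    (h1 : A - C * (a⁻¹ ^ (2 * N + 1) * s) = l * (b * u₂) ^ (2 * N + 2))
    (h2 : B - C * (b⁻¹ ^ (2 * N + 1) * t) = -(l * (a * u₁) ^ (2 * N + 2)))
    (h3 : A * (b⁻¹ ^ (2 * N + 1) * t) - B * (a⁻¹ ^ (2 * N + 1) * s) = l) :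
    ‖l‖ * M ^ (N + 1) ≤ (128 * c₀ ^ 5) ^ (N + 1) * T := by
  have hM1 : 1 ≤ M := hM ▸ le_max_left _ _
  have hT1 : 1 ≤ T := hT ▸ le_max_left _ _
  have hs : ‖s‖ ≤ T := hT ▸ (le_max_left _ _).trans (le_max_right _ _)
  have ht : ‖t‖ ≤ T := hT ▸ (le_max_right _ _).trans (le_max_right _ _)
  set Q := (64 * (c₀ * M)) ^ (N + 1) with hQ
  set W := c₀ ^ (2 * N + 2) * T with hW
  have hcW : (1 : ℝ) ≤ c₀ ^ (2 * N + 2) := one_le_pow₀ hc₀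
  have hW1 : 1 ≤ W := one_le_mul_of_one_le_of_one_le hcW hT1
  have hQ0 : 0 ≤ Q := by positivity
  have hw : ∀ {x y : ℂ}, ‖x‖ ≤ c₀ → ‖y‖ ≤ T → ‖x ^ (2 * N + 1) * y‖ ≤ W := by
    intro x y hx hy
    rw [norm_mul, norm_pow]
    have : ‖x‖ ^ (2 * N + 1) ≤ c₀ ^ (2 * N + 2) :=
      (pow_le_pow_left₀ (norm_nonneg _) hx _).trans (pow_le_pow_right₀ hc₀ (by omega))
    rw [hW]
    gcongr
  have hw1 := hw ha' hs
  have hw2 := hw hb' ht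
  have hmul : ∀ {x y : ℂ}, ‖x‖ ≤ Q → ‖y‖ ≤ W → ‖x * y‖ ≤ Q * W := by
    intro x y hx hy
    rw [norm_mul]
    exact mul_le_mul hx hy (norm_nonneg _) hQ0
  have hle : Q ≤ Q * W := le_mul_of_one_le_right hQ0 hW1
  have b0 : ‖l‖ ≤ 2 * (Q * W) := by
    rw [← h3]
    refine (norm_sub_le _ _).trans ?_
    linarith [hmul hA hw2, hmul hB hw1]
  have hcancel : ∀ {x u : ℂ}, x ≠ 0 → ‖x⁻¹‖ ≤ c₀ → ‖l * (x * u) ^ (2 * N + 2)‖ ≤ 2 * (Q * W) →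
      ‖l‖ * ‖u‖ ^ (2 * N + 2) ≤ 2 * (Q * W) * c₀ ^ (2 * N + 2) := by
    intro x u hx hx' h
    have e : ‖l‖ * ‖u‖ ^ (2 * N + 2) = ‖l * (x * u) ^ (2 * N + 2)‖ * ‖x⁻¹‖ ^ (2 * N + 2) := by
      rw [← norm_pow, ← norm_pow, ← norm_mul, ← norm_mul]
      rw [mul_pow, mul_assoc, mul_right_comm, ← mul_pow x, mul_inv_cancel₀ hx, one_pow, one_mul]
    rw [e]
    gcongr
  have b2 : ‖l‖ * ‖u₂‖ ^ (2 * N + 2) ≤ 2 * (Q * W) * c₀ ^ (2 * N + 2) := by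
    refine hcancel hb hb' ?_
    rw [← h1]
    refine (norm_sub_le _ _).trans ?_
    linarith [hmul hC hw1]
  have b1 : ‖l‖ * ‖u₁‖ ^ (2 * N + 2) ≤ 2 * (Q * W) * c₀ ^ (2 * N + 2) := by
    refine hcancel ha ha' ?_
    rw [← norm_neg, ← h2]
    refine (norm_sub_le _ _).trans ?_
    linarith [hmul hC hw2]
  have b3 : ‖l‖ * M ^ (2 * N + 2) ≤ 2 * (Q * W) * c₀ ^ (2 * N + 2) := by
    have hQW : 0 ≤ 2 * (Q * W) := by positivity
    rcases max_choice (1 : ℝ) (max ‖u₁‖ ‖u₂‖) with h | h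
    · rw [hM, h, one_pow, mul_one]
      exact b0.trans (le_mul_of_one_le_right hQW hcW)
    · rcases max_choice ‖u₁‖ ‖u₂‖ with h' | h' <;> rw [hM, h, h'] <;> assumption
  have hMpos : 0 < M ^ (N + 1) := by positivity
  refine le_of_mul_le_mul_right ?_ hMpos
  calc ‖l‖ * M ^ (N + 1) * M ^ (N + 1) = ‖l‖ * M ^ (2 * N + 2) := by ring
    _ ≤ _ := b3
    _ = 2 * 64 ^ (N + 1) * (c₀ ^ 5) ^ (N + 1) * T * M ^ (N + 1) := by rw [hQ, hW]; ring
    _ ≤ 2 ^ (N + 1) * 64 ^ (N + 1) * (c₀ ^ 5) ^ (N + 1) * T * M ^ (N + 1) := by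
        have : (2 : ℝ) ≤ 2 ^ (N + 1) := le_self_pow₀ (by norm_num) (by omega)
        gcongr
    _ = _ := by
        rw [mul_pow 128, show (128 : ℝ) = 2 * 64 by norm_num, mul_pow 2 64]

theorem one_le_prod_norm_embeddings {K : Type*} [Field K] [NumberField K] {x : K} (hx : x ≠ 0)
    (hi : IsIntegral ℤ x) : 1 ≤ ∏ σ : K →ₐ[ℚ] ℂ, ‖σ x‖ := by
  rw [← norm_prod, ← Algebra.norm_eq_prod_embeddings ℚ ℂ x]
  obtain ⟨n, hn⟩ := IsIntegrallyClosed.isIntegral_iff.mp (Algebra.isIntegral_norm ℚ hi)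
  have hne : Algebra.norm ℚ x ≠ 0 := Algebra.norm_ne_zero_iff.mpr hx
  rw [← hn]
  rw [← hn] at hne
  have hn0 : n ≠ 0 := by rintro rfl; simp at hne
  simp only [algebraMap_int_eq, eq_intCast, eq_ratCast, Rat.cast_intCast, Complex.norm_intCast]
  exact_mod_cast Int.one_le_abs hn0

/-- The archimedean logarithmic height of `(1 : x : y)`. -/
noncomputable def archHeight {K : Type*} [Field K] [NumberField K] (x y : K) : ℝ :=
  ∑ σ : K →ₐ[ℚ] ℂ, Real.log (max 1 (max ‖σ x‖ ‖σ y‖))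

theorem exists_common_denominator {K : Type*} [Field K] [NumberField K] (s : Finset K) :
    ∃ g : ℕ, g ≠ 0 ∧ ∀ x ∈ s, IsIntegral ℤ ((g : K) * x) := by
  obtain ⟨y, hy, h⟩ := exists_integral_multiples ℤ ℚ s
  refine ⟨y.natAbs, Int.natAbs_ne_zero.mpr hy, fun x hx => ?_⟩
  have := h x hx
  rw [zsmul_eq_mul] at this
  rcases Int.natAbs_eq y with e | e <;> rw [e] at this
  · simpa using this
  · simpa using this.neg

theorem exists_archHeight_le {K : Type*} [Field K] [NumberField K] {a b : K} (ha : a ≠ 0)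
    (hb : b ≠ 0) : ∃ c : ℝ, ∀ u₁ u₂ s t : (𝓞 K)ˣ, ∀ N : ℕ,
      a * (u₁ : K) + b * (u₂ : K) = 1 →
      a * ((s : K) * (u₁ : K) ^ (2 * N + 2)) + b * ((t : K) * (u₂ : K) ^ (2 * N + 2)) = 1 →
      (N + 1) * archHeight (u₁ : K) (u₂ : K) ≤ archHeight (s : K) (t : K) + (N + 1) * c := by
  classical
  obtain ⟨g, hg, hgi⟩ := exists_common_denominator {a, b, a⁻¹, b⁻¹}
  have hga : IsIntegral ℤ ((g : K) * a) := hgi _ (by simp)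
  have hgb : IsIntegral ℤ ((g : K) * b) := hgi _ (by simp)
  have hga' : IsIntegral ℤ ((g : K) * a⁻¹) := hgi _ (by simp)
  have hgb' : IsIntegral ℤ ((g : K) * b⁻¹) := hgi _ (by simp)
  have hgK : (g : K) ≠ 0 := Nat.cast_ne_zero.mpr hg
  have hgint : IsIntegral ℤ (g : K) := isIntegral_natCast g
  obtain ⟨c₀, hc₀, hc⟩ : ∃ c₀ : ℝ, 1 ≤ c₀ ∧ ∀ σ : K →ₐ[ℚ] ℂ,
      ‖σ a‖ ≤ c₀ ∧ ‖σ b‖ ≤ c₀ ∧ ‖(σ a)⁻¹‖ ≤ c₀ ∧ ‖(σ b)⁻¹‖ ≤ c₀ := by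
    refine ⟨1 + ∑ σ : K →ₐ[ℚ] ℂ, (‖σ a‖ + ‖σ b‖ + ‖(σ a)⁻¹‖ + ‖(σ b)⁻¹‖),
      le_add_of_nonneg_right (Finset.sum_nonneg fun _ _ => by positivity), fun σ => ?_⟩
    have := Finset.single_le_sum
      (f := fun σ : K →ₐ[ℚ] ℂ => ‖σ a‖ + ‖σ b‖ + ‖(σ a)⁻¹‖ + ‖(σ b)⁻¹‖)
      (fun _ _ => by positivity) (Finset.mem_univ σ)
    have := norm_nonneg (σ a)
    have := norm_nonneg (σ b)
    have := norm_nonneg (σ a)⁻¹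
    have := norm_nonneg (σ b)⁻¹
    refine ⟨?_, ?_, ?_, ?_⟩ <;> linarith
  set c₁ : ℝ := (g : ℝ) ^ 5 * (128 * c₀ ^ 5)
  have hc₁ : 0 < c₁ := by positivity
  refine ⟨∑ _σ : K →ₐ[ℚ] ℂ, Real.log c₁, fun u₁ u₂ s t N h1 h2 => ?_⟩
  have hu₁ : (u₁ : K) ≠ 0 := by simp
  have hu₂ : (u₂ : K) ≠ 0 := by simp
  have hiu : ∀ u : (𝓞 K)ˣ, IsIntegral ℤ (u : K) := fun u => (u : 𝓞 K).isIntegral_coe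
  have hw : (a⁻¹ ^ (2 * N + 1) * (s : K)) * (a * u₁) ^ (2 * N + 2) +
      (b⁻¹ ^ (2 * N + 1) * (t : K)) * (b * u₂) ^ (2 * N + 2) = 1 := by
    have e : ∀ {x y z : K}, x ≠ 0 →
        x⁻¹ ^ (2 * N + 1) * y * (x * z) ^ (2 * N + 2) = x * (y * z ^ (2 * N + 2)) := by
      intro x y z hx
      have : x⁻¹ ^ (2 * N + 1) * x ^ (2 * N + 1) = 1 := by
        rw [← mul_pow, inv_mul_cancel₀ hx, one_pow]
      rw [mul_pow, pow_succ x (2 * N + 1)]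
      linear_combination x * y * z ^ (2 * N + 2) * this
    rw [e ha, e hb, h2]
  obtain ⟨p, q, n₁, n₂, hp, hpq, hn₁, hn₂, hrel, hne⟩ :=
    exists_pade_relation N h1 (mul_ne_zero hb hu₂) (a⁻¹ ^ (2 * N + 1) * (s : K))
  set A := padeForm p q n₁ (a * (u₁ : K)) 1 with hA
  set B := (-1) ^ q * padeForm p q n₁ (b * (u₂ : K)) 1 with hB
  set C := padeForm p q n₂ 1 (a * (u₁ : K)) with hC
  set w₁ := a⁻¹ ^ (2 * N + 1) * (s : K) with hw₁
  set w₂ := b⁻¹ ^ (2 * N + 1) * (t : K) with hw₂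
  have hz₁ : (a * (u₁ : K)) ^ (2 * N + 2) ≠ 0 := pow_ne_zero _ (mul_ne_zero ha hu₁)
  have hz₂ : (b * (u₂ : K)) ^ (2 * N + 2) ≠ 0 := pow_ne_zero _ (mul_ne_zero hb hu₂)
  set l := (A - C * w₁) * ((b * (u₂ : K)) ^ (2 * N + 2))⁻¹ with hl
  have hl0 : l ≠ 0 := mul_ne_zero hne (inv_ne_zero hz₂)
  have r1 : A - C * w₁ = l * (b * (u₂ : K)) ^ (2 * N + 2) := by
    rw [hl, mul_assoc, inv_mul_cancel₀ hz₂, mul_one]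
  have r2 : B - C * w₂ = -(l * (a * (u₁ : K)) ^ (2 * N + 2)) := by
    apply mul_right_cancel₀ hz₂
    linear_combination hrel - C * hw - (a * (u₁ : K)) ^ (2 * N + 2) * r1
  have r3 : A * w₂ - B * w₁ = l := by
    linear_combination w₂ * r1 - w₁ * r2 + l * hw
  have hintg : IsIntegral ℤ ((g : K) ^ (5 * (N + 1)) * l) := by
    have e : (g : K) ^ (5 * (N + 1)) * l =
        (g ^ (2 * N + 2) * (g ^ (N + 1) * A) -
          (g ^ (N + 1) * C) * (g * (g * a⁻¹) ^ (2 * N + 1) * (s : K))) *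
          ((g * b⁻¹) ^ (2 * N + 2) * ((u₂⁻¹ : (𝓞 K)ˣ) : K) ^ (2 * N + 2)) := by
      rw [hl, hw₁, mul_pow b, mul_inv, ← inv_pow, ← inv_pow, mul_pow, mul_pow]
      simp only [map_units_inv]
      ring
    rw [e]
    have i1 := isIntegral_pow_mul_padeForm p q hn₁ hgint
      (x := a * (u₁ : K)) (z := 1) (by rw [← mul_assoc]; exact hga.mul (hiu _)) (by simpa)
    have i2 := isIntegral_pow_mul_padeForm p q hn₂ hgint
      (z := a * (u₁ : K)) (x := 1) (by simpa) (by rw [← mul_assoc]; exact hga.mul (hiu _))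
    exact (((hgint.pow _).mul i1).sub (i2.mul ((hgint.mul (hga'.pow _)).mul (hiu s)))).mul
      ((hgb'.pow _).mul ((hiu _).pow _))
  have hprod := one_le_prod_norm_embeddings (mul_ne_zero (pow_ne_zero _ hgK) hl0) hintg
  have hloc : ∀ σ : K →ₐ[ℚ] ℂ, ‖σ ((g : K) ^ (5 * (N + 1)) * l)‖ *
      max 1 (max ‖σ u₁‖ ‖σ u₂‖) ^ (N + 1) ≤ c₁ ^ (N + 1) * max 1 (max ‖σ s‖ ‖σ t‖) := by
    intro σ
    obtain ⟨ca, cb, ca', cb'⟩ := hc σ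
    set M := max 1 (max ‖σ u₁‖ ‖σ u₂‖) with hM
    have hM1 : 1 ≤ M := le_max_left _ _
    have hcM : 1 ≤ c₀ * M := one_le_mul_of_one_le_of_one_le hc₀ hM1
    have n1 : ‖σ (a * u₁)‖ ≤ c₀ * M := by
      rw [map_mul, norm_mul]
      exact mul_le_mul ca ((le_max_left _ _).trans (le_max_right _ _)) (norm_nonneg _)
        (by positivity)
    have n2 : ‖σ (b * u₂)‖ ≤ c₀ * M := by
      rw [map_mul, norm_mul]
      exact mul_le_mul cb ((le_max_right _ _).trans (le_max_right _ _)) (norm_nonneg _)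
        (by positivity)
    have hmap : ∀ n x z, σ (padeForm p q n x z) = padeForm p q n (σ x) (σ z) :=
      fun n x z => map_padeForm (σ : K →+* ℂ) p q n x z
    have nA : ‖σ A‖ ≤ (64 * (c₀ * M)) ^ (N + 1) := by
      rw [hA, hmap]
      exact norm_padeForm_le hp hpq hn₁ hcM n1 (by simpa)
    have nB : ‖σ B‖ ≤ (64 * (c₀ * M)) ^ (N + 1) := by
      rw [hB, map_mul, hmap, norm_mul]
      simpa using norm_padeForm_le hp hpq hn₁ hcM n2 (z := 1) (by simpa)
    have nC : ‖σ C‖ ≤ (64 * (c₀ * M)) ^ (N + 1) := by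
      rw [hC, hmap]
      exact norm_padeForm_le hp hpq hn₂ hcM (by simpa) n1
    have key := norm_mul_pow_le_of_relation (l := σ l) (N := N) (T := max 1 (max ‖σ s‖ ‖σ t‖))
      hc₀ ((map_ne_zero σ).mpr ha) ((map_ne_zero σ).mpr hb) ca' cb' hM rfl nA nB nC
      (by simpa [hw₁] using congrArg σ r1) (by simpa [hw₂] using congrArg σ r2)
      (by simpa only [hw₁, hw₂, map_sub, map_mul, map_pow, map_inv₀] using congrArg σ r3)
    calc _ = (g : ℝ) ^ (5 * (N + 1)) * (‖σ l‖ * M ^ (N + 1)) := by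
          rw [map_mul, norm_mul, map_pow, map_natCast, norm_pow, Complex.norm_natCast, mul_assoc]
      _ ≤ (g : ℝ) ^ (5 * (N + 1)) *
          ((128 * c₀ ^ 5) ^ (N + 1) * max 1 (max ‖σ s‖ ‖σ t‖)) := by gcongr
      _ = _ := by rw [mul_pow ((g : ℝ) ^ 5), ← pow_mul, mul_assoc]
  have hposM : ∀ (x y : K) (σ : K →ₐ[ℚ] ℂ), (0 : ℝ) < max 1 (max ‖σ x‖ ‖σ y‖) :=
    fun x y σ => lt_of_lt_of_le one_pos (le_max_left _ _)
  have hfin : ∏ σ : K →ₐ[ℚ] ℂ, max 1 (max ‖σ u₁‖ ‖σ u₂‖) ^ (N + 1) ≤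
      ∏ σ : K →ₐ[ℚ] ℂ, c₁ ^ (N + 1) * max 1 (max ‖σ s‖ ‖σ t‖) := by
    calc _ ≤ (∏ σ : K →ₐ[ℚ] ℂ, ‖σ ((g : K) ^ (5 * (N + 1)) * l)‖) *
          ∏ σ : K →ₐ[ℚ] ℂ, max 1 (max ‖σ u₁‖ ‖σ u₂‖) ^ (N + 1) :=
          le_mul_of_one_le_left (Finset.prod_nonneg fun σ _ => (pow_pos (hposM _ _ σ) _).le) hprod
      _ = ∏ σ : K →ₐ[ℚ] ℂ, ‖σ ((g : K) ^ (5 * (N + 1)) * l)‖ *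
          max 1 (max ‖σ u₁‖ ‖σ u₂‖) ^ (N + 1) := Finset.prod_mul_distrib.symm
      _ ≤ _ := Finset.prod_le_prod (fun σ _ =>
          mul_nonneg (norm_nonneg _) (pow_pos (hposM _ _ σ) _).le) (fun σ _ => hloc σ)
  have hlog := Real.log_le_log (Finset.prod_pos fun σ _ => pow_pos (hposM _ _ σ) _) hfin
  rw [Real.log_prod (fun σ _ => (pow_pos (hposM _ _ σ) _).ne'),
    Real.log_prod (fun σ _ => (mul_pos (pow_pos hc₁ _) (hposM _ _ σ)).ne')] at hlog
  simp_rw [Real.log_pow] at hlog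
  rw [← Finset.mul_sum] at hlog
  have e2 : ∑ σ : K →ₐ[ℚ] ℂ, Real.log (c₁ ^ (N + 1) * max 1 (max ‖σ s‖ ‖σ t‖)) =
      archHeight (s : K) (t : K) + (N + 1) * ∑ _σ : K →ₐ[ℚ] ℂ, Real.log c₁ := by
    rw [archHeight, Finset.mul_sum, ← Finset.sum_add_distrib]
    refine Finset.sum_congr rfl fun σ _ => ?_
    rw [Real.log_mul (pow_pos hc₁ _).ne' (hposM _ _ σ).ne', Real.log_pow]
    push_cast
    ring
  rw [e2] at hlog
  exact_mod_cast hlog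

theorem exists_norm_sub_smul_le {ι V : Type*} [NormedAddCommGroup V] [NormedSpace ℝ V]
    [ProperSpace V] (L : ι → V) {S : Set ι} (hS : S.Infinite)
    (hfin : ∀ B : ℝ, {i ∈ S | ‖L i‖ ≤ B}.Finite) {ε : ℝ} (hε : 0 < ε) (R : ℝ) (n₀ : ℕ) :
    ∃ p ∈ S, ∃ q ∈ S, ∃ n : ℕ, n₀ ≤ n ∧ R < ‖L p‖ ∧
      ‖L q - (2 * n : ℝ) • L p‖ ≤ (ε * (n + 1) + 2) * ‖L p‖ := by
  obtain ⟨t, -, ht, hcover⟩ := (isCompact_closedBall (0 : V) 1).finite_cover_balls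
    (e := ε / 4) (by positivity)
  set φ : ι → V := fun i => ‖L i‖⁻¹ • L i
  have hφ : ∀ i, ‖φ i‖ ≤ 1 := by
    intro i
    simp only [φ, norm_smul, norm_inv, norm_norm]
    exact inv_mul_le_one
  obtain ⟨x, -, hx⟩ : ∃ x ∈ t, {i ∈ S | φ i ∈ Metric.ball x (ε / 4)}.Infinite := by
    by_contra! h
    refine hS ((ht.biUnion fun x hx => h x hx).subset fun i hi => ?_)
    obtain ⟨x, hx, hix⟩ := Set.mem_iUnion₂.mp (hcover (by simpa using hφ i : φ i ∈ _))
    exact Set.mem_iUnion₂.mpr ⟨x, hx, hi, hix⟩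
  have hbig : ∀ B : ℝ, ∃ i ∈ S, φ i ∈ Metric.ball x (ε / 4) ∧ B < ‖L i‖ := by
    intro B
    obtain ⟨i, hi, hi'⟩ := (hx.sdiff (hfin B)).nonempty
    exact ⟨i, hi.1, hi.2, not_le.mp fun h => hi' ⟨hi.1, h⟩⟩
  obtain ⟨p, hp, hpx, hpR⟩ := hbig (max R 0)
  have hp0 : 0 < ‖L p‖ := (le_max_right _ _).trans_lt hpR
  obtain ⟨q, hq, hqx, hqR⟩ := hbig (2 * ‖L p‖ * n₀)
  set n := ⌊‖L q‖ / (2 * ‖L p‖)⌋₊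
  have h1 : (n : ℝ) * (2 * ‖L p‖) ≤ ‖L q‖ :=
    (le_div_iff₀ (by positivity)).mp (Nat.floor_le (by positivity))
  have h2 : ‖L q‖ < (n + 1) * (2 * ‖L p‖) :=
    (div_lt_iff₀ (by positivity)).mp (Nat.lt_floor_add_one _)
  refine ⟨p, hp, q, hq, n, ?_, (le_max_left _ _).trans_lt hpR, ?_⟩
  · exact Nat.le_floor ((le_div_iff₀ (by positivity)).mpr (by linarith))
  have hq0 : ‖L q‖ ≠ 0 := by
    have : (0 : ℝ) ≤ 2 * ‖L p‖ * n₀ := by positivity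
    linarith
  have e : L q - (2 * n : ℝ) • L p =
      ‖L q‖ • (φ q - φ p) + (‖L q‖ - n * (2 * ‖L p‖)) • φ p := by
    have e1 : ‖L q‖ • φ q = L q := by simp only [φ]; rw [smul_smul, mul_inv_cancel₀ hq0, one_smul]
    have e2 : ‖L p‖ • φ p = L p := by
      simp only [φ]; rw [smul_smul, mul_inv_cancel₀ hp0.ne', one_smul]
    rw [smul_sub, e1, sub_smul]
    conv_lhs => rw [← e2]
    rw [smul_smul, show (n : ℝ) * (2 * ‖L p‖) = 2 * n * ‖L p‖ by ring]
    abel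
  have hd : ‖φ q - φ p‖ ≤ ε / 2 := by
    rw [← dist_eq_norm]
    rw [Metric.mem_ball] at hpx hqx
    linarith [dist_triangle_right (φ q) (φ p) x]
  rw [e]
  calc _ ≤ ‖L q‖ * ‖φ q - φ p‖ + (‖L q‖ - n * (2 * ‖L p‖)) * ‖φ p‖ := by
        refine (norm_add_le _ _).trans ?_
        rw [norm_smul, norm_smul, norm_norm, Real.norm_of_nonneg (by linarith)]
    _ ≤ (n + 1) * (2 * ‖L p‖) * (ε / 2) + 2 * ‖L p‖ * 1 := by
        refine add_le_add ?_ ?_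
        · gcongr
        · exact mul_le_mul (by linarith) (hφ p) (norm_nonneg _) (by positivity)
    _ = _ := by ring

/-- The logarithms of the absolute values of the conjugates of a pair. -/
noncomputable def logPair {K : Type*} [Field K] [NumberField K] (x y : K) :
    (K →ₐ[ℚ] ℂ) → ℝ × ℝ :=
  fun σ => (Real.log ‖σ x‖, Real.log ‖σ y‖)

theorem archHeight_le {K : Type*} [Field K] [NumberField K] (x y : K) :
    archHeight x y ≤ Fintype.card (K →ₐ[ℚ] ℂ) * ‖logPair x y‖ := by
  rw [archHeight, ← nsmul_eq_mul, ← Finset.card_univ]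
  refine Finset.sum_le_card_nsmul _ _ _ fun σ _ => ?_
  have h : ‖logPair x y σ‖ ≤ ‖logPair x y‖ := norm_le_pi_norm _ _
  rcases max_choice (1 : ℝ) (max ‖σ x‖ ‖σ y‖) with e | e
  · rw [e, Real.log_one]
    positivity
  · rcases max_choice ‖σ x‖ ‖σ y‖ with e' | e' <;> rw [e, e']
    · exact (Real.le_norm_self _).trans ((norm_fst_le (logPair x y σ)).trans h)
    · exact (Real.le_norm_self _).trans ((norm_snd_le (logPair x y σ)).trans h)

theorem abs_log_norm_le_of_unit {K : Type*} [Field K] [NumberField K] (u : (𝓞 K)ˣ)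
    {f : (K →ₐ[ℚ] ℂ) → ℝ} (hf : ∀ σ, 0 ≤ f σ) (huf : ∀ σ, Real.log ‖σ (u : K)‖ ≤ f σ)
    (σ : K →ₐ[ℚ] ℂ) : |Real.log ‖σ (u : K)‖| ≤ ∑ τ, f τ := by
  classical
  have hu : (u : K) ≠ 0 := by simp
  have h1 := one_le_prod_norm_embeddings hu (u : 𝓞 K).isIntegral_coe
  have h2 := Real.log_nonneg h1
  rw [Real.log_prod (fun σ _ => norm_ne_zero_iff.mpr ((map_ne_zero σ).mpr hu)),
    ← Finset.add_sum_erase _ _ (Finset.mem_univ σ)] at h2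
  rw [← Finset.add_sum_erase _ _ (Finset.mem_univ σ)]
  have h3 : ∑ τ ∈ Finset.univ.erase σ, Real.log ‖τ (u : K)‖ ≤ ∑ τ ∈ Finset.univ.erase σ, f τ :=
    Finset.sum_le_sum fun τ _ => huf τ
  have h4 : 0 ≤ ∑ τ ∈ Finset.univ.erase σ, f τ := Finset.sum_nonneg fun τ _ => hf τ
  have := hf σ
  have := huf σ
  rw [abs_le]
  constructor <;> linarith

theorem norm_logPair_le {K : Type*} [Field K] [NumberField K] (u v : (𝓞 K)ˣ) :
    ‖logPair (u : K) (v : K)‖ ≤ archHeight (u : K) (v : K) := by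
  have hf : ∀ σ : K →ₐ[ℚ] ℂ, 0 ≤ Real.log (max 1 (max ‖σ (u : K)‖ ‖σ (v : K)‖)) :=
    fun σ => Real.log_nonneg (le_max_left _ _)
  have hpos : ∀ (w : (𝓞 K)ˣ) (σ : K →ₐ[ℚ] ℂ), 0 < ‖σ (w : K)‖ := fun w σ =>
    norm_pos_iff.mpr ((map_ne_zero σ).mpr (by simp))
  refine (pi_norm_le_iff_of_nonneg (Finset.sum_nonneg fun σ _ => hf σ)).mpr fun σ => ?_
  rw [Prod.norm_def]
  refine max_le ?_ ?_
  · exact abs_log_norm_le_of_unit u hf (fun σ => Real.log_le_log (hpos u σ)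
      ((le_max_left _ _).trans (le_max_right _ _))) σ
  · exact abs_log_norm_le_of_unit v hf (fun σ => Real.log_le_log (hpos v σ)
      ((le_max_right _ _).trans (le_max_right _ _))) σ

theorem finite_units_norm_le (K : Type*) [Field K] [NumberField K] (B : ℝ) :
    {u : (𝓞 K)ˣ | ∀ σ : K →ₐ[ℚ] ℂ, ‖σ (u : K)‖ ≤ B}.Finite := by
  refine Set.Finite.of_finite_image (f := fun u : (𝓞 K)ˣ => (u : K))
    ((Embeddings.finite_of_norm_le K ℂ B).subset ?_) (Units.coe_injective K).injOn
  rintro _ ⟨u, hu, rfl⟩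
  exact ⟨(u : 𝓞 K).isIntegral_coe, fun φ => hu φ.toRatAlgHom⟩

theorem finite_norm_logPair_le (K : Type*) [Field K] [NumberField K] (B : ℝ) :
    {p : (𝓞 K)ˣ × (𝓞 K)ˣ | ‖logPair (p.1 : K) (p.2 : K)‖ ≤ B}.Finite := by
  have h := finite_units_norm_le K (Real.exp B)
  refine (h.prod h).subset fun p hp => ?_
  have hpos : ∀ (w : (𝓞 K)ˣ) (σ : K →ₐ[ℚ] ℂ), 0 < ‖σ (w : K)‖ := fun w σ =>
    norm_pos_iff.mpr ((map_ne_zero σ).mpr (by simp))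
  have hσ : ∀ σ, ‖logPair (p.1 : K) (p.2 : K) σ‖ ≤ B := fun σ => (norm_le_pi_norm _ σ).trans hp
  refine ⟨fun σ => ?_, fun σ => ?_⟩
  · rw [← Real.log_le_iff_le_exp (hpos _ _)]
    exact (Real.le_norm_self _).trans ((norm_fst_le (logPair (p.1 : K) (p.2 : K) σ)).trans (hσ σ))
  · rw [← Real.log_le_iff_le_exp (hpos _ _)]
    exact (Real.le_norm_self _).trans ((norm_snd_le (logPair (p.1 : K) (p.2 : K) σ)).trans (hσ σ))

theorem logPair_div_pow {K : Type*} [Field K] [NumberField K] (u v s t : (𝓞 K)ˣ) (m : ℕ) :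
    logPair ((s * (u ^ m)⁻¹ : (𝓞 K)ˣ) : K) ((t * (v ^ m)⁻¹ : (𝓞 K)ˣ) : K) =
      logPair (s : K) (t : K) - (m : ℝ) • logPair (u : K) (v : K) := by
  have h0 : ∀ (w : (𝓞 K)ˣ) (σ : K →ₐ[ℚ] ℂ), ‖σ (w : K)‖ ≠ 0 := fun w σ =>
    norm_ne_zero_iff.mpr ((map_ne_zero σ).mpr (by simp))
  funext σ
  have key : ∀ s u : (𝓞 K)ˣ, Real.log ‖σ ((s * (u ^ m)⁻¹ : (𝓞 K)ˣ) : K)‖ =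
      Real.log ‖σ (s : K)‖ - m * Real.log ‖σ (u : K)‖ := by
    intro s u
    have e : ‖σ ((s * (u ^ m)⁻¹ : (𝓞 K)ˣ) : K)‖ = ‖σ (s : K)‖ * (‖σ (u : K)‖ ^ m)⁻¹ := by
      simp
    rw [e, Real.log_mul (h0 s σ) (inv_ne_zero (pow_ne_zero _ (h0 u σ))), Real.log_inv, Real.log_pow]
    ring
  simp only [logPair, Pi.sub_apply, Pi.smul_apply, key, Prod.smul_mk, Prod.mk_sub_mk, smul_eq_mul]

/-- **Siegel's theorem** on unit equations in two unknowns over a number field. -/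
theorem finite_unit_equation {K : Type*} [Field K] [NumberField K] {a b : K} (ha : a ≠ 0)
    (hb : b ≠ 0) : {p : (𝓞 K)ˣ × (𝓞 K)ˣ | a * (p.1 : K) + b * (p.2 : K) = 1}.Finite := by
  by_contra hinf
  obtain ⟨c, hc⟩ := exists_archHeight_le ha hb
  set d : ℝ := (Fintype.card (K →ₐ[ℚ] ℂ) : ℝ) with hd
  have hd0 : 0 < d := by
    rw [hd, AlgHom.card]
    exact_mod_cast Module.finrank_pos
  obtain ⟨p, hp, q, hq, n, hn, hR, hle⟩ := exists_norm_sub_smul_le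
    (fun p : (𝓞 K)ˣ × (𝓞 K)ˣ => logPair (p.1 : K) (p.2 : K)) hinf
    (fun B => (finite_norm_logPair_le K B).subset fun _ h => h.2)
    (ε := 1 / (4 * d)) (by positivity) (max (4 * c) 0) (8 * Fintype.card (K →ₐ[ℚ] ℂ) + 1)
  obtain ⟨N, rfl⟩ : ∃ N, n = N + 1 := ⟨n - 1, by omega⟩
  have hn' : 8 * d ≤ N := by
    have : 8 * Fintype.card (K →ₐ[ℚ] ℂ) ≤ N := by omega
    rw [hd]
    exact_mod_cast this
  have h1 := hc p.1 p.2 (q.1 * (p.1 ^ (2 * N + 2))⁻¹) (q.2 * (p.2 ^ (2 * N + 2))⁻¹) N hp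
    (by simpa [mul_assoc] using hq)
  have h2 := archHeight_le ((q.1 * (p.1 ^ (2 * N + 2))⁻¹ : (𝓞 K)ˣ) : K)
    ((q.2 * (p.2 ^ (2 * N + 2))⁻¹ : (𝓞 K)ˣ) : K)
  rw [logPair_div_pow, ← hd] at h2
  have h3 := norm_logPair_le (K := K) p.1 p.2
  set ℓ := ‖logPair (p.1 : K) (p.2 : K)‖
  push_cast at hle
  rw [show ((2 * N + 2 : ℕ) : ℝ) = 2 * (N + 1) by push_cast; ring] at h2
  have hℓ : 0 < ℓ := (le_max_right _ _).trans_lt hR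
  have hℓc : 4 * c < ℓ := (le_max_left _ _).trans_lt hR
  have h4 : d * ((1 / (4 * d) * ((N : ℝ) + 1 + 1) + 2) * ℓ) = ((N + 2) / 4 + 2 * d) * ℓ := by
    field_simp
    ring
  have h5 := mul_le_mul_of_nonneg_left hle hd0.le
  rw [h4] at h5
  have hN0 : (0 : ℝ) ≤ N := Nat.cast_nonneg N
  have h6 : (N + 1 : ℝ) * ℓ ≤ ((N + 2) / 4 + 2 * d) * ℓ + (N + 1) * c :=
    (mul_le_mul_of_nonneg_left h3 (by positivity)).trans (by linarith)
  nlinarith [mul_le_mul_of_nonneg_right hn' hℓ.le, mul_pos (by positivity : (0 : ℝ) < N + 1)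
    (sub_pos.mpr hℓc)]

theorem Finset.prod_offDiag_image {α β M : Type*} [DecidableEq α] [DecidableEq β] [CommMonoid M]
    {s : Finset α} {g : α → β} (hg : Set.InjOn g s) (F : β × β → M) :
    ∏ p ∈ (s.image g).offDiag, F p = ∏ p ∈ s.offDiag, F (g p.1, g p.2) := by
  symm
  refine Finset.prod_bij (fun p _ => (g p.1, g p.2)) ?_ ?_ ?_ fun _ _ => rfl
  · rintro ⟨a, b⟩ h
    simp only [Finset.mem_offDiag] at h ⊢
    exact ⟨Finset.mem_image_of_mem g h.1, Finset.mem_image_of_mem g h.2.1,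
      fun e => h.2.2 (hg h.1 h.2.1 e)⟩
  · rintro ⟨a, b⟩ h ⟨a', b'⟩ h' e
    simp only [Finset.mem_offDiag, Prod.mk.injEq] at h h' e ⊢
    exact ⟨hg h.1 h'.1 e.1, hg h.2.1 h'.2.1 e.2⟩
  · rintro ⟨x, y⟩ h
    simp only [Finset.mem_offDiag, Finset.mem_image] at h
    obtain ⟨⟨a, ha, rfl⟩, ⟨b, hb, rfl⟩, hab⟩ := h
    exact ⟨(a, b), Finset.mem_offDiag.mpr ⟨ha, hb, fun e => hab (congrArg g e)⟩, rfl⟩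

/-- The product of all differences of ordered pairs of distinct elements of a finite set. -/
def diffProd {R : Type*} [CommRing R] [DecidableEq R] (s : Finset R) : R :=
  ∏ p ∈ s.offDiag, (p.1 - p.2)

theorem diffProd_image {R S : Type*} [CommRing R] [CommRing S] [DecidableEq R] [DecidableEq S]
    {f : R →+* S} (hf : Function.Injective f) (s : Finset R) :
    diffProd (s.image f) = f (diffProd s) := by
  rw [diffProd, Finset.prod_offDiag_image hf.injOn, diffProd, map_prod]
  simp

theorem diffProd_image_sub_div {K : Type*} [Field K] [DecidableEq K] (s : Finset K) (b : K) {δ : K}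
    (hδ : δ ≠ 0) :
    δ ^ ((s.image fun a => (a - b) / δ).offDiag.card) *
      diffProd (s.image fun a => (a - b) / δ) = diffProd s := by
  have hinj : Function.Injective fun a => (a - b) / δ := fun x y h => by
    simpa [div_left_inj' hδ] using h
  have hc : (s.image fun a => (a - b) / δ).offDiag.card = s.offDiag.card := by
    rw [Finset.offDiag_card, Finset.offDiag_card, Finset.card_image_of_injective _ hinj]
  rw [hc, diffProd, Finset.prod_offDiag_image hinj.injOn, diffProd, ← Finset.prod_const,
    ← Finset.prod_mul_distrib]
  refine Finset.prod_congr rfl fun p _ => ?_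
  field_simp
  ring

/-- Up to units, an element of a Dedekind domain has only finitely many divisors. -/
theorem exists_finite_divisors_up_to_units {R : Type*} [CommRing R] [IsDedekindDomain R] {d : R}
    (hd : d ≠ 0) : ∃ S : Set R, S.Finite ∧ (∀ r ∈ S, r ≠ 0) ∧
      ∀ x, x ∣ d → ∃ r ∈ S, ∃ u : Rˣ, x = r * u := by
  have hfin : {I : Ideal R | I ∣ Ideal.span {d}}.Finite := by
    have := UniqueFactorizationMonoid.fintypeSubtypeDvd (Ideal.span {d}) (by simpa using hd)
    exact (Set.finite_range (Subtype.val : {I // I ∣ Ideal.span {d}} → Ideal R)).subset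
      fun I hI => ⟨⟨I, hI⟩, rfl⟩
  obtain ⟨S, hS, hbij⟩ := Set.exists_subset_bijOn {x | x ∣ d} fun x : R => Ideal.span {x}
  refine ⟨S, ?_, fun r hr => ?_, fun x hx => ?_⟩
  · rw [hbij.finite_iff_finite]
    refine hfin.subset ?_
    rintro _ ⟨x, hx, rfl⟩
    exact Ideal.dvd_iff_le.mpr (Ideal.span_singleton_le_span_singleton.mpr hx)
  · rintro rfl
    exact hd (zero_dvd_iff.mp (hS hr))
  · obtain ⟨r, hr, hrx⟩ := hbij.surjOn ⟨x, hx, rfl⟩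
    obtain ⟨u, hu⟩ := Ideal.span_singleton_eq_span_singleton.mp hrx
    exact ⟨r, hr, u, hu.symm⟩

/-- If the three differences of three algebraic numbers divide a fixed nonzero algebraic integer,
then their ratios lie in a fixed finite set. -/
theorem exists_finite_ratios {K : Type*} [Field K] [NumberField K] {d : 𝓞 K} (hd : d ≠ 0) :
    ∃ T : Set K, T.Finite ∧ ∀ x y z : 𝓞 K, x ∣ d → y ∣ d → z ∣ d → x + y = z →
      (x : K) / z ∈ T := by
  obtain ⟨S, hS, hS0, hdiv⟩ := exists_finite_divisors_up_to_units hd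
  have h0 : ∀ r ∈ S, (r : K) ≠ 0 := fun r hr => by simpa using hS0 r hr
  refine ⟨⋃ r₁ ∈ S, ⋃ r₂ ∈ S, ⋃ r₃ ∈ S,
    (fun p : (𝓞 K)ˣ × (𝓞 K)ˣ => (r₁ : K) / r₃ * (p.1 : K)) ''
      {p | (r₁ : K) / r₃ * (p.1 : K) + (r₂ : K) / r₃ * (p.2 : K) = 1}, ?_, ?_⟩
  · exact hS.biUnion fun r₁ h₁ => hS.biUnion fun r₂ h₂ => hS.biUnion fun r₃ h₃ =>
      (finite_unit_equation (div_ne_zero (h0 _ h₁) (h0 _ h₃))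
        (div_ne_zero (h0 _ h₂) (h0 _ h₃))).image _
  · intro x y z hx hy hz hxyz
    obtain ⟨r₁, h₁, u₁, rfl⟩ := hdiv x hx
    obtain ⟨r₂, h₂, u₂, rfl⟩ := hdiv y hy
    obtain ⟨r₃, h₃, u₃, rfl⟩ := hdiv z hz
    have hu : ((u₃ : 𝓞 K) : K) ≠ 0 := by simp
    have hr := h0 _ h₃
    have hinv : (((u₃⁻¹ : (𝓞 K)ˣ) : 𝓞 K) : K) = ((u₃ : 𝓞 K) : K)⁻¹ := by simp
    have e : (r₁ : K) * ((u₁ : 𝓞 K) : K) + (r₂ : K) * ((u₂ : 𝓞 K) : K) =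
        (r₃ : K) * ((u₃ : 𝓞 K) : K) := by
      rw [← map_mul, ← map_mul, ← map_mul, ← map_add, hxyz]
    simp only [Set.mem_iUnion]
    refine ⟨r₁, h₁, r₂, h₂, r₃, h₃, (u₁ * u₃⁻¹, u₂ * u₃⁻¹), ?_, ?_⟩
    · simp only [Set.mem_ofPred_eq, Units.val_mul, map_mul, hinv]
      field_simp
      exact e
    · simp only [Units.val_mul, map_mul, hinv]
      field_simp

theorem exists_finite_differences {K : Type*} [Field K] [NumberField K] [DecidableEq K] {D : ℤ}
    (hD : D ≠ 0) : ∃ Δ : Set K, Δ.Finite ∧ ∀ R : Finset K, (∀ a ∈ R, IsIntegral ℤ a) →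
      (diffProd R = D ∨ diffProd R = -D) → ∀ a ∈ R, ∀ b ∈ R, a - b ∈ Δ := by
  have hDK : ((D : ℤ) : K) ≠ 0 := by exact_mod_cast hD
  obtain ⟨T, hT, hratio⟩ := exists_finite_ratios (K := K) (d := (D : 𝓞 K)) (by exact_mod_cast hD)
  set T' : Set K := insert 0 (insert 1 T)
  have hT' : T'.Finite := (hT.insert 1).insert 0
  refine ⟨insert 0 (⋃ U ∈ {U : Finset K | (U : Set K) ⊆ T' ∧ U.offDiag.Nonempty},
    {δ | δ ^ U.offDiag.card * diffProd U = D ∨ δ ^ U.offDiag.card * diffProd U = -D}), ?_, ?_⟩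
  · refine Set.Finite.insert _ (Set.Finite.biUnion ?_ ?_)
    · refine (hT'.toFinset.powerset.finite_toSet).subset fun U hU => ?_
      simpa [← Finset.coe_subset] using hU.1
    · rintro U ⟨-, hU⟩
      have hm : U.offDiag.card ≠ 0 := Finset.card_ne_zero.mpr hU
      have hpoly : ∀ v : K, v ≠ 0 → {δ : K | δ ^ U.offDiag.card * diffProd U = v}.Finite := by
        intro v hv
        by_cases hP : diffProd U = 0
        · simp [hP, hv.symm]
        refine (Polynomial.finite_setOfPred_isRoot (p := X ^ U.offDiag.card - C (v / diffProd U))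
          (X_pow_sub_C_ne_zero (Nat.pos_of_ne_zero hm) _)).subset fun δ hδ => ?_
        simp only [Set.mem_ofPred_eq] at hδ
        simp [← hδ, hP]
      exact (hpoly _ hDK).union (hpoly _ (neg_ne_zero.mpr hDK))
  · intro R hintg hR c hc b hb
    by_cases hcb : c = b
    · simp [hcb]
    have hδ : c - b ≠ 0 := sub_ne_zero.mpr hcb
    have hdvd : ∀ x ∈ R, ∀ y ∈ R, x ≠ y → ∃ z : 𝓞 K, (z : K) = x - y ∧ z ∣ (D : 𝓞 K) := by
      intro x hx y hy hxy
      have hz : IsIntegral ℤ (x - y) := (hintg x hx).sub (hintg y hy)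
      have hw : IsIntegral ℤ (∏ p ∈ R.offDiag.erase (x, y), (p.1 - p.2)) := by
        refine IsIntegral.prod _ fun p hp => ?_
        have := Finset.mem_offDiag.mp (Finset.mem_of_mem_erase hp)
        exact (hintg _ this.1).sub (hintg _ this.2.1)
      have hmul : (x - y) * ∏ p ∈ R.offDiag.erase (x, y), (p.1 - p.2) = diffProd R :=
        Finset.mul_prod_erase R.offDiag (fun p => p.1 - p.2)
          (Finset.mem_offDiag.mpr ⟨hx, hy, hxy⟩ : (x, y) ∈ R.offDiag)
      have hcast : ((D : 𝓞 K) : K) = D := map_intCast (algebraMap (𝓞 K) K) D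
      refine ⟨⟨x - y, hz⟩, rfl, ?_⟩
      rcases hR with h | h
      · refine ⟨⟨_, hw⟩, RingOfIntegers.ext ?_⟩
        exact hcast.trans (h.symm.trans hmul.symm)
      · refine (dvd_neg.mp ⟨⟨_, hw⟩, RingOfIntegers.ext ?_⟩)
        exact (congrArg Neg.neg hcast).trans (h.symm.trans hmul.symm)
    refine Or.inr (Set.mem_iUnion₂.mpr ⟨R.image fun a => (a - b) / (c - b), ⟨?_, ?_⟩, ?_⟩)
    · intro t ht
      obtain ⟨a, ha, rfl⟩ := Finset.mem_image.mp (Finset.mem_coe.mp ht)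
      by_cases hab : a = b
      · simp [T', hab]
      by_cases hac : a = c
      · simp [T', hac, hδ]
      obtain ⟨x, hx, hx'⟩ := hdvd a ha b hb hab
      obtain ⟨y, hy, hy'⟩ := hdvd c hc a ha (Ne.symm hac)
      obtain ⟨z, hz, hz'⟩ := hdvd c hc b hb hcb
      refine Or.inr (Or.inr ?_)
      rw [← hx, ← hz]
      refine hratio x y z hx' hy' hz' (RingOfIntegers.ext ?_)
      change (x : K) + (y : K) = z
      rw [hx, hy, hz]
      ring
    · refine ⟨(1, 0), Finset.mem_offDiag.mpr ⟨?_, ?_, one_ne_zero⟩⟩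
      · exact Finset.mem_image.mpr ⟨c, hc, div_self hδ⟩
      · exact Finset.mem_image.mpr ⟨b, hb, by simp⟩
    · simpa only [Set.mem_ofPred_eq, diffProd_image_sub_div R b hδ] using hR

/-- The product of the squares of the differences of the entries of a tuple is, up to sign, the
product of the differences of ordered pairs of distinct entries. -/
theorem exists_sign_prod_sq_sub_eq {R : Type*} [CommRing R] [DecidableEq R] {m : ℕ} {e : Fin m → R}
    (he : Function.Injective e) :
    ∏ p : Fin m × Fin m, (if (p.1 : ℕ) < (p.2 : ℕ) then (e p.1 - e p.2) ^ 2 else 1) =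
        diffProd (Finset.univ.image e) ∨
      ∏ p : Fin m × Fin m, (if (p.1 : ℕ) < (p.2 : ℕ) then (e p.1 - e p.2) ^ 2 else 1) =
        -diffProd (Finset.univ.image e) := by
  have hlt : ∏ p ∈ Finset.univ.offDiag with p.1 < p.2, (e p.1 - e p.2) =
      ∏ p : Fin m × Fin m with p.1 < p.2, (e p.1 - e p.2) :=
    Finset.prod_congr (by ext p; simpa using fun h => h.ne) fun _ _ => rfl
  have hgt : ∏ p ∈ Finset.univ.offDiag with ¬ p.1 < p.2, (e p.1 - e p.2) =
      ∏ p : Fin m × Fin m with p.1 < p.2, -(e p.1 - e p.2) := by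
    refine Finset.prod_bij' (fun p _ => p.swap) (fun p _ => p.swap) ?_ ?_ ?_ ?_ ?_
    · rintro ⟨i, j⟩ h
      simp at h ⊢
      omega
    · rintro ⟨i, j⟩ h
      simp at h ⊢
      omega
    · simp
    · simp
    · simp
  rw [diffProd, Finset.prod_offDiag_image he.injOn,
    ← Finset.prod_filter_mul_prod_filter_not Finset.univ.offDiag
      fun p : Fin m × Fin m => p.1 < p.2, hlt, hgt,
    Finset.prod_neg, ← Finset.prod_filter, Finset.prod_pow]
  simp only [Fin.val_fin_lt]
  rcases neg_one_pow_eq_or R (Finset.univ.filter fun p : Fin m × Fin m => p.1 < p.2).card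
    with h | h <;> rw [h]
  · left; ring
  · right; ring

/-- The set of complex roots of an integral polynomial. -/
noncomputable def complexRoots (f : ℤ[X]) : Finset ℂ :=
  (f.map (Int.castRingHom ℂ)).roots.toFinset

theorem mem_complexRoots {f : ℤ[X]} (hf : f.Monic) {α : ℂ} :
    α ∈ complexRoots f ↔ aeval α f = 0 := by
  rw [complexRoots, Multiset.mem_toFinset, mem_roots (hf.map _).ne_zero, IsRoot.def, eval_map,
    aeval_def]
  rfl

theorem nodup_roots_of_discC_ne_zero {f : ℤ[X]} (hD : discC f ≠ 0) :
    (rootList f).Nodup := by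
  rw [List.nodup_iff_injective_get]
  have h : ∀ i j : Fin (rootList f).length, i < j → (rootList f).get i ≠ (rootList f).get j := by
    intro i j hij e
    refine hD (mul_eq_zero_of_right _ (Finset.prod_eq_zero (Finset.mem_univ (i, j)) ?_))
    rw [if_pos (by exact_mod_cast hij), sub_eq_zero.mpr e, zero_pow two_ne_zero]
  intro i j e
  rcases lt_trichotomy i j with hij | hij | hij
  · exact absurd e (h i j hij)
  · exact hij
  · exact absurd e.symm (h j i hij)

theorem diffProd_complexRoots {f : ℤ[X]} (hf : f.Monic) {D : ℤ} (hD : D ≠ 0) (h : discC f = D) :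
    diffProd (complexRoots f) = D ∨ diffProd (complexRoots f) = -D := by
  have hn := nodup_roots_of_discC_ne_zero (f := f) (by rw [h]; exact_mod_cast hD)
  have himage : Finset.univ.image (rootList f).get = complexRoots f := by
    ext α
    simp only [Finset.mem_image, Finset.mem_univ, true_and, complexRoots, Multiset.mem_toFinset]
    rw [← Multiset.mem_toList]
    exact List.mem_iff_get.symm
  rw [← h, discC, hf.leadingCoeff, Int.cast_one, one_pow, one_mul, ← himage]
  rcases exists_sign_prod_sq_sub_eq (List.nodup_iff_injective_get.mp hn) with e | e
  · exact Or.inl e.symm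
  · exact Or.inr (by rw [e, neg_neg])

theorem map_eq_prod_complexRoots {f : ℤ[X]} (hf : f.Monic) {D : ℤ} (hD : D ≠ 0)
    (h : discC f = D) : f.map (Int.castRingHom ℂ) = ∏ α ∈ complexRoots f, (X - C α) := by
  have hn := nodup_roots_of_discC_ne_zero (f := f) (by rw [h]; exact_mod_cast hD)
  have hn' : (f.map (Int.castRingHom ℂ)).roots.Nodup := by
    rw [← Multiset.coe_toList (f.map (Int.castRingHom ℂ)).roots]
    exact Multiset.coe_nodup.mpr hn
  rw [complexRoots, Finset.prod, Multiset.toFinset_val, Multiset.dedup_eq_self.mpr hn']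
  exact (IsAlgClosed.splits _).eq_prod_roots_of_monic (hf.map _)

/-- The discriminant of a number field divides the discriminant of every basis consisting of
algebraic integers. -/
theorem discr_dvd_discr_basis {K ι : Type*} [Field K] [NumberField K] [Fintype ι] [DecidableEq ι]
    (b : Module.Basis ι ℚ K) (hb : ∀ i, IsIntegral ℤ (b i)) :
    ∃ c : ℚ, IsIntegral ℤ c ∧ Algebra.discr ℚ b = c * discr K := by
  set b₀ := (integralBasis K).reindex ((integralBasis K).indexEquiv b)
  refine ⟨(b₀.toMatrix b).det ^ 2, (IsIntegral.det fun i j => ?_).pow 2, ?_⟩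
  · rw [Module.Basis.toMatrix_apply, Module.Basis.repr_reindex_apply]
    obtain ⟨x, hx⟩ : ∃ x : 𝓞 K, algebraMap (𝓞 K) K x = b j := ⟨⟨b j, hb j⟩, rfl⟩
    rw [← hx, integralBasis_repr_apply]
    exact isIntegral_algebraMap
  · have h := Algebra.discr_of_matrix_vecMul (A := ℚ) b₀ (b₀.toMatrix b)
    rwa [b₀.toMatrix_map_vecMul b, Module.Basis.coe_reindex, Algebra.discr_reindex,
      ← coe_discr] at h

theorem isIntegral_of_mem_complexRoots {f : ℤ[X]} (hf : f.Monic) {α : ℂ}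
    (hα : α ∈ complexRoots f) : IsIntegral ℤ α :=
  ⟨f, hf, (mem_complexRoots hf).mp hα⟩

theorem exists_isIntegral_mul_diffProd {s t : Finset ℂ} (hst : s ⊆ t)
    (ht : ∀ a ∈ t, IsIntegral ℤ a) :
    ∃ w : ℂ, IsIntegral ℤ w ∧ diffProd t = w * diffProd s := by
  refine ⟨∏ p ∈ t.offDiag \ s.offDiag, (p.1 - p.2), IsIntegral.prod _ fun p hp => ?_, ?_⟩
  · have := Finset.mem_offDiag.mp (Finset.mem_sdiff.mp hp).1
    exact (ht _ this.1).sub (ht _ this.2.1)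
  · exact (Finset.prod_sdiff (Finset.offDiag_mono hst)).symm

theorem discr_powerBasis_eq_diffProd {K : Type*} [Field K] [NumberField K] (pb : PowerBasis ℚ K) :
    (Algebra.discr ℚ pb.basis : ℂ) =
        diffProd (Finset.univ.image fun σ : K →ₐ[ℚ] ℂ => σ pb.gen) ∨
      (Algebra.discr ℚ pb.basis : ℂ) =
        -diffProd (Finset.univ.image fun σ : K →ₐ[ℚ] ℂ => σ pb.gen) := by
  have hcard : Fintype.card (Fin pb.dim) = Fintype.card (K →ₐ[ℚ] ℂ) := by
    rw [Fintype.card_fin, AlgHom.card, pb.finrank]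
  obtain ⟨e⟩ := Fintype.card_eq.mp hcard
  have hinj : Function.Injective fun i => e i pb.gen := fun i j h => e.injective (pb.algHom_ext h)
  have himage : (Finset.univ.image fun i => e i pb.gen) =
      Finset.univ.image fun σ : K →ₐ[ℚ] ℂ => σ pb.gen := by
    ext z
    simp only [Finset.mem_image, Finset.mem_univ, true_and]
    exact (e.surjective.exists (p := fun σ => σ pb.gen = z)).symm
  have hd := Algebra.discr_powerBasis_eq_prod ℚ ℂ pb e
  have hprod : ∏ i : Fin pb.dim, ∏ j ∈ Finset.Ioi i, (e j pb.gen - e i pb.gen) ^ 2 =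
      ∏ p : Fin pb.dim × Fin pb.dim,
        if (p.1 : ℕ) < (p.2 : ℕ) then (e p.1 pb.gen - e p.2 pb.gen) ^ 2 else 1 := by
    rw [Fintype.prod_prod_type]
    refine Finset.prod_congr rfl fun i _ => ?_
    rw [← Finset.prod_filter]
    refine Finset.prod_congr (by ext j; simp) fun j _ => by ring
  rw [hprod, eq_ratCast] at hd
  rw [hd, ← himage]
  simpa only using exists_sign_prod_sq_sub_eq hinj

/-- The discriminant of a field generated by a root of `f` is at most that of `f`. -/
theorem abs_discr_le_of_powerBasis {f : ℤ[X]} (hf : f.Monic) {D : ℤ} (hD : D ≠ 0)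
    (h : discC f = D) {K : Type*} [Field K] [NumberField K] (pb : PowerBasis ℚ K)
    (hpb : aeval pb.gen f = 0) : |discr K| ≤ |D| := by
  have hintg : IsIntegral ℤ pb.gen := ⟨f, hf, hpb⟩
  obtain ⟨c, hc, hcd⟩ := discr_dvd_discr_basis pb.basis fun i => by
    rw [pb.basis_eq_pow]
    exact hintg.pow _
  have hsub : (Finset.univ.image fun σ : K →ₐ[ℚ] ℂ => σ pb.gen) ⊆ complexRoots f := by
    intro z hz
    obtain ⟨σ, -, rfl⟩ := Finset.mem_image.mp hz
    rw [mem_complexRoots hf]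
    exact (aeval_algHom_apply (σ.restrictScalars ℤ) pb.gen f).trans (by rw [hpb, map_zero])
  obtain ⟨w, hw, hwd⟩ :=
    exists_isIntegral_mul_diffProd hsub fun a => isIntegral_of_mem_complexRoots hf
  have hcC : IsIntegral ℤ (c : ℂ) := hc.map (algebraMap ℚ ℂ).toIntAlgHom
  obtain ⟨z, hz, hzd⟩ : ∃ z : ℂ, IsIntegral ℤ z ∧ (D : ℂ) = z * (discr K : ℂ) := by
    have e : (Algebra.discr ℚ pb.basis : ℂ) = c * (discr K : ℂ) := by
      rw [hcd]
      push_cast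
      rfl
    rcases diffProd_complexRoots hf hD h with h1 | h1 <;>
      rcases discr_powerBasis_eq_diffProd pb with h2 | h2
    · exact ⟨w * c, hw.mul hcC, by linear_combination hwd - h1 - w * h2 + w * e⟩
    · exact ⟨-(w * c), (hw.mul hcC).neg, by linear_combination hwd - h1 + w * h2 - w * e⟩
    · exact ⟨-(w * c), (hw.mul hcC).neg, by linear_combination h1 - hwd + w * h2 - w * e⟩
    · exact ⟨w * c, hw.mul hcC, by linear_combination h1 - hwd - w * h2 + w * e⟩
  have hdK : (discr K : ℚ) ≠ 0 := by exact_mod_cast discr_ne_zero K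
  have hzq : z = algebraMap ℚ ℂ ((D : ℚ) / discr K) := by
    have : (discr K : ℂ) ≠ 0 := by exact_mod_cast discr_ne_zero K
    simp only [eq_ratCast]
    push_cast
    rw [hzd]
    field_simp
  rw [hzq, isIntegral_algebraMap_iff (algebraMap ℚ ℂ).injective] at hz
  obtain ⟨k, hk⟩ := IsIntegrallyClosed.isIntegral_iff.mp hz
  have hk' : D = k * discr K := by
    have : (k : ℚ) = D / discr K := hk
    rw [eq_div_iff hdK] at this
    exact_mod_cast this.symm
  exact Int.le_of_dvd (abs_pos.mpr hD) ((abs_dvd_abs _ _).mpr (Dvd.intro_left k hk'.symm))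

theorem exists_field_of_roots {D : ℤ} (hD : D ≠ 0) :
    ∃ K : IntermediateField ℚ ℂ, FiniteDimensional ℚ K ∧
      ∀ f : ℤ[X], f.Monic → discC f = D → ∀ α ∈ complexRoots f, α ∈ K := by
  have hfin := finite_of_discr_bdd ℂ D.natAbs
  set S := {F : {F : IntermediateField ℚ ℂ // FiniteDimensional ℚ F} |
      haveI : NumberField F := @NumberField.mk _ _ inferInstance F.prop
      |discr F| ≤ D.natAbs}
  have : Finite S := hfin
  have hfd : ∀ F : S, FiniteDimensional ℚ F.1.1 := fun F => F.1.2
  refine ⟨⨆ F : S, F.1.1, IntermediateField.finiteDimensional_iSup_of_finite, ?_⟩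
  intro f hf h α hα
  have hintg : IsIntegral ℚ α := (isIntegral_of_mem_complexRoots hf hα).tower_top
  have hF : FiniteDimensional ℚ (IntermediateField.adjoin ℚ {α}) :=
    IntermediateField.adjoin.finiteDimensional hintg
  have hNF : NumberField (IntermediateField.adjoin ℚ {α}) :=
    @NumberField.mk _ _ inferInstance hF
  have hle : |discr (IntermediateField.adjoin ℚ {α})| ≤ |D| := by
    refine abs_discr_le_of_powerBasis hf hD h (IntermediateField.adjoin.powerBasis hintg) ?_
    refine (algebraMap (IntermediateField.adjoin ℚ {α}) ℂ).injective ?_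
    rw [IntermediateField.adjoin.powerBasis_gen, ← aeval_algebraMap_apply, map_zero,
      IntermediateField.AdjoinSimple.algebraMap_gen]
    exact (mem_complexRoots hf).mp hα
  have hmem : (⟨IntermediateField.adjoin ℚ {α}, hF⟩ :
      {F : IntermediateField ℚ ℂ // FiniteDimensional ℚ F}) ∈ S := by
    rw [Int.abs_eq_natAbs D] at hle
    exact hle
  exact (le_iSup (fun F : S => F.1.1) ⟨_, hmem⟩) (IntermediateField.mem_adjoin_simple_self ℚ α)

theorem exists_finite_root_differences {D : ℤ} (hD : D ≠ 0) :
    ∃ Δ : Set ℂ, Δ.Finite ∧ ∀ f : ℤ[X], f.Monic → discC f = D →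
      ∀ a ∈ complexRoots f, ∀ b ∈ complexRoots f, a - b ∈ Δ := by
  classical
  obtain ⟨K, hK, hroots⟩ := exists_field_of_roots hD
  have : NumberField K := @NumberField.mk _ _ inferInstance hK
  obtain ⟨Δ, hΔ, hdiff⟩ := exists_finite_differences (K := K) hD
  have hinj : Function.Injective (algebraMap K ℂ) := (algebraMap K ℂ).injective
  refine ⟨algebraMap K ℂ '' Δ, hΔ.image _, fun f hf h a ha b hb => ?_⟩
  have himage : ((complexRoots f).preimage (algebraMap K ℂ) hinj.injOn).image (algebraMap K ℂ) =
      complexRoots f := by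
    rw [Finset.image_preimage, Finset.filter_true_of_mem]
    exact fun α hα => ⟨⟨α, hroots f hf h α hα⟩, rfl⟩
  have hprod := diffProd_image hinj ((complexRoots f).preimage (algebraMap K ℂ) hinj.injOn)
  rw [himage] at hprod
  have hval : diffProd ((complexRoots f).preimage (algebraMap K ℂ) hinj.injOn) = D ∨
      diffProd ((complexRoots f).preimage (algebraMap K ℂ) hinj.injOn) = -D := by
    refine (diffProd_complexRoots hf hD h).imp (fun e => hinj ?_) fun e => hinj ?_
    · rw [← hprod, e, map_intCast]
    · rw [← hprod, e, map_neg, map_intCast]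
  refine ⟨⟨a, hroots f hf h a ha⟩ - ⟨b, hroots f hf h b hb⟩,
    hdiff _ (fun x hx => ?_) hval _ (by simpa using ha) _ (by simpa using hb), rfl⟩
  rw [← isIntegral_algebraMap_iff hinj]
  exact isIntegral_of_mem_complexRoots hf (Finset.mem_preimage.mp hx)

theorem finite_setOf_map_eq_prod {B : Set ℂ} (hB : B.Finite) :
    {g : ℤ[X] | ∃ U : Finset ℂ, (U : Set ℂ) ⊆ B ∧
      g.map (Int.castRingHom ℂ) = ∏ β ∈ U, (X - C β)}.Finite := by
  refine Set.Finite.of_finite_image (f := fun g : ℤ[X] => g.map (Int.castRingHom ℂ)) ?_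
    (map_injective _ Int.cast_injective).injOn
  refine ((hB.toFinset.powerset.finite_toSet).image fun U => ∏ β ∈ U, (X - C β)).subset ?_
  rintro _ ⟨g, ⟨U, hU, hg⟩, rfl⟩
  exact ⟨U, by simpa [← Finset.coe_subset] using hU, hg.symm⟩

/-- The possible elements of a finite set of numbers all of whose differences lie in `Δ` and whose
sum is a natural number smaller than its cardinality; see `subset_reducedRoots`. -/
def reducedRoots (Δ : Set ℂ) : Set ℂ :=
  ⋃ V ∈ {V : Finset ℂ | (V : Set ℂ) ⊆ Δ}, ⋃ s ∈ Set.Iio V.card, {((s : ℂ) + ∑ δ ∈ V, δ) / V.card}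

theorem finite_reducedRoots {Δ : Set ℂ} (hΔ : Δ.Finite) : (reducedRoots Δ).Finite := by
  refine Set.Finite.biUnion ?_ fun V _ => (Set.finite_Iio _).biUnion fun s _ =>
    Set.finite_singleton _
  refine (hΔ.toFinset.powerset.finite_toSet).subset fun U hU => ?_
  simpa [← Finset.coe_subset] using hU

theorem subset_reducedRoots {Δ : Set ℂ} {U : Finset ℂ} (hU : ∀ a ∈ U, ∀ b ∈ U, a - b ∈ Δ) {s : ℕ}
    (hs : s < U.card) (hsum : ∑ a ∈ U, a = s) : (U : Set ℂ) ⊆ reducedRoots Δ := by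
  intro b hb
  have hinj : Function.Injective fun a => b - a := sub_right_injective
  have hcard : (U.image fun a => b - a).card = U.card := Finset.card_image_of_injective _ hinj
  simp only [reducedRoots, Set.mem_iUnion]
  refine ⟨U.image fun a => b - a, ?_, s, by rwa [hcard], ?_⟩
  · intro x hx
    obtain ⟨a, ha, rfl⟩ := Finset.mem_image.mp (Finset.mem_coe.mp hx)
    exact hU b hb a ha
  · have h0 : (U.card : ℂ) ≠ 0 := by
      have : U.card ≠ 0 := by omega
      exact_mod_cast this
    rw [hcard, Finset.sum_image hinj.injOn, Finset.sum_sub_distrib, hsum, Finset.sum_const,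
      nsmul_eq_mul, Set.mem_singleton_iff]
    field_simp
    ring

theorem exists_translate_subset {f : ℤ[X]} {R : Finset ℂ} {Δ : Set ℂ}
    (hf : f.map (Int.castRingHom ℂ) = ∏ α ∈ R, (X - C α)) (hR : ∀ a ∈ R, ∀ b ∈ R, a - b ∈ Δ) :
    ∃ a : ℤ, ∃ U : Finset ℂ, (U : Set ℂ) ⊆ reducedRoots Δ ∧
      (f.comp (X + C a)).map (Int.castRingHom ℂ) = ∏ β ∈ U, (X - C β) := by
  rcases R.eq_empty_or_nonempty with rfl | hne
  · exact ⟨0, ∅, by simp, by simpa using hf⟩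
  have hn : 0 < (R.card : ℤ) := by exact_mod_cast hne.card_pos
  have hsum : ∑ α ∈ R, α = ((-f.nextCoeff : ℤ) : ℂ) := by
    have h1 := prod_X_sub_C_nextCoeff (s := R) fun α : ℂ => α
    rw [← hf, nextCoeff_map Int.cast_injective] at h1
    rw [Int.cast_neg, ← neg_eq_iff_eq_neg]
    exact h1.symm
  set a : ℤ := -f.nextCoeff / R.card
  have hinj : Function.Injective fun α : ℂ => α - a := sub_left_injective
  refine ⟨a, R.image fun α => α - a, subset_reducedRoots (s := (-f.nextCoeff % R.card).toNat)
    ?_ ?_ ?_, ?_⟩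
  · intro x hx y hy
    obtain ⟨α, hα, rfl⟩ := Finset.mem_image.mp hx
    obtain ⟨β, hβ, rfl⟩ := Finset.mem_image.mp hy
    simpa using hR α hα β hβ
  · rw [Finset.card_image_of_injective _ hinj]
    have := Int.emod_lt_of_pos (-f.nextCoeff) hn
    omega
  · rw [Finset.sum_image hinj.injOn, Finset.sum_sub_distrib, hsum, Finset.sum_const, nsmul_eq_mul]
    have h1 := Int.emod_nonneg (-f.nextCoeff) hn.ne'
    have h2 := Int.emod_add_mul_ediv (-f.nextCoeff) R.card
    have h3 : (((-f.nextCoeff % R.card).toNat : ℤ) : ℂ) = ((-f.nextCoeff - R.card * a : ℤ) : ℂ) := by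
      rw [Int.toNat_of_nonneg h1]
      congr 1
      linarith
    rw [Int.cast_natCast] at h3
    rw [h3]
    push_cast
    ring
  · rw [map_comp, hf, prod_comp, Finset.prod_image hinj.injOn]
    refine Finset.prod_congr rfl fun α _ => ?_
    simp only [Polynomial.map_add, map_X, map_C, sub_comp, X_comp, C_comp, C_sub]
    simp
    ring

/-- the monic polynomials in ℤ[X] with given nonzero discriminant `D`
(of any degree) lie in finitely many ℤ-equivalence classes. -/
theorem finitely_many_z_classes_monic (D : ℤ) (hD : D ≠ 0) :
    ∃ S : Finset (Polynomial ℤ), (∀ h ∈ S, h.Monic) ∧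
      ∀ f : Polynomial ℤ, f.Monic → discC f = (D : ℂ) → ∃ g ∈ S, ZEquiv f g := by
  obtain ⟨Δ, hΔ, hdiff⟩ := exists_finite_root_differences hD
  have hfin := finite_setOf_map_eq_prod (finite_reducedRoots hΔ)
  refine ⟨hfin.toFinset, fun g hg => ?_, fun f hf h => ?_⟩
  · obtain ⟨U, -, hU⟩ := hfin.mem_toFinset.mp hg
    rw [Function.Injective.monic_map_iff (f := Int.castRingHom ℂ) Int.cast_injective, hU]
    exact monic_prod_X_sub_C _ _
  · obtain ⟨a, ha⟩ := exists_translate_subset (map_eq_prod_complexRoots hf hD h) (hdiff f hf h)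
    exact ⟨_, hfin.mem_toFinset.mpr ha, 1, a, Or.inl rfl, by simp⟩
end

section
/- Every polynomial f ∈ ℤ[X] of degree n ≥ 1 with nonzero discriminant D satisfies n ≤ 3 + 2·log|D|/log 3. -/
open Polynomial

theorem isIntegral_truncation {K : Type*} [Field K] (f : ℤ[X]) (x : K) (hx : aeval x f = 0)
    {i : ℕ} (hi : i < f.natDegree) :
    IsIntegral ℤ (∑ k ∈ Finset.range (i + 1),
      (f.coeff (f.natDegree - i + k) : K) * x ^ k) := by
  set d := f.natDegree with hd
  let N : Submodule ℤ K := Submodule.span ℤ ((fun j : ℕ => x ^ j) '' Set.Iio d)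
  have hmem (j : ℕ) (hj : j < d) (c : ℤ) : (c : K) * x ^ j ∈ N := by
    rw [← zsmul_eq_mul]
    exact N.smul_mem c (Submodule.subset_span ⟨j, hj, rfl⟩)
  refine isIntegral_of_smul_mem_submodule (M := K) N ?_ ?_ _ ?_
  · intro h
    have := hmem 0 (by omega) 1
    rw [h, Submodule.mem_bot] at this
    simp at this
  · exact Submodule.fg_span ((Set.finite_Iio d).image _)
  · intro y hy
    induction hy using Submodule.span_induction with
    | zero => simp
    | add y z _ _ hy hz => rw [smul_add]; exact N.add_mem hy hz
    | smul c y _ hy => rw [smul_comm]; exact N.smul_mem c hy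
    | mem y hy =>
      obtain ⟨j, hj, rfl⟩ := hy
      simp only [Set.mem_Iio] at hj
      simp only [smul_eq_mul]
      by_cases hij : i + j < d
      · rw [Finset.sum_mul]
        refine N.sum_mem fun k hk => ?_
        rw [mul_assoc, ← pow_add]
        exact hmem _ (by simp at hk; omega) _
      · have hsum : ∑ m ∈ Finset.range (d - i), (f.coeff m : K) * x ^ m +
            x ^ (d - i) * ∑ k ∈ Finset.range (i + 1), (f.coeff (d - i + k) : K) * x ^ k = 0 := by
          rw [← hx, aeval_eq_sum_range, ← hd, show d + 1 = d - i + (i + 1) by omega,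
            Finset.sum_range_add _ (d - i) (i + 1), Finset.mul_sum]
          simp only [zsmul_eq_mul, pow_add]
          congr 1
          exact Finset.sum_congr rfl fun k _ => by ring
        have : (∑ k ∈ Finset.range (i + 1), (f.coeff (d - i + k) : K) * x ^ k) * x ^ j =
            -∑ m ∈ Finset.range (d - i), (f.coeff m : K) * x ^ (m + (j - (d - i))) := by
          have h1 : x ^ j = x ^ (d - i) * x ^ (j - (d - i)) := by
            rw [← pow_add]; congr 1; omega
          simp only [pow_add, ← mul_assoc]
          rw [← Finset.sum_mul, h1]
          linear_combination x ^ (j - (d - i)) * hsum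
        rw [this]
        refine N.neg_mem (N.sum_mem fun m hm => hmem _ ?_ _)
        simp at hm; omega

theorem discr_eq_sq_mul_discr {K : Type*} [Field K] [NumberField K] {ι : Type*} [Fintype ι]
    [DecidableEq ι] (hι : Fintype.card ι = Module.finrank ℚ K) (b : ι → K)
    (hb : ∀ i, IsIntegral ℤ (b i)) :
    ∃ z : ℤ, Algebra.discr ℚ b = (z : ℚ) ^ 2 * NumberField.discr K := by
  have e : Module.Free.ChooseBasisIndex ℤ (NumberField.RingOfIntegers K) ≃ ι :=
    Fintype.equivOfCardEq (by
      rw [hι, ← NumberField.RingOfIntegers.rank, Module.finrank_eq_card_chooseBasisIndex])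
  let B := (NumberField.integralBasis K).reindex e
  let c : ι → NumberField.RingOfIntegers K := fun i => ⟨b i, hb i⟩
  let P : Matrix ι ι ℤ := .of fun i j => (NumberField.RingOfIntegers.basis K).repr (c i) (e.symm j)
  refine ⟨P.det, ?_⟩
  have hP : b = ((P.map (Int.castRingHom ℚ)).map (algebraMap ℚ K)).mulVec B := by
    funext i
    have h := B.sum_repr (b i)
    rw [← h]
    simp only [Matrix.mulVec, dotProduct]
    refine Finset.sum_congr rfl fun j _ => ?_
    rw [Algebra.smul_def]
    congr 1
    refine congrArg (algebraMap ℚ K) ?_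
    rw [Module.Basis.repr_reindex_apply]
    exact NumberField.integralBasis_repr_apply K (c i) (e.symm j)
  rw [hP, Algebra.discr_of_matrix_mulVec, NumberField.coe_discr]
  congr 1
  · rw [← RingHom.mapMatrix_apply, ← RingHom.map_det]; simp
  · rw [show (B : ι → K) = NumberField.integralBasis K ∘ e.symm by ext; simp [B],
      Algebra.discr_reindex]

theorem leadingCoeff_pow_mul_discr {K : Type*} [Field K] [NumberField K] (pb : PowerBasis ℚ K)
    (f : ℤ[X]) (hf : f.natDegree = pb.dim) (hx : aeval pb.gen f = 0) :
    ∃ z : ℤ, (f.leadingCoeff : ℚ) ^ (2 * f.natDegree - 2) * Algebra.discr ℚ pb.basis =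
      (z : ℚ) ^ 2 * NumberField.discr K := by
  have hd : 0 < pb.dim := pb.dim_pos
  let P : Matrix (Fin pb.dim) (Fin pb.dim) ℚ := .of fun i j =>
    if (i : ℕ) = 0 then (if (j : ℕ) = 0 then 1 else 0)
    else if (j : ℕ) ≤ i then (f.coeff (f.natDegree - i + j) : ℚ) else 0
  let b : Fin pb.dim → K := fun i => if (i : ℕ) = 0 then 1 else
    ∑ k ∈ Finset.range (i + 1), (f.coeff (f.natDegree - i + k) : K) * pb.gen ^ k
  have hP : b = (P.map (algebraMap ℚ K)).mulVec pb.basis := by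
    funext i
    simp only [Matrix.mulVec, dotProduct, Matrix.map_apply, PowerBasis.coe_basis, b, P,
      Matrix.of_apply]
    split_ifs with hi
    · rw [Finset.sum_eq_single ⟨0, hd⟩]
      · simp
      · intro j _ hj
        have : (j : ℕ) ≠ 0 := fun h => hj (Fin.ext h)
        simp [this]
      · simp
    · rw [Fin.sum_univ_eq_sum_range (fun j => algebraMap ℚ K (if j ≤ (i : ℕ) then
        (f.coeff (f.natDegree - i + j) : ℚ) else 0) * pb.gen ^ j) pb.dim]
      have hsub : Finset.range (i + 1) ⊆ Finset.range pb.dim := by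
        intro j hj
        simp at hj ⊢
        omega
      rw [← Finset.sum_subset hsub]
      · refine Finset.sum_congr rfl fun k hk => ?_
        rw [if_pos (by simp at hk; omega)]
        simp
      · intro j _ hj
        rw [if_neg (by simp at hj; omega)]
        simp
  have hdet : P.det = (f.leadingCoeff : ℚ) ^ (f.natDegree - 1) := by
    rw [Matrix.det_of_isLowerTriangular]
    · simp only [P, Matrix.of_apply]
      obtain ⟨m, hm⟩ : ∃ m, pb.dim = m + 1 := ⟨pb.dim - 1, by omega⟩
      rw [Fin.prod_univ_eq_prod_range (fun i => if i = 0 then (if i = 0 then (1 : ℚ) else 0)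
        else if i ≤ i then (f.coeff (f.natDegree - i + i) : ℚ) else 0) pb.dim, hf, hm,
        Finset.prod_range_succ']
      simp only [Nat.add_sub_cancel, if_true, mul_one]
      rw [Finset.prod_congr rfl (g := fun _ => (f.leadingCoeff : ℚ))]
      · simp
      · intro k hk
        rw [if_neg (by omega), if_pos le_rfl, leadingCoeff]
        congr 2
        simp at hk
        omega
    · intro i j hij
      have hij : (i : ℕ) < j := hij
      simp only [P, Matrix.of_apply]
      split_ifs <;> first | rfl | omega
  obtain ⟨z, hz⟩ := discr_eq_sq_mul_discr (K := K) (by simp [pb.finrank]) b (by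
    intro i
    simp only [b]
    split_ifs with hi
    · exact isIntegral_one
    · exact isIntegral_truncation f pb.gen hx (by omega))
  refine ⟨z, ?_⟩
  rw [← hz, hP, Algebra.discr_of_matrix_mulVec, hdet, ← pow_mul]
  congr 2
  omega

theorem prod_lt_norm_sub_sq {n : ℕ} {g : Fin n → ℂ} (hg : Function.Injective g) :
    ∏ p : Fin n × Fin n, (if p.1 < p.2 then ‖g p.1 - g p.2‖ ^ 2 else 1) =
      ∏ p ∈ (Finset.univ.image g).offDiag, ‖p.1 - p.2‖ := by
  have himg : (Finset.univ.image g).offDiag =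
      (Finset.univ : Finset (Fin n)).offDiag.image (Prod.map g g) := by
    ext ⟨x, y⟩
    simp only [Finset.mem_offDiag, Finset.mem_image, Finset.mem_univ, true_and, Prod.exists,
      Prod.map_apply, Prod.mk.injEq]
    constructor
    · rintro ⟨⟨i, rfl⟩, ⟨j, rfl⟩, hij⟩
      exact ⟨i, j, fun h => hij (h ▸ rfl), rfl, rfl⟩
    · rintro ⟨i, j, hij, rfl, rfl⟩
      exact ⟨⟨i, rfl⟩, ⟨j, rfl⟩, fun h => hij (hg h)⟩
  have hoff : (Finset.univ : Finset (Fin n)).offDiag =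
      Finset.univ.filter (fun p : Fin n × Fin n => p.1 < p.2) ∪
        Finset.univ.filter (fun p : Fin n × Fin n => p.2 < p.1) := by
    ext ⟨i, j⟩
    simp [lt_or_lt_iff_ne]
  have hswap : ∏ p ∈ Finset.univ.filter (fun p : Fin n × Fin n => p.2 < p.1), ‖g p.1 - g p.2‖ =
      ∏ p ∈ Finset.univ.filter (fun p : Fin n × Fin n => p.1 < p.2), ‖g p.1 - g p.2‖ := by
    refine Finset.prod_bij' (fun p _ => p.swap) (fun p _ => p.swap) ?_ ?_ ?_ ?_ ?_
    · simp
    · simp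
    · simp
    · simp
    · intro p _
      exact norm_sub_rev _ _
  rw [himg, Finset.prod_image (hg.prodMap hg).injOn, hoff,
    Finset.prod_union]
  · simp only [Prod.map_fst, Prod.map_snd]
    rw [hswap, ← sq, ← Finset.prod_pow, Finset.prod_filter]
  · rw [Finset.disjoint_filter]
    intro p _ h
    exact not_lt.mpr h.le

/-- The set of distinct complex roots of an integer polynomial. -/
noncomputable def rootFinset (f : ℤ[X]) : Finset ℂ :=
  (f.map (Int.castRingHom ℂ)).roots.toFinset

/-- The absolute value of the discriminant of an integer polynomial with simple roots. -/
noncomputable def absDisc (f : ℤ[X]) : ℝ :=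
  ‖(f.leadingCoeff : ℂ)‖ ^ (2 * f.natDegree - 2) *
    ∏ p ∈ (rootFinset f).offDiag, ‖p.1 - p.2‖

/-- A nonzero integer polynomial whose complex roots are all simple. -/
def HasSimpleRoots (f : ℤ[X]) : Prop :=
  f ≠ 0 ∧ (f.map (Int.castRingHom ℂ)).roots.Nodup

theorem map_ne_zero_of_ne_zero {f : ℤ[X]} (hf : f ≠ 0) : f.map (Int.castRingHom ℂ) ≠ 0 :=
  (Polynomial.map_ne_zero_iff (RingHom.injective_int _)).mpr hf

theorem roots_map_mul {f g : ℤ[X]} (h : f * g ≠ 0) :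
    ((f * g).map (Int.castRingHom ℂ)).roots =
      (f.map (Int.castRingHom ℂ)).roots + (g.map (Int.castRingHom ℂ)).roots := by
  have := map_ne_zero_of_ne_zero h
  rw [Polynomial.map_mul] at this ⊢
  exact roots_mul this

theorem HasSimpleRoots.left {f g : ℤ[X]} (h : HasSimpleRoots (f * g)) : HasSimpleRoots f :=
  ⟨left_ne_zero_of_mul h.1, (Multiset.nodup_add.mp (roots_map_mul h.1 ▸ h.2)).1⟩

theorem HasSimpleRoots.right {f g : ℤ[X]} (h : HasSimpleRoots (f * g)) : HasSimpleRoots g :=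
  HasSimpleRoots.left (mul_comm f g ▸ h)

theorem HasSimpleRoots.disjoint {f g : ℤ[X]} (h : HasSimpleRoots (f * g)) :
    Disjoint (rootFinset f) (rootFinset g) :=
  Multiset.disjoint_toFinset.mpr (Multiset.nodup_add.mp (roots_map_mul h.1 ▸ h.2)).2.2

theorem rootFinset_mul {f g : ℤ[X]} (h : f * g ≠ 0) :
    rootFinset (f * g) = rootFinset f ∪ rootFinset g := by
  rw [rootFinset, roots_map_mul h, Multiset.toFinset_add]; rfl

theorem rootFinset_val {f : ℤ[X]} (h : HasSimpleRoots f) :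
    (rootFinset f).val = (f.map (Int.castRingHom ℂ)).roots := by
  rw [rootFinset, Multiset.toFinset_val, Multiset.dedup_eq_self.mpr h.2]

theorem card_rootFinset {f : ℤ[X]} (h : HasSimpleRoots f) :
    (rootFinset f).card = f.natDegree := by
  rw [Finset.card_def, rootFinset_val h, ← (IsAlgClosed.splits _).natDegree_eq_card_roots,
    natDegree_map_eq_of_injective (RingHom.injective_int _)]

theorem absDisc_of_natDegree_le_one {f : ℤ[X]} (h : HasSimpleRoots f) (hf : f.natDegree ≤ 1) :
    absDisc f = 1 := by
  have : (rootFinset f).offDiag = ∅ := by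
    refine Finset.eq_empty_of_forall_notMem fun p hp => ?_
    obtain ⟨hx, hy, hxy⟩ := Finset.mem_offDiag.mp hp
    exact hxy (Finset.card_le_one.mp ((card_rootFinset h).trans_le hf) _ hx _ hy)
  rw [absDisc, this, show 2 * f.natDegree - 2 = 0 by omega]
  simp

theorem norm_resultant {f g : ℤ[X]} (hf : HasSimpleRoots f) (hg : HasSimpleRoots g) :
    ‖((resultant f g : ℤ) : ℂ)‖ = ‖(f.leadingCoeff : ℂ)‖ ^ g.natDegree *
      ‖(g.leadingCoeff : ℂ)‖ ^ f.natDegree *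
      ∏ p ∈ rootFinset f ×ˢ rootFinset g, ‖p.1 - p.2‖ := by
  have hinj : Function.Injective (Int.castRingHom ℂ) := RingHom.injective_int _
  have h1 : ((resultant f g : ℤ) : ℂ) = (f.leadingCoeff : ℂ) ^ g.natDegree *
      ∏ a ∈ rootFinset f, (g.map (Int.castRingHom ℂ)).eval a := by
    have := resultant_eq_prod_eval (f.map (Int.castRingHom ℂ)) (g.map (Int.castRingHom ℂ))
      g.natDegree natDegree_map_le (IsAlgClosed.splits _)
    rw [natDegree_map_eq_of_injective hinj, resultant_map_map,
      leadingCoeff_map_of_injective hinj, ← rootFinset_val hf] at this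
    exact this
  have h2 (a : ℂ) : (g.map (Int.castRingHom ℂ)).eval a =
      (g.leadingCoeff : ℂ) * ∏ b ∈ rootFinset g, (a - b) := by
    rw [(IsAlgClosed.splits (g.map (Int.castRingHom ℂ))).eval_eq_prod_roots,
      leadingCoeff_map_of_injective hinj, ← rootFinset_val hg]
    rfl
  rw [h1, Finset.prod_product]
  simp_rw [h2]
  rw [Finset.prod_mul_distrib, Finset.prod_const, card_rootFinset hf]
  simp only [norm_mul, norm_pow, norm_prod]
  ring

theorem one_le_norm_leadingCoeff {f : ℤ[X]} (hf : f ≠ 0) : 1 ≤ ‖(f.leadingCoeff : ℂ)‖ := by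
  rw [Complex.norm_intCast]
  exact_mod_cast Int.one_le_abs (leadingCoeff_ne_zero.mpr hf)

theorem absDisc_nonneg (f : ℤ[X]) : 0 ≤ absDisc f :=
  mul_nonneg (by positivity) (Finset.prod_nonneg fun _ _ => norm_nonneg _)

theorem resultant_ne_zero_of_hasSimpleRoots {f g : ℤ[X]} (h : HasSimpleRoots (f * g)) :
    resultant f g ≠ 0 := by
  intro h0
  have := norm_resultant h.left h.right
  have hf := one_le_norm_leadingCoeff h.left.1
  have hg := one_le_norm_leadingCoeff h.right.1
  have hp : 0 < ∏ p ∈ rootFinset f ×ˢ rootFinset g, ‖p.1 - p.2‖ := by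
    refine Finset.prod_pos fun p hp => norm_pos_iff.mpr (sub_ne_zero.mpr ?_)
    rw [Finset.mem_product] at hp
    exact fun he => Finset.disjoint_left.mp h.disjoint hp.1 (he ▸ hp.2)
  rw [h0, Int.cast_zero, norm_zero] at this
  have : 0 < ‖(f.leadingCoeff : ℂ)‖ ^ g.natDegree * ‖(g.leadingCoeff : ℂ)‖ ^ f.natDegree *
      ∏ p ∈ rootFinset f ×ˢ rootFinset g, ‖p.1 - p.2‖ := by positivity
  linarith

theorem absDisc_mul {f g : ℤ[X]} (h : HasSimpleRoots (f * g)) (hf : 1 ≤ f.natDegree)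
    (hg : 1 ≤ g.natDegree) :
    absDisc (f * g) = absDisc f * absDisc g * ‖((resultant f g : ℤ) : ℂ)‖ ^ 2 := by
  have hsymm : ∏ p ∈ rootFinset g ×ˢ rootFinset f, ‖p.1 - p.2‖ =
      ∏ p ∈ rootFinset f ×ˢ rootFinset g, ‖p.1 - p.2‖ := by
    rw [Finset.prod_product, Finset.prod_product_right]
    simp only [norm_sub_rev]
  have hd := h.disjoint
  have hfg : ∀ z ∈ rootFinset f, z ∉ rootFinset g :=
    fun z hz => Finset.disjoint_left.mp hd hz
  obtain ⟨m, hm⟩ := Nat.exists_eq_add_of_le hf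
  obtain ⟨k, hk⟩ := Nat.exists_eq_add_of_le hg
  rw [norm_resultant h.left h.right, absDisc, rootFinset_mul h.1, Finset.offDiag_union hd,
    Finset.prod_union, Finset.prod_union, Finset.prod_union, hsymm, leadingCoeff_mul,
    natDegree_mul h.left.1 h.right.1, absDisc, absDisc, hm, hk, Int.cast_mul, norm_mul,
    show 2 * (1 + m + (1 + k)) - 2 = 2 * m + 2 * k + 2 by omega,
    show 2 * (1 + m) - 2 = 2 * m by omega, show 2 * (1 + k) - 2 = 2 * k by omega]
  · ring
  all_goals
    rw [Finset.disjoint_left]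
    rintro ⟨x, y⟩
    simp only [Finset.mem_union, Finset.mem_offDiag, Finset.mem_product]
    have hx := hfg x
    have hy := hfg y
    tauto

theorem absDisc_mul_le {f g : ℤ[X]} (h : HasSimpleRoots (f * g)) :
    absDisc f * absDisc g ≤ absDisc (f * g) := by
  have hconst {c q : ℤ[X]} (h : HasSimpleRoots (c * q)) (hc : c.natDegree = 0) :
      absDisc c * absDisc q ≤ absDisc (c * q) := by
    have hr : rootFinset c = ∅ := by
      rw [← Finset.card_eq_zero, card_rootFinset h.left, hc]
    rw [absDisc_of_natDegree_le_one h.left (by omega), one_mul, absDisc, absDisc,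
      rootFinset_mul h.1, hr, Finset.empty_union, natDegree_mul h.left.1 h.right.1, hc, zero_add,
      leadingCoeff_mul, Int.cast_mul, norm_mul, mul_pow]
    have := one_le_pow₀ (one_le_norm_leadingCoeff h.left.1) (n := 2 * q.natDegree - 2)
    refine mul_le_mul_of_nonneg_right ?_ (Finset.prod_nonneg fun _ _ => norm_nonneg _)
    exact le_mul_of_one_le_left (by positivity) this
  rcases Nat.eq_zero_or_pos f.natDegree with hf | hf
  · exact hconst h hf
  rcases Nat.eq_zero_or_pos g.natDegree with hg | hg
  · rw [mul_comm, mul_comm f]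
    exact hconst (mul_comm f g ▸ h) hg
  rw [absDisc_mul h hf hg]
  refine le_mul_of_one_le_right (mul_nonneg (absDisc_nonneg f) (absDisc_nonneg g)) ?_
  rw [Complex.norm_intCast]
  refine one_le_pow₀ ?_
  exact_mod_cast Int.one_le_abs (resultant_ne_zero_of_hasSimpleRoots h)

theorem three_pow_finrank_le_discr_sq (K : Type*) [Field K] [NumberField K]
    (h : 2 ≤ Module.finrank ℚ K) : 3 ^ Module.finrank ℚ K ≤ NumberField.discr K ^ 2 := by
  have h1 := NumberField.abs_discr_ge (K := K) h
  have h2 := NumberField.abs_discr_gt_two (K := K) h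
  generalize Module.finrank ℚ K = d at *
  generalize NumberField.discr K = D at *
  rw [← sq_abs D]
  obtain rfl | ⟨k, rfl⟩ : d = 2 ∨ ∃ k, d = k + 3 := by
    rcases Nat.lt_or_ge d 3 with h3 | h3
    · left; omega
    · exact Or.inr ⟨d - 3, by omega⟩
  · nlinarith
  · have hpi := Real.pi_gt_d2
    have hk : (2.355 : ℝ) ^ (k + 3) ≤ (3 * Real.pi / 4) ^ (k + 3) :=
      pow_le_pow_left₀ (by norm_num) (by linarith) _
    have h4 : (4 / 9 : ℝ) * 2.355 ^ (k + 3) ≤ |(D : ℝ)| := by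
      push_cast at h1
      linarith
    have h5 : ((4 / 9 : ℝ) * 2.355 ^ (k + 3)) ^ 2 ≤ |(D : ℝ)| ^ 2 :=
      pow_le_pow_left₀ (by positivity) h4 _
    have h6 : (3 : ℝ) ^ k ≤ (2.355 ^ 2) ^ k := pow_le_pow_left₀ (by norm_num) (by norm_num) _
    have h7 : ((4 / 9 : ℝ) * 2.355 ^ (k + 3)) ^ 2 =
        (4 / 9) ^ 2 * 2.355 ^ 6 * (2.355 ^ 2) ^ k := by
      rw [← pow_mul, mul_pow, ← pow_mul, mul_assoc, ← pow_add]
      congr 2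
      ring
    have h8 : (3 : ℝ) ^ (k + 3) ≤ |(D : ℝ)| ^ 2 := by
      rw [pow_add]
      have : (0 : ℝ) < 3 ^ k := by positivity
      norm_num at *
      nlinarith
    exact_mod_cast h8

theorem norm_discr_powerBasis {K : Type*} [Field K] [NumberField K] (pb : PowerBasis ℚ K)
    {f : ℤ[X]} (hf : HasSimpleRoots f) (hd : f.natDegree = pb.dim) (hx : aeval pb.gen f = 0) :
    ‖((Algebra.discr ℚ pb.basis : ℚ) : ℂ)‖ = ∏ p ∈ (rootFinset f).offDiag, ‖p.1 - p.2‖ := by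
  have hcard : Fintype.card (Fin pb.dim) = Fintype.card (K →ₐ[ℚ] ℂ) := by
    rw [AlgHom.card, pb.finrank, Fintype.card_fin]
  let e : Fin pb.dim ≃ (K →ₐ[ℚ] ℂ) := Fintype.equivOfCardEq hcard
  let g : Fin pb.dim → ℂ := fun i => e i pb.gen
  have hg : Function.Injective g := fun i j hij => e.injective (pb.algHom_ext hij)
  have himg : Finset.univ.image g = rootFinset f := by
    refine Finset.eq_of_subset_of_card_le ?_ ?_
    · intro y hy
      obtain ⟨i, -, rfl⟩ := Finset.mem_image.mp hy
      rw [rootFinset, Multiset.mem_toFinset, mem_roots (map_ne_zero_of_ne_zero hf.1), IsRoot.def,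
        eval_map]
      have := congrArg (e i) hx
      rw [map_zero] at this
      rw [← this]
      exact (hom_eval₂ f (algebraMap ℤ K) (e i : K →+* ℂ) pb.gen).symm ▸ by
        congr 1
        exact RingHom.ext_int _ _
    · rw [card_rootFinset hf, hd, Finset.card_image_of_injective _ hg, Finset.card_fin]
  rw [← himg, ← prod_lt_norm_sub_sq hg, Fintype.prod_prod_type]
  have := Algebra.discr_powerBasis_eq_prod ℚ ℂ pb e
  rw [eq_ratCast] at this
  rw [this, norm_prod]
  refine Finset.prod_congr rfl fun i _ => ?_
  rw [norm_prod, ← Finset.prod_filter]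
  refine Finset.prod_congr (by ext; simp) fun j _ => ?_
  rw [norm_pow, norm_sub_rev]

theorem three_pow_le_absDisc_sq_of_irreducible {p : ℤ[X]} (hp : Irreducible p)
    (hs : HasSimpleRoots p) (hd : 2 ≤ p.natDegree) :
    1 ≤ absDisc p ∧ 3 ^ p.natDegree ≤ absDisc p ^ 2 := by
  have hirr : Irreducible (p.map (Int.castRingHom ℚ)) :=
    (IsPrimitive.Int.irreducible_iff_irreducible_map_cast
      (hp.isPrimitive (by omega))).mp hp
  have : Fact (Irreducible (p.map (Int.castRingHom ℚ))) := ⟨hirr⟩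
  let K := AdjoinRoot (p.map (Int.castRingHom ℚ))
  let pb : PowerBasis ℚ K := AdjoinRoot.powerBasis hirr.ne_zero
  have : CharZero K := algebraRat.charZero K
  have : FiniteDimensional ℚ K := pb.finite
  have : NumberField K := ⟨⟩
  have hdim : p.natDegree = pb.dim := by
    rw [AdjoinRoot.powerBasis_dim, natDegree_map_eq_of_injective (RingHom.injective_int _)]
  have hx : aeval pb.gen p = 0 := by
    have := AdjoinRoot.eval₂_root (p.map (Int.castRingHom ℚ))
    rw [eval₂_map] at this
    rw [AdjoinRoot.powerBasis_gen, aeval_def, ← this]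
    congr 1
  obtain ⟨z, hz⟩ := leadingCoeff_pow_mul_discr pb p hdim hx
  have hnorm : absDisc p = |(z : ℝ) ^ 2 * NumberField.discr K| := by
    rw [absDisc, ← norm_discr_powerBasis pb hs hdim hx, ← norm_pow, ← norm_mul]
    have : ((p.leadingCoeff : ℂ) ^ (2 * p.natDegree - 2) *
        ((Algebra.discr ℚ pb.basis : ℚ) : ℂ)) = ((z ^ 2 * NumberField.discr K : ℤ) : ℂ) := by
      have := congrArg (fun q : ℚ => (q : ℂ)) hz
      push_cast at this ⊢
      exact this
    rw [this, Complex.norm_intCast]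
    push_cast
    rfl
  have hz0 : z ≠ 0 := by
    rintro rfl
    have hb := Algebra.discr_not_zero_of_basis ℚ pb.basis
    have hl : (p.leadingCoeff : ℚ) ≠ 0 := Int.cast_ne_zero.mpr (leadingCoeff_ne_zero.mpr hs.1)
    have := mul_ne_zero (pow_ne_zero (2 * p.natDegree - 2) hl) hb
    rw [hz] at this
    simp at this
  have h1 : (1 : ℝ) ≤ |(z : ℝ) ^ 2 * NumberField.discr K| := by
    have := Int.one_le_abs (mul_ne_zero (pow_ne_zero 2 hz0) (NumberField.discr_ne_zero K))
    exact_mod_cast this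
  have h3 := three_pow_finrank_le_discr_sq K (by rw [pb.finrank, ← hdim]; exact hd)
  rw [pb.finrank, ← hdim] at h3
  rw [hnorm, sq_abs, mul_pow]
  refine ⟨h1, ?_⟩
  have h3' : (3 : ℝ) ^ p.natDegree ≤ (NumberField.discr K : ℝ) ^ 2 := by exact_mod_cast h3
  refine h3'.trans (le_mul_of_one_le_left (by positivity) ?_)
  have : (1 : ℤ) ≤ (z ^ 2) ^ 2 := Int.add_one_le_iff.mpr (pow_pos (sq_pos_of_ne_zero hz0) 2)
  exact_mod_cast this

theorem exists_irreducible_dvd_of_natDegree_pos {f : ℤ[X]} (hf : 1 ≤ f.natDegree) :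
    ∃ p : ℤ[X], Irreducible p ∧ 1 ≤ p.natDegree ∧ p ∣ f := by
  have hnu : ¬IsUnit f.primPart := fun h => by
    have := natDegree_eq_zero_of_isUnit h
    rw [natDegree_primPart] at this
    omega
  obtain ⟨p, hp, hpf⟩ := WfDvdMonoid.exists_irreducible_factor hnu f.primPart_ne_zero
  refine ⟨p, hp, ?_, hpf.trans (primPart_dvd f)⟩
  by_contra! h
  obtain ⟨c, rfl⟩ := natDegree_eq_zero.mp (Nat.lt_one_iff.mp h)
  exact hp.not_isUnit (isUnit_C.mpr (f.isPrimitive_primPart c hpf))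

theorem resultant_of_natDegree_eq_one {f g : ℤ[X]} (hf : f.natDegree = 1) (hg : g.natDegree = 1) :
    resultant f g = f.coeff 1 * g.coeff 0 - f.coeff 0 * g.coeff 1 := by
  rw [show resultant f g = resultant f g 1 1 by rw [hf, hg]]
  simp [resultant, sylvester, Matrix.det_fin_two, Fin.addCases]
  ring

theorem exists_even_resultant {f g h k : ℤ[X]} (hf : f.natDegree = 1) (hg : g.natDegree = 1)
    (hh : h.natDegree = 1) (hk : k.natDegree = 1) :
    2 ∣ resultant f g ∨ 2 ∣ resultant f h ∨ 2 ∣ resultant f k ∨ 2 ∣ resultant g h ∨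
      2 ∣ resultant g k ∨ 2 ∣ resultant h k := by
  have key : ∀ a b c d : ZMod 2 × ZMod 2, a.1 * b.2 - a.2 * b.1 = 0 ∨ a.1 * c.2 - a.2 * c.1 = 0 ∨
      a.1 * d.2 - a.2 * d.1 = 0 ∨ b.1 * c.2 - b.2 * c.1 = 0 ∨ b.1 * d.2 - b.2 * d.1 = 0 ∨
      c.1 * d.2 - c.2 * d.1 = 0 := by decide
  have hdvd (m : ℤ) : 2 ∣ m ↔ (m : ZMod 2) = 0 := (ZMod.intCast_zmod_eq_zero_iff_dvd m 2).symm
  rw [resultant_of_natDegree_eq_one hf hg, resultant_of_natDegree_eq_one hf hh,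
    resultant_of_natDegree_eq_one hf hk, resultant_of_natDegree_eq_one hg hh,
    resultant_of_natDegree_eq_one hg hk, resultant_of_natDegree_eq_one hh hk]
  simp only [hdvd, Int.cast_sub, Int.cast_mul]
  exact key (f.coeff 1, f.coeff 0) (g.coeff 1, g.coeff 0) (h.coeff 1, h.coeff 0)
    (k.coeff 1, k.coeff 0)

theorem four_mul_absDisc_le {f g q : ℤ[X]} (h : HasSimpleRoots (f * (g * q)))
    (hf : f.natDegree = 1) (hg : g.natDegree = 1) (h2 : 2 ∣ resultant f g) :
    4 * absDisc (g * q) ≤ absDisc (f * (g * q)) := by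
  have hgq := natDegree_mul h.right.left.1 h.right.right.1
  have hdvd : 2 ∣ resultant f (g * q) := by
    rw [hgq, resultant_mul_right _ _ _ _ le_rfl]
    exact dvd_mul_of_dvd_left h2 _
  have hle : (2 : ℤ) ≤ |resultant f (g * q)| :=
    Int.le_of_dvd (abs_pos.mpr (resultant_ne_zero_of_hasSimpleRoots h)) ((dvd_abs _ _).mpr hdvd)
  have hle' : (2 : ℝ) ≤ |((resultant f (g * q) : ℤ) : ℝ)| := by exact_mod_cast hle
  rw [absDisc_mul h hf.ge (by omega), absDisc_of_natDegree_le_one h.left hf.le, one_mul,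
    Complex.norm_intCast, mul_comm]
  exact mul_le_mul_of_nonneg_left (by nlinarith) (absDisc_nonneg _)

theorem one_le_absDisc_and_three_pow_le (n : ℕ) : ∀ f : ℤ[X], f.natDegree = n →
    HasSimpleRoots f → 1 ≤ absDisc f ∧ 3 ^ n ≤ 27 * absDisc f ^ 2 := by
  induction n using Nat.strong_induction_on with
  | _ n ih =>
  intro f hfn hf
  by_cases hirr : ∃ p : ℤ[X], Irreducible p ∧ 2 ≤ p.natDegree ∧ p ∣ f
  · obtain ⟨p, hp, hp2, q, rfl⟩ := hirr
    have hdeg := natDegree_mul hf.left.1 hf.right.1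
    obtain ⟨hp1, hp3⟩ := three_pow_le_absDisc_sq_of_irreducible hp hf.left hp2
    obtain ⟨hq1, hq3⟩ := ih q.natDegree (by omega) q rfl hf.right
    have hle := absDisc_mul_le hf
    refine ⟨(one_le_mul_of_one_le_of_one_le hp1 hq1).trans hle, ?_⟩
    calc (3 : ℝ) ^ n = 3 ^ p.natDegree * 3 ^ q.natDegree := by rw [← pow_add, ← hdeg, hfn]
      _ ≤ absDisc p ^ 2 * (27 * absDisc q ^ 2) := by gcongr
      _ = 27 * (absDisc p * absDisc q) ^ 2 := by ring
      _ ≤ 27 * absDisc (p * q) ^ 2 := by gcongr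
  have hlin {g : ℤ[X]} (hgf : g ∣ f) (hg : 1 ≤ g.natDegree) :
      ∃ l q : ℤ[X], l.natDegree = 1 ∧ g = l * q ∧ q.natDegree + 1 = g.natDegree := by
    obtain ⟨p, hp, hp1, q, rfl⟩ := exists_irreducible_dvd_of_natDegree_pos hg
    have hpq := ne_zero_of_dvd_ne_zero hf.1 hgf
    have : p.natDegree = 1 := by
      by_contra h
      exact hirr ⟨p, hp, by omega, (dvd_mul_right p q).trans hgf⟩
    refine ⟨p, q, this, rfl, ?_⟩
    rw [natDegree_mul (left_ne_zero_of_mul hpq) (right_ne_zero_of_mul hpq)]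
    omega
  have hone : 1 ≤ absDisc f := by
    rcases Nat.eq_zero_or_pos n with rfl | hn
    · rw [absDisc_of_natDegree_le_one hf (by omega)]
    obtain ⟨l, q, hl, rfl, hq⟩ := hlin dvd_rfl (by omega)
    have := absDisc_mul_le hf
    rw [absDisc_of_natDegree_le_one hf.left hl.le, one_mul] at this
    exact (ih q.natDegree (by omega) q rfl hf.right).1.trans this
  refine ⟨hone, ?_⟩
  rcases Nat.lt_or_ge 3 n with hn | hn
  · have hstep {l m q : ℤ[X]} (hl : l.natDegree = 1) (hm : m.natDegree = 1)
        (hfe : f = l * (m * q)) (h2 : 2 ∣ resultant l m) : (3 : ℝ) ^ n ≤ 27 * absDisc f ^ 2 := by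
      subst hfe
      have hdeg := natDegree_mul hf.left.1 hf.right.1
      obtain ⟨h1, h3⟩ := ih (m * q).natDegree (by omega) _ rfl hf.right
      have h4 := four_mul_absDisc_le hf hl hm h2
      rw [← hfn, hdeg, hl, pow_add]
      nlinarith
    obtain ⟨a, q₁, ha, rfl, hq₁⟩ := hlin dvd_rfl (by omega)
    obtain ⟨b, q₂, hb, rfl, hq₂⟩ := hlin (dvd_mul_left q₁ a) (by omega)
    obtain ⟨c, q₃, hc, rfl, hq₃⟩ := hlin ((dvd_mul_left q₂ b).mul_left a) (by omega)
    obtain ⟨d, q, hd, rfl, -⟩ := hlin (((dvd_mul_left q₃ c).mul_left b).mul_left a) (by omega)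
    rcases exists_even_resultant ha hb hc hd with h | h | h | h | h | h
    · exact hstep ha hb (q := c * (d * q)) (by ring) h
    · exact hstep ha hc (q := b * (d * q)) (by ring) h
    · exact hstep ha hd (q := b * (c * q)) (by ring) h
    · exact hstep hb hc (q := a * (d * q)) (by ring) h
    · exact hstep hb hd (q := a * (c * q)) (by ring) h
    · exact hstep hc hd (q := a * (b * q)) (by ring) h
  · calc (3 : ℝ) ^ n ≤ 3 ^ 3 := pow_le_pow_right₀ (by norm_num) hn
      _ ≤ 27 * absDisc f ^ 2 := by nlinarith

theorem nodup_rootList_of_discC_ne_zero {f : ℤ[X]} (h : discC f ≠ 0) : (rootList f).Nodup := by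
  rw [List.nodup_iff_injective_get]
  have hlt {i j : Fin (rootList f).length} (hij : i < j) :
      (rootList f).get i ≠ (rootList f).get j := fun he => by
    refine h (mul_eq_zero_of_right _ (Finset.prod_eq_zero (Finset.mem_univ (i, j)) ?_))
    rw [if_pos (by exact hij), he, sub_self, zero_pow two_ne_zero]
  intro i j he
  by_contra hij
  rcases lt_or_gt_of_ne hij with hij | hij
  · exact hlt hij he
  · exact hlt hij he.symm

theorem norm_discC {f : ℤ[X]} (h : discC f ≠ 0) : ‖discC f‖ = absDisc f := by
  have hg := List.nodup_iff_injective_get.mp (nodup_rootList_of_discC_ne_zero h)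
  have himg : Finset.univ.image (rootList f).get = rootFinset f := by
    ext x
    rw [rootFinset, Multiset.mem_toFinset, ← Multiset.mem_toList, ← rootList, List.mem_iff_get]
    simp only [Finset.mem_image, Finset.mem_univ, true_and]
  rw [discC, norm_mul, norm_pow, norm_prod, absDisc, ← himg, ← prod_lt_norm_sub_sq hg]
  congr 1
  refine Finset.prod_congr rfl fun p _ => ?_
  rw [apply_ite norm, norm_pow, norm_one]
  rfl

/-- every `f ∈ ℤ[X]` of degree `n ≥ 1` with nonzero discriminant `D`
satisfies `n ≤ 3 + 2·log|D|/log 3`. -/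
theorem degree_bound_of_disc (n : ℕ) (hn : 1 ≤ n) (f : Polynomial ℤ)
    (hfn : f.natDegree = n) (D : ℤ) (hD : D ≠ 0) (hdisc : discC f = (D : ℂ)) :
    (n : ℝ) ≤ 3 + 2 * Real.log (|D| : ℝ) / Real.log 3 := by
  have hne : discC f ≠ 0 := hdisc ▸ Int.cast_ne_zero.mpr hD
  have hf : HasSimpleRoots f := by
    refine ⟨?_, ?_⟩
    · rintro rfl
      simp at hfn
      omega
    · rw [← Multiset.coe_toList (f.map (Int.castRingHom ℂ)).roots]
      exact nodup_rootList_of_discC_ne_zero hne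
  have hbound := (one_le_absDisc_and_three_pow_le n f hfn hf).2
  rw [← norm_discC hne, hdisc, Complex.norm_intCast] at hbound
  have hDpos : (0 : ℝ) < |(D : ℝ)| := abs_pos.mpr (Int.cast_ne_zero.mpr hD)
  have hlog3 : 0 < Real.log 3 := Real.log_pos (by norm_num)
  have hlog := Real.log_le_log (by positivity) hbound
  rw [Real.log_pow, Real.log_mul (by norm_num) (by positivity), Real.log_pow,
    show (27 : ℝ) = 3 ^ 3 by norm_num, Real.log_pow] at hlog
  rw [← sub_le_iff_le_add', le_div_iff₀ hlog3]
  push_cast at hlog ⊢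
  linarith
end

section
/- Let f, g ∈ ℤ[X] be polynomials of degree 3 with nonzero discriminant. Then f and g are Hermite equivalent if and only if they are GL₂(ℤ)-equivalent. -/
open Polynomial

open Matrix

/-- `f` is an integer cubic whose complex roots are the pairwise distinct numbers `α i`. -/
structure IsCubicWithRoots (f : ℤ[X]) (α : Fin 3 → ℂ) : Prop where
  natDegree_eq : f.natDegree = 3
  injective : Function.Injective α
  roots_eq : (f.map (Int.castRingHom ℂ)).roots = Finset.univ.val.map α

theorem exists_isCubicWithRoots {f : ℤ[X]} (hf : f.natDegree = 3) (hd : discC f ≠ 0) :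
    ∃ α, IsCubicWithRoots f α := by
  have hlen : (rootList f).length = 3 := by
    rw [rootList, Multiset.length_toList, ← (IsAlgClosed.splits _).natDegree_eq_card_roots,
      natDegree_map_eq_of_injective (Int.castRingHom ℂ).injective_int, hf]
  have hinj : Function.Injective (rootList f).get := by
    have hlt : ∀ i j, i < j → (rootList f).get i ≠ (rootList f).get j := by
      intro i j hij heq
      have h := Finset.prod_ne_zero_iff.mp (right_ne_zero_of_mul hd) (i, j) (Finset.mem_univ _)
      simp [Fin.lt_def.mp hij] at h
      exact h (by simpa [sub_eq_zero] using heq)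
    intro i j h
    rcases lt_trichotomy i j with hij | hij | hij
    · exact absurd h (hlt i j hij)
    · exact hij
    · exact absurd h.symm (hlt j i hij)
  refine ⟨(rootList f).get ∘ Fin.cast hlen.symm, hf, hinj.comp (Fin.cast_injective _), ?_⟩
  have h : (Multiset.ofList (rootList f)) = (f.map (Int.castRingHom ℂ)).roots :=
    Multiset.coe_toList _
  rw [← h, Fin.univ_val_map, Multiset.coe_eq_coe]
  refine List.Perm.of_eq ?_
  refine List.ext_getElem (by simp [hlen]) fun i hi _ => ?_
  rw [hlen] at hi
  interval_cases i <;> simp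

namespace IsCubicWithRoots

variable {f g : ℤ[X]} {α β : Fin 3 → ℂ}

theorem comp_perm (hf : IsCubicWithRoots f α) (e : Equiv.Perm (Fin 3)) :
    IsCubicWithRoots f (α ∘ e) where
  natDegree_eq := hf.natDegree_eq
  injective := hf.injective.comp e.injective
  roots_eq := by
    have h := Finset.map_val e.toEmbedding Finset.univ
    rw [Finset.univ_map_equiv_to_embedding] at h
    rw [hf.roots_eq, ← Multiset.map_map]
    exact congrArg _ h

theorem leadingCoeff_eq (hf : IsCubicWithRoots f α) : f.leadingCoeff = f.coeff 3 := by
  rw [leadingCoeff, hf.natDegree_eq]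

theorem coeff_three_ne_zero (hf : IsCubicWithRoots f α) : (f.coeff 3 : ℂ) ≠ 0 := by
  rw [← hf.leadingCoeff_eq, Int.cast_ne_zero, leadingCoeff_ne_zero]
  rintro rfl
  simpa using hf.natDegree_eq

theorem content_ne_zero (hf : IsCubicWithRoots f α) : f.content ≠ 0 := by
  rw [Ne, content_eq_zero_iff]
  rintro rfl
  simpa using hf.natDegree_eq

theorem aeval_eq (hf : IsCubicWithRoots f α) (z : ℂ) :
    aeval z f = f.coeff 3 * z ^ 3 + f.coeff 2 * z ^ 2 + f.coeff 1 * z + f.coeff 0 := by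
  rw [aeval_eq_sum_range, hf.natDegree_eq]
  simp [Finset.sum_range_succ]
  ring

theorem aeval_eq_prod (hf : IsCubicWithRoots f α) (z : ℂ) :
    aeval z f = f.coeff 3 * ∏ i, (z - α i) := by
  have h := (IsAlgClosed.splits (f.map (Int.castRingHom ℂ))).eq_prod_roots
  rw [leadingCoeff_map_of_injective (Int.castRingHom ℂ).injective_int, hf.roots_eq,
    hf.leadingCoeff_eq] at h
  have h' := congrArg (eval z) h
  rw [eval_map] at h'
  rw [aeval_def, algebraMap_int_eq, h', eval_mul, eval_C, Multiset.map_map,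
    Finset.prod_map_val, eval_prod]
  simp

theorem vieta (hf : IsCubicWithRoots f α) :
    (f.coeff 2 : ℂ) = -f.coeff 3 * (α 0 + α 1 + α 2) ∧
    (f.coeff 1 : ℂ) = f.coeff 3 * (α 0 * α 1 + α 0 * α 2 + α 1 * α 2) ∧
    (f.coeff 0 : ℂ) = -f.coeff 3 * (α 0 * α 1 * α 2) := by
  have h (z : ℂ) := (hf.aeval_eq z).symm.trans (hf.aeval_eq_prod z)
  simp only [Fin.prod_univ_three] at h
  refine ⟨?_, ?_, ?_⟩
  · linear_combination (h 1 + h (-1)) / 2 - h 0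
  · linear_combination (h 1 - h (-1)) / 2
  · linear_combination h 0

/-- Factorization of the binary cubic form attached to `f`. -/
theorem form_eq_prod (hf : IsCubicWithRoots f α) (x y : ℂ) :
    f.coeff 3 * x ^ 3 + f.coeff 2 * x ^ 2 * y + f.coeff 1 * x * y ^ 2 + f.coeff 0 * y ^ 3 =
      f.coeff 3 * ∏ i, (x - α i * y) := by
  obtain ⟨h2, h1, h0⟩ := hf.vieta
  rw [h2, h1, h0, Fin.prod_univ_three]
  ring

theorem root_eq (hf : IsCubicWithRoots f α) (i : Fin 3) :
    (f.coeff 3 : ℂ) * α i ^ 3 + f.coeff 2 * α i ^ 2 + f.coeff 1 * α i + f.coeff 0 = 0 := by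
  rw [← hf.aeval_eq, hf.aeval_eq_prod, Finset.prod_eq_zero (Finset.mem_univ i) (sub_self _),
    mul_zero]

theorem aeval_glTranslate (hf : IsCubicWithRoots f α) (M : Matrix (Fin 2) (Fin 2) ℤ) (z : ℂ) :
    aeval z (glTranslate 3 f M) =
      f.coeff 3 * ∏ i, (M 0 0 * z + M 0 1 - α i * (M 1 0 * z + M 1 1)) := by
  rw [← hf.form_eq_prod]
  simp [glTranslate, Finset.sum_range_succ]
  ring

theorem of_C_mul {c : ℤ} (hc : c ≠ 0) (hf : IsCubicWithRoots (C c * f) α) :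
    IsCubicWithRoots f α where
  natDegree_eq := by rw [← hf.natDegree_eq, natDegree_C_mul hc]
  injective := hf.injective
  roots_eq := by
    rw [← hf.roots_eq, Polynomial.map_mul, map_C,
      roots_C_mul _ (by simpa using hc)]

theorem eval_hermiteForm (hf : IsCubicWithRoots f α) (x : Fin 3 → ℂ) :
    MvPolynomial.eval x (hermiteForm 3 f) =
      f.coeff 3 ^ 2 * ∏ i, (α i ^ 2 * x 0 + α i * x 1 + x 2) := by
  rw [hermiteForm, hf.roots_eq, hf.leadingCoeff_eq, Multiset.map_map, Finset.prod_map_val,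
    map_mul, map_prod]
  simp [Fin.sum_univ_three]

end IsCubicWithRoots

theorem quadratic_coeffs_eq_zero {α : Fin 3 → ℂ} (hα : Function.Injective α) {a b c : ℂ}
    (h : ∀ i, a * α i ^ 2 + b * α i + c = 0) : a = 0 ∧ b = 0 ∧ c = 0 := by
  have h01 : α 0 - α 1 ≠ 0 := sub_ne_zero.mpr (hα.ne (by decide))
  have h02 : α 0 - α 2 ≠ 0 := sub_ne_zero.mpr (hα.ne (by decide))
  have h12 : α 1 - α 2 ≠ 0 := sub_ne_zero.mpr (hα.ne (by decide))
  have ha : a = 0 := by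
    refine (mul_eq_zero.mp ?_).resolve_right (mul_ne_zero (mul_ne_zero h01 h02) h12)
    linear_combination (α 1 - α 2) * h 0 - (α 0 - α 2) * h 1 + (α 0 - α 1) * h 2
  subst ha
  have hb : b = 0 := by
    refine (mul_eq_zero.mp ?_).resolve_right h01
    linear_combination h 0 - h 1
  subst hb
  exact ⟨rfl, rfl, by simpa using h 0⟩

/-- The tuple `(z², z, 1)`. -/
def powVec (z : ℂ) : Fin 3 → ℂ := ![z ^ 2, z, 1]

@[simp] theorem powVec_zero (z : ℂ) : powVec z 0 = z ^ 2 := rfl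
@[simp] theorem powVec_one (z : ℂ) : powVec z 1 = z := rfl
@[simp] theorem powVec_two (z : ℂ) : powVec z 2 = 1 := rfl

/-- The complex matrix underlying an integer matrix. -/
abbrev toComplex {n : ℕ} (U : Matrix (Fin n) (Fin n) ℤ) : Matrix (Fin n) (Fin n) ℂ :=
  U.map (Int.castRingHom ℂ)

theorem hermiteEquiv_iff_eval {f g : ℤ[X]} {α β : Fin 3 → ℂ} (hf : IsCubicWithRoots f α)
    (hg : IsCubicWithRoots g β) :
    HermiteEquiv 3 f g ↔ ∃ (U : Matrix (Fin 3) (Fin 3) ℤ) (ε : ℤ), IsUnit U.det ∧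
      (ε = 1 ∨ ε = -1) ∧ ∀ x : Fin 3 → ℂ,
        (g.coeff 3 : ℂ) ^ 2 * ∏ i, (powVec (β i) ᵥ* toComplex U) ⬝ᵥ x =
          ε * (f.coeff 3 ^ 2 * ∏ i, powVec (α i) ⬝ᵥ x) := by
  refine exists_congr fun U => exists_congr fun ε => and_congr_right fun _ =>
    and_congr_right fun _ => ?_
  rw [MvPolynomial.funext_iff]
  refine forall_congr' fun x => ?_
  rw [map_mul, hf.eval_hermiteForm, MvPolynomial.eval_C, ← MvPolynomial.coe_aeval_eq_eval,
    RingHom.coe_coe, MvPolynomial.aeval_bind₁, MvPolynomial.aeval_eq_eval,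
    hg.eval_hermiteForm]
  simp only [← Matrix.dotProduct_mulVec, Fin.prod_univ_three]
  simp [dotProduct, mulVec, Fin.sum_univ_three, add_assoc]

/-- The relation `λᵢ • (αᵢ², αᵢ, 1) = (βᵢ², βᵢ, 1) U` with nonzero `λᵢ`. -/
def LatticeSimilar (U : Matrix (Fin 3) (Fin 3) ℤ) (α β c : Fin 3 → ℂ) : Prop :=
  ∀ i, c i ≠ 0 ∧ powVec (β i) ᵥ* toComplex U = c i • powVec (α i)

theorem powVec_ne_zero (z : ℂ) : powVec z ≠ 0 := fun h => by
  simpa using congrFun h 2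

theorem toComplex_mul {n : ℕ} (U V : Matrix (Fin n) (Fin n) ℤ) :
    toComplex (U * V) = toComplex U * toComplex V := Matrix.map_mul

theorem toComplex_mul_inv {n : ℕ} {U : Matrix (Fin n) (Fin n) ℤ} (hU : IsUnit U.det) :
    toComplex U * toComplex U⁻¹ = 1 := by
  rw [← toComplex_mul, Matrix.mul_nonsing_inv _ hU, toComplex, Matrix.map_one] <;> simp

theorem LatticeSimilar.symm {U : Matrix (Fin 3) (Fin 3) ℤ} {α β c : Fin 3 → ℂ}
    (hU : IsUnit U.det) (h : LatticeSimilar U α β c) : LatticeSimilar U⁻¹ β α c⁻¹ := by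
  intro i
  obtain ⟨hc, hi⟩ := h i
  refine ⟨inv_ne_zero hc, ?_⟩
  have : powVec (α i) = (c i)⁻¹ • (powVec (β i) ᵥ* toComplex U) := by
    rw [hi, smul_smul, inv_mul_cancel₀ hc, one_smul]
  rw [this, Matrix.smul_vecMul, Matrix.vecMul_vecMul, toComplex_mul_inv hU, Matrix.vecMul_one,
    Pi.inv_apply]

/-- If a product of linear forms vanishes on the plane where `(z², z, 1)` does, then one of the
factors is proportional to `(z², z, 1)`. -/
theorem exists_eq_smul_powVec {w : Fin 3 → Fin 3 → ℂ} {z : ℂ}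
    (h : ∀ x, powVec z ⬝ᵥ x = 0 → ∏ j, w j ⬝ᵥ x = 0) : ∃ j, w j = w j 2 • powVec z := by
  have hzero : ∏ j, (C (w j 0 - w j 2 * z ^ 2) + C (w j 1 - w j 2 * z) * X) = 0 := by
    refine Polynomial.funext fun t => ?_
    have := h ![1, t, -z ^ 2 - z * t] (by simp [dotProduct, Fin.sum_univ_three])
    rw [eval_prod, eval_zero, ← this]
    refine Finset.prod_congr rfl fun j _ => ?_
    simp [dotProduct, Fin.sum_univ_three]
    ring
  obtain ⟨j, -, hj⟩ := Finset.prod_eq_zero_iff.mp hzero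
  have h0 := congrArg (fun p => coeff p 0) hj
  have h1 := congrArg (fun p => coeff p 1) hj
  simp only [coeff_add, coeff_C_mul, coeff_C_zero, coeff_C_succ, coeff_X_zero, coeff_X_one,
    coeff_zero, mul_zero, mul_one, add_zero, zero_add] at h0 h1
  refine ⟨j, funext fun k => ?_⟩
  fin_cases k
  · simpa using sub_eq_zero.mp h0
  · simpa using sub_eq_zero.mp h1
  · simp

theorem exists_latticeSimilar {f g : ℤ[X]} {α β : Fin 3 → ℂ} (hf : IsCubicWithRoots f α)
    (hg : IsCubicWithRoots g β) {U : Matrix (Fin 3) (Fin 3) ℤ} {ε : ℤ} (hU : IsUnit U.det)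
    (h : ∀ x : Fin 3 → ℂ, (g.coeff 3 : ℂ) ^ 2 * ∏ i, (powVec (β i) ᵥ* toComplex U) ⬝ᵥ x =
      ε * (f.coeff 3 ^ 2 * ∏ i, powVec (α i) ⬝ᵥ x)) :
    ∃ (e : Equiv.Perm (Fin 3)) (c : Fin 3 → ℂ), LatticeSimilar U α (β ∘ e) c := by
  have hex : ∀ i, ∃ j, (powVec (β j) ᵥ* toComplex U) =
      (powVec (β j) ᵥ* toComplex U) 2 • powVec (α i) := fun i => by
    refine exists_eq_smul_powVec (w := fun j => powVec (β j) ᵥ* toComplex U) fun x hx => ?_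
    have hx' := h x
    rw [Finset.prod_eq_zero (f := fun i => powVec (α i) ⬝ᵥ x) (Finset.mem_univ i) hx, mul_zero,
      mul_zero] at hx'
    exact (mul_eq_zero.mp hx').resolve_left (pow_ne_zero 2 hg.coeff_three_ne_zero)
  choose σ hσ using hex
  have hne : ∀ i, (powVec (β (σ i)) ᵥ* toComplex U) 2 ≠ 0 := fun i h0 => by
    have h1 := hσ i
    rw [h0, zero_smul] at h1
    have h2 := congrArg (· ᵥ* toComplex U⁻¹) h1
    rw [Matrix.vecMul_vecMul, toComplex_mul_inv hU, Matrix.vecMul_one, Matrix.zero_vecMul] at h2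
    exact powVec_ne_zero _ h2
  have hinj : Function.Injective σ := fun i j hij => by
    have hi := hσ i
    rw [hij] at hi
    have h2 := congrFun (hi.symm.trans (hσ j)) 1
    exact hf.injective (mul_left_cancel₀ (hne j) h2)
  exact ⟨Equiv.ofBijective σ (Finite.injective_iff_bijective.mp hinj), _,
    fun i => ⟨hne i, hσ i⟩⟩

theorem coeff_three_dvd {f : ℤ[X]} {α : Fin 3 → ℂ} (hf : IsCubicWithRoots f α)
    (hprim : f.IsPrimitive) {p a b c : ℤ}
    (h : ∀ i, (p : ℂ) * α i ^ 3 + a * α i ^ 2 + b * α i + c = 0) : f.coeff 3 ∣ p := by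
  obtain ⟨h2, h1, h0⟩ := quadratic_coeffs_eq_zero hf.injective
    (a := p * f.coeff 2 - f.coeff 3 * a) (b := p * f.coeff 1 - f.coeff 3 * b)
    (c := p * f.coeff 0 - f.coeff 3 * c)
    fun i => by linear_combination p * hf.root_eq i - f.coeff 3 * h i
  have h2 : p * f.coeff 2 = f.coeff 3 * a := by exact_mod_cast sub_eq_zero.mp h2
  have h1 : p * f.coeff 1 = f.coeff 3 * b := by exact_mod_cast sub_eq_zero.mp h1
  have h0 : p * f.coeff 0 = f.coeff 3 * c := by exact_mod_cast sub_eq_zero.mp h0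
  have hdvd : C (f.coeff 3) ∣ C p * f := by
    rw [C_dvd_iff_dvd_coeff]
    intro k
    rw [coeff_C_mul]
    match k with
    | 0 => exact ⟨_, h0⟩
    | 1 => exact ⟨_, h1⟩
    | 2 => exact ⟨_, h2⟩
    | 3 => exact dvd_mul_left _ _
    | k + 4 =>
      have hk : f.natDegree < k + 4 := by
        rw [hf.natDegree_eq]
        omega
      rw [coeff_eq_zero_of_natDegree_lt hk, mul_zero]
      exact dvd_zero _
  rw [← dvd_content_iff_C_dvd, content_C_mul, hprim.content_eq_one, mul_one] at hdvd
  exact (dvd_normalize_iff).mp hdvd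

/-- The second generator `θ = f₀α² + f₁α` of the cubic ring `ℤ + ℤ f₀α + ℤ θ` of `f`. -/
noncomputable def theta (f : ℤ[X]) (z : ℂ) : ℂ := f.coeff 3 * z ^ 2 + f.coeff 2 * z

/-- For primitive `f`, the multiplier ring of `ℤα² + ℤα + ℤ` is `ℤ + ℤ f₀α + ℤ θ`. -/
theorem exists_eq_of_multiplier {f : ℤ[X]} {α d : Fin 3 → ℂ} (hf : IsCubicWithRoots f α)
    (hprim : f.IsPrimitive) {T : Matrix (Fin 3) (Fin 3) ℤ}
    (hT : ∀ i, powVec (α i) ᵥ* toComplex T = d i • powVec (α i)) :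
    ∃ r n m : ℤ, ∀ i, d i = r + n * (f.coeff 3 * α i) + m * theta f (α i) := by
  have hT0 i := congrFun (hT i) 0
  have hT1 i := congrFun (hT i) 1
  have hT2 i := congrFun (hT i) 2
  simp [vecMul, dotProduct, Fin.sum_univ_three] at hT0 hT1 hT2
  obtain ⟨m, hm⟩ := coeff_three_dvd hf hprim (p := T 0 2) (a := T 1 2 - T 0 1)
    (b := T 2 2 - T 1 1) (c := -T 2 1) fun i => by
      push_cast
      linear_combination α i * hT2 i - hT1 i
  have hm' : (T 0 2 : ℂ) = f.coeff 3 * m := by exact_mod_cast hm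
  obtain ⟨n, hn⟩ := coeff_three_dvd hf hprim (p := T 1 2 - m * f.coeff 2)
    (a := T 2 2 - m * f.coeff 1 - T 0 0) (b := - m * f.coeff 0 - T 1 0) (c := -T 2 0) fun i => by
      push_cast
      linear_combination α i ^ 2 * hT2 i - hT0 i - α i ^ 4 * hm' - m * α i * hf.root_eq i
  have hn' : (T 1 2 - m * f.coeff 2 : ℂ) = f.coeff 3 * n := by exact_mod_cast hn
  refine ⟨T 2 2, n, m, fun i => ?_⟩
  rw [theta]
  linear_combination -hT2 i + α i ^ 2 * hm' + α i * hn'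

theorem exists_eq_of_latticeSimilar {f : ℤ[X]} {α β c d : Fin 3 → ℂ}
    (hf : IsCubicWithRoots f α) (hprim : f.IsPrimitive) {U T : Matrix (Fin 3) (Fin 3) ℤ}
    (hU : IsUnit U.det) (h : LatticeSimilar U α β c)
    (hT : ∀ i, powVec (β i) ᵥ* toComplex T = d i • powVec (β i)) :
    ∃ r n m : ℤ, ∀ i, d i = r + n * (f.coeff 3 * α i) + m * theta f (α i) := by
  refine exists_eq_of_multiplier hf hprim (T := U⁻¹ * T * U) fun i => ?_
  obtain ⟨hc, hi⟩ := h i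
  rw [toComplex_mul, toComplex_mul, ← Matrix.vecMul_vecMul, ← Matrix.vecMul_vecMul,
    (h.symm hU i).2, Matrix.smul_vecMul, hT, Matrix.smul_vecMul, Matrix.smul_vecMul, hi,
    smul_comm (d i), smul_smul, Pi.inv_apply, inv_mul_cancel₀ hc, one_smul]

/-- A square root of the discriminant. -/
noncomputable def sqrtDisc (f : ℤ[X]) (α : Fin 3 → ℂ) : ℂ :=
  f.coeff 3 ^ 2 * ((α 0 - α 1) * (α 0 - α 2) * (α 1 - α 2))

theorem IsCubicWithRoots.sqrtDisc_ne_zero {f : ℤ[X]} {α : Fin 3 → ℂ}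
    (hf : IsCubicWithRoots f α) : sqrtDisc f α ≠ 0 :=
  mul_ne_zero (pow_ne_zero 2 hf.coeff_three_ne_zero)
    (mul_ne_zero (mul_ne_zero (sub_ne_zero.mpr (hf.injective.ne (by decide)))
      (sub_ne_zero.mpr (hf.injective.ne (by decide))))
      (sub_ne_zero.mpr (hf.injective.ne (by decide))))

/-- Similar lattices have the same multiplier ring, and the change of basis between the
canonical bases of the two cubic rings relates the cubics. -/
theorem LatticeSimilar.exists_translate {f g : ℤ[X]} {α β c : Fin 3 → ℂ}
    (hf : IsCubicWithRoots f α) (hg : IsCubicWithRoots g β) (hprim : f.IsPrimitive)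
    {U : Matrix (Fin 3) (Fin 3) ℤ} (hU : IsUnit U.det) (h : LatticeSimilar U α β c) :
    ∃ M : Matrix (Fin 2) (Fin 2) ℤ, sqrtDisc g β = M.det * sqrtDisc f α ∧
      ∀ z : ℂ, sqrtDisc g β * aeval z g = sqrtDisc f α * aeval z (glTranslate 3 f M) := by
  obtain ⟨r, n, m, hω⟩ := exists_eq_of_latticeSimilar hf hprim hU h
    (T := !![-g.coeff 2, g.coeff 3, 0; -g.coeff 1, 0, g.coeff 3; -g.coeff 0, 0, 0])
    (d := fun i => g.coeff 3 * β i) fun i => by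
      ext k
      fin_cases k <;> simp [vecMul, dotProduct, Fin.sum_univ_three]
      · linear_combination -hg.root_eq i
      all_goals ring
  obtain ⟨r', n', m', hθ⟩ := exists_eq_of_latticeSimilar hf hprim hU h
    (T := !![-g.coeff 1, 0, g.coeff 3; -g.coeff 0, -g.coeff 1, g.coeff 2; 0, -g.coeff 0, 0])
    (d := fun i => theta g (β i)) fun i => by
      ext k
      fin_cases k <;> simp [vecMul, dotProduct, Fin.sum_univ_three, theta]
      · linear_combination -β i * hg.root_eq i
      · linear_combination -hg.root_eq i
      · ring
  simp only [theta] at hω hθ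
  refine ⟨!![n, n'; m, m'], ?_, fun z => ?_⟩
  · have e1 : (g.coeff 3 : ℂ) * (β 0 - β 1) = n * (f.coeff 3 * (α 0 - α 1)) +
        m * ((α 0 - α 1) * (f.coeff 3 * (α 0 + α 1) + f.coeff 2)) := by
      linear_combination hω 0 - hω 1
    have e2 : (g.coeff 3 : ℂ) * (β 0 - β 2) = n * (f.coeff 3 * (α 0 - α 2)) +
        m * ((α 0 - α 2) * (f.coeff 3 * (α 0 + α 2) + f.coeff 2)) := by
      linear_combination hω 0 - hω 2
    have e3 : (β 0 - β 1) * (g.coeff 3 * (β 0 + β 1) + g.coeff 2) =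
        n' * (f.coeff 3 * (α 0 - α 1)) +
        m' * ((α 0 - α 1) * (f.coeff 3 * (α 0 + α 1) + f.coeff 2)) := by
      linear_combination hθ 0 - hθ 1
    have e4 : (β 0 - β 2) * (g.coeff 3 * (β 0 + β 2) + g.coeff 2) =
        n' * (f.coeff 3 * (α 0 - α 2)) +
        m' * ((α 0 - α 2) * (f.coeff 3 * (α 0 + α 2) + f.coeff 2)) := by
      linear_combination hθ 0 - hθ 2
    have key := congrArg₂ (· - ·) (congrArg₂ (· * ·) e2 e3) (congrArg₂ (· * ·) e1 e4)
    simp only [sqrtDisc, Matrix.det_fin_two_of]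
    push_cast
    linear_combination key
  · rw [hf.aeval_glTranslate, hg.aeval_eq_prod]
    obtain ⟨hf2, -, -⟩ := hf.vieta
    obtain ⟨hg2, -, -⟩ := hg.vieta
    rw [hf2] at hω hθ
    rw [hg2] at hθ
    have e2 : (g.coeff 3 : ℂ) * ((β 0 - β 1) * (z - β 2)) = f.coeff 3 * ((α 0 - α 1) *
        (n * z + n' - α 2 * (m * z + m'))) := by
      linear_combination z * (hω 0 - hω 1) + hθ 0 - hθ 1
    have e1 : (g.coeff 3 : ℂ) * ((β 0 - β 2) * (z - β 1)) = f.coeff 3 * ((α 0 - α 2) *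
        (n * z + n' - α 1 * (m * z + m'))) := by
      linear_combination z * (hω 0 - hω 2) + hθ 0 - hθ 2
    have e0 : (g.coeff 3 : ℂ) * ((β 1 - β 2) * (z - β 0)) = f.coeff 3 * ((α 1 - α 2) *
        (n * z + n' - α 0 * (m * z + m'))) := by
      linear_combination z * (hω 1 - hω 2) + hθ 1 - hθ 2
    have key := congrArg₂ (· * ·) (congrArg₂ (· * ·) e0 e1) e2
    simp [sqrtDisc, Fin.prod_univ_three]
    linear_combination key

theorem glTranslate_C_mul (n : ℕ) (c : ℤ) (f : ℤ[X]) (M : Matrix (Fin 2) (Fin 2) ℤ) :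
    glTranslate n (C c * f) M = C c * glTranslate n f M := by
  simp [glTranslate, Finset.mul_sum, mul_assoc]

theorem GL2Equiv.C_mul {n : ℕ} {f g : ℤ[X]} (h : GL2Equiv n f g) (c : ℤ) :
    GL2Equiv n (C c * f) (C c * g) := by
  obtain ⟨M, hM, h⟩ := h
  refine ⟨M, hM, ?_⟩
  rw [glTranslate_C_mul, ← mul_neg]
  exact h.imp (congrArg _) (congrArg _)

theorem eq_of_aeval_eq {f g : ℤ[X]} (h : ∀ z : ℂ, aeval z f = aeval z g) : f = g := by
  refine Polynomial.map_injective _ (Int.castRingHom ℂ).injective_int (Polynomial.funext fun z => ?_)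
  simpa [eval_map, aeval_def] using h z

/-- Similar lattices attached to primitive cubics come from equivalent cubics of equal
discriminant. -/
theorem LatticeSimilar.gl2Equiv {f g : ℤ[X]} {α β c : Fin 3 → ℂ}
    (hf : IsCubicWithRoots f α) (hg : IsCubicWithRoots g β) (hfp : f.IsPrimitive)
    (hgp : g.IsPrimitive) {U : Matrix (Fin 3) (Fin 3) ℤ} (hU : IsUnit U.det)
    (h : LatticeSimilar U α β c) :
    GL2Equiv 3 f g ∧ (sqrtDisc g β = sqrtDisc f α ∨ sqrtDisc g β = -sqrtDisc f α) := by
  obtain ⟨M, hM, hz⟩ := h.exists_translate hf hg hfp hU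
  obtain ⟨N, hN, -⟩ := (h.symm hU).exists_translate hg hf hgp
    (U.isUnit_nonsing_inv_det hU)
  have hunit : N.det * M.det = 1 := by
    have : (N.det * M.det : ℂ) = 1 := by
      refine mul_right_cancel₀ hf.sqrtDisc_ne_zero ?_
      linear_combination -hN - N.det * hM
    exact_mod_cast this
  have hMu : IsUnit M.det := IsUnit.of_mul_eq_one_right _ hunit
  refine ⟨⟨M, hMu, ?_⟩, ?_⟩ <;> rcases Int.isUnit_iff.mp hMu with h1 | h1 <;>
    rw [h1] at hM <;> push_cast at hM
  · refine .inl (eq_of_aeval_eq fun z => mul_left_cancel₀ hf.sqrtDisc_ne_zero ?_)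
    rw [← hz, hM, one_mul]
  · refine .inr (eq_of_aeval_eq fun z => mul_left_cancel₀ hf.sqrtDisc_ne_zero ?_)
    rw [map_neg, mul_neg, ← hz, hM]
    ring
  · exact .inl (by rw [hM, one_mul])
  · exact .inr (by rw [hM, neg_one_mul])

theorem det_powVec (α : Fin 3 → ℂ) : (Matrix.of fun i => powVec (α i)).det =
    (α 0 - α 1) * (α 0 - α 2) * (α 1 - α 2) := by
  rw [Matrix.det_fin_three]
  simp
  ring

theorem LatticeSimilar.det_mul {U : Matrix (Fin 3) (Fin 3) ℤ} {α β c : Fin 3 → ℂ}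
    (h : LatticeSimilar U α β c) :
    (β 0 - β 1) * (β 0 - β 2) * (β 1 - β 2) * U.det =
      (∏ i, c i) * ((α 0 - α 1) * (α 0 - α 2) * (α 1 - α 2)) := by
  have hmat : (Matrix.of fun i => powVec (β i)) * toComplex U =
      Matrix.diagonal c * Matrix.of fun i => powVec (α i) := by
    ext i j
    rw [Matrix.diagonal_mul]
    exact congrFun (h i).2 j
  have := congrArg Matrix.det hmat
  rwa [Matrix.det_mul, Matrix.det_mul, Matrix.det_diagonal, det_powVec, det_powVec,
    toComplex, ← RingHom.mapMatrix_apply, ← RingHom.map_det] at this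

theorem gl2Equiv_of_hermiteEquiv {f g : ℤ[X]} {α β : Fin 3 → ℂ} (hf : IsCubicWithRoots f α)
    (hg : IsCubicWithRoots g β) (h : HermiteEquiv 3 f g) : GL2Equiv 3 f g := by
  obtain ⟨U, ε, hU, hε, h⟩ := (hermiteEquiv_iff_eval hf hg).mp h
  obtain ⟨e, c, hsim⟩ := exists_latticeSimilar hf hg hU h
  have hnorm : (g.coeff 3 : ℂ) ^ 2 * ∏ i, c i = ε * f.coeff 3 ^ 2 := by
    have h2 := h ![0, 0, 1]
    have hx (i) : (powVec (β (e i)) ᵥ* toComplex U) ⬝ᵥ ![0, 0, 1] = c i := by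
      rw [show powVec (β (e i)) ᵥ* toComplex U = _ from (hsim i).2]
      simp [dotProduct, Fin.sum_univ_three]
    rw [← Equiv.prod_comp e] at h2
    simp only [hx] at h2
    simpa [dotProduct, Fin.sum_univ_three] using h2
  have hfc : f.content ≠ 0 := hf.content_ne_zero
  have hgc : g.content ≠ 0 := hg.content_ne_zero
  have hf1 : IsCubicWithRoots f.primPart α :=
    .of_C_mul hfc (by rwa [← eq_C_content_mul_primPart])
  have hg1 : IsCubicWithRoots g.primPart (β ∘ e) :=
    .of_C_mul hgc (by rw [← eq_C_content_mul_primPart]; exact hg.comp_perm e)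
  obtain ⟨hequiv, hdisc⟩ := hsim.gl2Equiv hf1 hg1 f.isPrimitive_primPart
    g.isPrimitive_primPart hU
  suffices hc : f.content = g.content by
    rw [f.eq_C_content_mul_primPart, g.eq_C_content_mul_primPart, ← hc]
    exact hequiv.C_mul _
  obtain ⟨δ, hδ, hdisc⟩ : ∃ δ : ℤ, IsUnit δ ∧
      sqrtDisc g.primPart (β ∘ e) = δ * sqrtDisc f.primPart α :=
    hdisc.elim (fun h => ⟨1, isUnit_one, by simpa using h⟩)
      fun h => ⟨-1, isUnit_one.neg, by simpa using h⟩
  have hfe : (f.coeff 3 : ℂ) = f.content * f.primPart.coeff 3 := by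
    conv_lhs => rw [f.eq_C_content_mul_primPart, coeff_C_mul, Int.cast_mul]
  have hge : (g.coeff 3 : ℂ) = g.content * g.primPart.coeff 3 := by
    conv_lhs => rw [g.eq_C_content_mul_primPart, coeff_C_mul, Int.cast_mul]
  have hdet := hsim.det_mul
  have hsq : g.content ^ 2 * (δ * U.det) = ε * f.content ^ 2 := by
    have : (g.content ^ 2 * (δ * U.det) : ℂ) = ε * f.content ^ 2 := by
      refine mul_right_cancel₀ hf1.sqrtDisc_ne_zero ?_
      rw [hfe, hge] at hnorm
      rw [sqrtDisc, sqrtDisc] at hdisc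
      rw [sqrtDisc]
      linear_combination -(g.content ^ 2 * U.det : ℂ) * hdisc +
        g.content ^ 2 * g.primPart.coeff 3 ^ 2 * hdet +
        (α 0 - α 1) * (α 0 - α 2) * (α 1 - α 2) * hnorm
    exact_mod_cast this
  have habs := congrArg Int.natAbs hsq
  rw [Int.natAbs_mul, Int.natAbs_mul, Int.natAbs_mul, Int.isUnit_iff_natAbs_eq.mp hδ,
    Int.isUnit_iff_natAbs_eq.mp hU, Int.isUnit_iff_natAbs_eq.mp (Int.isUnit_iff.mpr hε),
    Int.natAbs_pow, Int.natAbs_pow, mul_one, mul_one, one_mul] at habs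
  rw [← normalize_content (p := f), ← normalize_content (p := g), ← Int.abs_eq_normalize,
    ← Int.abs_eq_normalize, Int.abs_eq_natAbs, Int.abs_eq_natAbs,
    Nat.pow_left_injective two_ne_zero habs]

theorem hermiteEquiv_of_gl2Equiv {f g : ℤ[X]} {α β : Fin 3 → ℂ} (hf : IsCubicWithRoots f α)
    (hg : IsCubicWithRoots g β) (h : GL2Equiv 3 f g) : HermiteEquiv 3 f g := by
  obtain ⟨M, hM, h⟩ := h
  obtain ⟨δ, hδ, h⟩ : ∃ δ : ℂ, δ ^ 2 = 1 ∧ ∀ z : ℂ, aeval z g = δ * aeval z (glTranslate 3 f M) :=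
    h.elim (fun h => ⟨1, by simp, by simp [h]⟩) fun h => ⟨-1, by simp, by simp [h]⟩
  simp only [hf.aeval_glTranslate, hg.aeval_eq_prod] at h
  have hD : (M.det : ℂ) ^ 2 = 1 := by
    rcases Int.isUnit_iff.mp hM with h | h <;> simp [h]
  have hD0 : (M.det : ℂ) ≠ 0 := fun h0 => by simp [h0] at hD
  have hMdet : (M.det : ℂ) = M 0 0 * M 1 1 - M 0 1 * M 1 0 := by
    rw [Matrix.det_fin_two]
    push_cast
    rfl
  have hδ0 : δ ≠ 0 := fun h0 => by simp [h0] at hδ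
  have hex : ∀ i, ∃ j, M 0 0 * β i + M 0 1 = α j * (M 1 0 * β i + M 1 1) := fun i => by
    have hi := h (β i)
    rw [Finset.prod_eq_zero (Finset.mem_univ i) (sub_self _), mul_zero, eq_comm, mul_eq_zero,
      mul_eq_zero, or_iff_right hδ0, or_iff_right hf.coeff_three_ne_zero,
      Finset.prod_eq_zero_iff] at hi
    exact hi.imp fun j hj => sub_eq_zero.mp hj.2
  choose σ hσ using hex
  have hinj : Function.Injective σ := fun i j hij => by
    have hi := hσ i
    rw [hij] at hi
    refine hg.injective (sub_eq_zero.mp ((mul_eq_zero.mp ?_).resolve_left hD0))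
    linear_combination (β i - β j) * hMdet + (M 1 0 * β j + M 1 1) * hi -
      (M 1 0 * β i + M 1 1) * hσ j
  obtain ⟨e, rfl⟩ : ∃ e : Equiv.Perm (Fin 3), ⇑e = σ :=
    ⟨Equiv.ofBijective σ (Finite.injective_iff_bijective.mp hinj), rfl⟩
  have hfactor (i) : (M 0 0 - α (e i) * M 1 0) * (M 1 0 * β i + M 1 1) = M.det := by
    linear_combination M 1 0 * hσ i - hMdet
  have hlead : (g.coeff 3 : ℂ) = δ * (f.coeff 3 * ∏ i, (M 0 0 - α (e i) * M 1 0)) := by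
    obtain ⟨z, hz⟩ := Infinite.exists_notMem_finset (Finset.univ.image β)
    have hprod : ∏ i, (z - β i) ≠ 0 := Finset.prod_ne_zero_iff.mpr fun i _ h0 =>
      hz (Finset.mem_image.mpr ⟨i, Finset.mem_univ i, (sub_eq_zero.mp h0).symm⟩)
    refine mul_right_cancel₀ hprod ?_
    rw [h, mul_assoc, mul_assoc, ← Finset.prod_mul_distrib, ← Equiv.prod_comp e]
    congr 2
    refine Finset.prod_congr rfl fun i _ => ?_
    linear_combination hσ i
  have hnorm : (g.coeff 3 : ℂ) ^ 2 * ∏ i, (M 1 0 * β i + M 1 1) ^ 2 = f.coeff 3 ^ 2 := by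
    rw [hlead, Finset.prod_pow, ← mul_pow, mul_assoc, mul_assoc, ← Finset.prod_mul_distrib,
      Finset.prod_congr rfl fun i _ => hfactor i, mul_pow, mul_pow, hδ, ← Finset.prod_pow, hD]
    simp
  refine (hermiteEquiv_iff_eval hf hg).mpr ⟨
    !![M 0 0 ^ 2, M 0 0 * M 1 0, M 1 0 ^ 2;
      2 * M 0 0 * M 0 1, M 0 0 * M 1 1 + M 0 1 * M 1 0, 2 * M 1 0 * M 1 1;
      M 0 1 ^ 2, M 0 1 * M 1 1, M 1 1 ^ 2], 1, ?_, .inl rfl, fun x => ?_⟩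
  · convert hM.pow 3
    rw [Matrix.det_fin_three, Matrix.det_fin_two]
    simp
    ring
  · have hrow (i) : (powVec (β i) ᵥ* toComplex !![M 0 0 ^ 2, M 0 0 * M 1 0, M 1 0 ^ 2;
        2 * M 0 0 * M 0 1, M 0 0 * M 1 1 + M 0 1 * M 1 0, 2 * M 1 0 * M 1 1;
        M 0 1 ^ 2, M 0 1 * M 1 1, M 1 1 ^ 2]) =
        (M 1 0 * β i + M 1 1 : ℂ) ^ 2 • powVec (α (e i)) := by
      ext k
      fin_cases k <;> simp [vecMul, dotProduct, Fin.sum_univ_three]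
      · linear_combination (M 0 0 * β i + M 0 1 + α (e i) * (M 1 0 * β i + M 1 1)) * hσ i
      · linear_combination (M 1 0 * β i + M 1 1) * hσ i
      · ring
    simp only [hrow, smul_dotProduct, smul_eq_mul, Finset.prod_mul_distrib]
    rw [← mul_assoc, hnorm, Int.cast_one, one_mul,
      Equiv.prod_comp e fun i => powVec (α i) ⬝ᵥ x]

/-- cubic polynomials with nonzero discriminant are Hermite equivalent
iff they are `GL₂(ℤ)`-equivalent. -/
theorem hermiteEquiv_iff_gl2Equiv_cubic (f g : Polynomial ℤ)
    (hfn : f.natDegree = 3) (hgn : g.natDegree = 3)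
    (hdf : discC f ≠ 0) (hdg : discC g ≠ 0) :
    HermiteEquiv 3 f g ↔ GL2Equiv 3 f g := by
  obtain ⟨α, hα⟩ := exists_isCubicWithRoots hfn hdf
  obtain ⟨β, hβ⟩ := exists_isCubicWithRoots hgn hdg
  exact ⟨gl2Equiv_of_hermiteEquiv hα hβ, hermiteEquiv_of_gl2Equiv hα hβ⟩
end

section
/- Let n ≥ 3 be an integer and let f ∈ ℤ[X] be a monic irreducible polynomial of degree n with constant coefficient f(0) = 1, such that the stabilizer of f in GL₂(ℤ) is trivial, i.e. the only matrices M ∈ GL₂(ℤ) with (f∘M) = ±f are M = ±I₂. Then the monic reducible polynomials g(X) := X·f(X) and h(X) := X^(n+1)·f(1/X) = ∑_{k=0}^n f_k·X^(n+1−k) (where f_k is the coefficient of X^k in f), both of degree n+1, are Hermite equivalent but not GL₂(ℤ)-equivalent. -/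
open Polynomial

section HermiteEquivalence

/-- The linear form `α^(N-1) X₁ + ⋯ + X_N` attached to a root `α` in the Hermite form. -/
noncomputable def rootForm (N : ℕ) (α : ℂ) : MvPolynomial (Fin N) ℂ :=
  ∑ j : Fin N, MvPolynomial.C (α ^ (N - 1 - (j : ℕ))) * MvPolynomial.X j

lemma hermiteForm_of_monic (N : ℕ) {p : ℤ[X]} (hp : p.Monic) :
    hermiteForm N p = ((p.map (Int.castRingHom ℂ)).roots.map (rootForm N)).prod := by
  simp only [hermiteForm, hp.leadingCoeff, Int.cast_one, one_pow, map_one, one_mul]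
  rfl

/-- The integral linear map `x ↦ (x_{n-i} + f_i (x_n - x_0))_i`. -/
def flipMap (n : ℕ) (f : ℤ[X]) : (Fin (n + 1) → ℤ) →ₗ[ℤ] (Fin (n + 1) → ℤ) where
  toFun x i := x i.rev + f.coeff i * (x (Fin.last n) - x 0)
  map_add' x y := by ext i; simp; ring
  map_smul' c x := by ext i; simp; ring

/-- The inverse of `flipMap`. -/
def flipInv (n : ℕ) (f : ℤ[X]) : (Fin (n + 1) → ℤ) →ₗ[ℤ] (Fin (n + 1) → ℤ) where
  toFun y i := y i.rev - f.coeff i.rev * (y 0 - y (Fin.last n))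
  map_add' x y := by ext i; simp; ring
  map_smul' c x := by ext i; simp; ring

lemma flipInv_comp_flipMap {n : ℕ} {f : ℤ[X]} (h0 : f.coeff 0 = 1) (hn : f.coeff n = 1) :
    flipInv n f ∘ₗ flipMap n f = LinearMap.id := by
  ext1 j
  ext i
  simp [flipInv, flipMap, h0, hn]

lemma isUnit_det_toMatrix'_flipMap {n : ℕ} {f : ℤ[X]} (h0 : f.coeff 0 = 1)
    (hn : f.coeff n = 1) : IsUnit (LinearMap.toMatrix' (flipMap n f)).det := by
  apply Matrix.isUnit_det_of_left_inverse (B := LinearMap.toMatrix' (flipInv n f))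
  rw [← LinearMap.toMatrix'_comp, flipInv_comp_flipMap h0 hn, LinearMap.toMatrix'_id]

lemma sum_toMatrix'_flipMap (n : ℕ) (f : ℤ[X]) (i : Fin (n + 1)) :
    (∑ j, MvPolynomial.C ((LinearMap.toMatrix' (flipMap n f) i j : ℤ) : ℂ) * MvPolynomial.X j :
        MvPolynomial (Fin (n + 1)) ℂ) =
      MvPolynomial.X i.rev + MvPolynomial.C (f.coeff i : ℂ) *
        (MvPolynomial.X (Fin.last n) - MvPolynomial.X 0) := by
  simp [LinearMap.toMatrix'_apply, flipMap, Pi.single_apply, apply_ite MvPolynomial.C, add_mul, sub_mul, mul_sub,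
    Finset.sum_add_distrib, Finset.sum_sub_distrib, ite_mul]

/-- The substitution `X_i ↦ X_{n-i} + f_i (X_n - X_0)`. -/
noncomputable def flipHom (n : ℕ) (f : ℤ[X]) :
    MvPolynomial (Fin (n + 1)) ℂ →ₐ[ℂ] MvPolynomial (Fin (n + 1)) ℂ :=
  MvPolynomial.bind₁ fun i => MvPolynomial.X i.rev + MvPolynomial.C (f.coeff i : ℂ) *
    (MvPolynomial.X (Fin.last n) - MvPolynomial.X 0)

lemma rootForm_zero (n : ℕ) : rootForm (n + 1) 0 = MvPolynomial.X (Fin.last n) := by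
  rw [rootForm, Finset.sum_eq_single (Fin.last n)]
  · simp
  · intro j _ hj
    have : (j : ℕ) < n := Fin.val_lt_last hj
    have h : n - (j : ℕ) ≠ 0 := by omega
    simp [h]
  · simp

lemma flipHom_rootForm_zero {n : ℕ} {f : ℤ[X]} (hn : f.coeff n = 1) :
    flipHom n f (rootForm (n + 1) 0) = rootForm (n + 1) 0 := by
  simp [rootForm_zero, flipHom, hn]

lemma flipHom_rootForm_inv {n : ℕ} {f : ℤ[X]} (hfn : f.natDegree = n) {α : ℂ} (hα : α ≠ 0)
    (hroot : (f.map (Int.castRingHom ℂ)).eval α = 0) :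
    flipHom n f (rootForm (n + 1) α⁻¹) =
      MvPolynomial.C ((α ^ n)⁻¹) * rootForm (n + 1) α := by
  have key : ∑ i : Fin (n + 1), (α ^ n)⁻¹ * α ^ (i : ℕ) * (f.coeff i : ℂ) = 0 := by
    have h : ∑ i : Fin (n + 1), (f.coeff i : ℂ) * α ^ (i : ℕ) = 0 := by
      rw [Fin.sum_univ_eq_sum_range (fun i => (f.coeff i : ℂ) * α ^ i)]
      rw [eval_map, eval₂_eq_sum_range, hfn] at hroot
      simpa using hroot
    calc _ = (α ^ n)⁻¹ * ∑ i : Fin (n + 1), (f.coeff i : ℂ) * α ^ (i : ℕ) := by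
          rw [Finset.mul_sum]
          exact Finset.sum_congr rfl fun i _ => by ring
      _ = 0 := by rw [h, mul_zero]
  have hpow (i : Fin (n + 1)) : α⁻¹ ^ (n - (i : ℕ)) = (α ^ n)⁻¹ * α ^ (i : ℕ) := by
    have hi : (i : ℕ) ≤ n := Nat.lt_succ_iff.mp i.2
    rw [inv_pow, pow_sub₀ _ hα hi, mul_inv, inv_inv]
  have hlin (i : Fin (n + 1)) : flipHom n f (MvPolynomial.C (α⁻¹ ^ (n + 1 - 1 - (i : ℕ))) *
      MvPolynomial.X i) = MvPolynomial.C ((α ^ n)⁻¹ * α ^ (i : ℕ)) * MvPolynomial.X i.rev +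
        MvPolynomial.C ((α ^ n)⁻¹ * α ^ (i : ℕ) * (f.coeff i : ℂ)) *
          (MvPolynomial.X (Fin.last n) - MvPolynomial.X 0) := by
    rw [Nat.add_sub_cancel, hpow, map_mul (flipHom n f), flipHom, MvPolynomial.bind₁_C_right,
      MvPolynomial.bind₁_X_right, mul_add, MvPolynomial.C_mul (a' := (f.coeff i : ℂ))]
    ring
  rw [rootForm, map_sum, Finset.sum_congr rfl fun i _ => hlin i, Finset.sum_add_distrib,
    ← Finset.sum_mul, ← map_sum, key, map_zero, zero_mul, add_zero, rootForm, Finset.mul_sum,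
    ← Equiv.sum_comp Fin.revPerm]
  refine Finset.sum_congr rfl fun i _ => ?_
  simp [mul_assoc]

lemma sum_coeff_eq_X_mul_reflect (n : ℕ) (f : ℤ[X]) :
    ∑ k ∈ Finset.range (n + 1), C (f.coeff k) * X ^ (n + 1 - k) =
      X * ∑ k ∈ Finset.range (n + 1), C (f.coeff k) * X ^ (n - k) := by
  rw [Finset.mul_sum]
  refine Finset.sum_congr rfl fun k hk => ?_
  have : n + 1 - k = (n - k) + 1 := by have := Finset.mem_range.mp hk; omega
  rw [this]; ring

lemma reflect_finsetSum {R ι : Type*} [Semiring R] (N : ℕ) (s : Finset ι) (p : ι → R[X]) :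
    reflect N (∑ k ∈ s, p k) = ∑ k ∈ s, reflect N (p k) := by
  ext i
  simp [coeff_reflect]

lemma reflect_eq_sum {R : Type*} [CommSemiring R] {n : ℕ} {f : R[X]} (hfn : f.natDegree = n) :
    reflect n f = ∑ k ∈ Finset.range (n + 1), C (f.coeff k) * X ^ (n - k) := by
  conv_lhs => rw [f.as_sum_range_C_mul_X_pow]
  rw [hfn, reflect_finsetSum]
  refine Finset.sum_congr rfl fun k hk => ?_
  rw [reflect_C_mul_X_pow, revAt_le (by have := Finset.mem_range.mp hk; omega)]

lemma reflect_one_linear {R : Type*} [CommRing R] (a b : R) :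
    reflect 1 (C a * X + C b) = C b * X + C a := by
  rw [reflect_add, reflect_C_mul, reflect_one_X, reflect_C, mul_one, pow_one, add_comm]

lemma reverse_multiset_prod_X_sub_C {K : Type*} [Field K] (s : Multiset K)
    (hs : (0 : K) ∉ s) :
    (s.map fun a => X - C a).prod.reverse =
      C (s.map fun a => -a).prod * ((s.map fun a => a⁻¹).map fun a => X - C a).prod := by
  induction s using Multiset.induction_on with
  | empty => simpa using reverse_C (1 : K)
  | cons a s ih =>
    have ha : a ≠ 0 := fun h => hs (by simp [h])
    have h1 : (X - C a : K[X]).reverse = C (-a) * (X - C a⁻¹) := by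
      have h := reflect_one_linear (1 : K) (-a)
      rw [C_1, one_mul, C_neg, ← sub_eq_add_neg] at h
      rw [reverse, natDegree_X_sub_C, h, mul_sub, ← C_mul, neg_mul a, mul_inv_cancel₀ ha]
      simp
    simp only [Multiset.map_cons, Multiset.prod_cons, reverse_mul_of_domain, h1,
      ih fun h => hs (Multiset.mem_cons_of_mem h), C_mul]
    ring

lemma hermiteEquiv_X_mul_reflect {n : ℕ} {f : ℤ[X]} (hfm : f.Monic)
    (hfn : f.natDegree = n) (hf0 : f.eval 0 = 1) :
    HermiteEquiv (n + 1) (X * f) (X * reflect n f) := by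
  set F := f.map (Int.castRingHom ℂ) with hF
  set S := F.roots with hS
  have hFm : F.Monic := hfm.map _
  have hF0 : F.eval 0 = 1 := by
    have := congrArg (Int.castRingHom ℂ) hf0
    rwa [← eval₂_at_apply, map_zero, ← eval_map, map_one] at this
  have hprod : F = (S.map fun a => X - C a).prod :=
    (IsAlgClosed.splits F).eq_prod_roots_of_monic hFm
  have hS0 : (0 : ℂ) ∉ S := fun h => by
    have := (mem_roots'.mp h).2
    rw [IsRoot, hF0] at this
    exact one_ne_zero this
  have hneg : (S.map fun a => -a).prod = 1 := by
    rw [← hF0, hprod, eval_multiset_prod, Multiset.map_map]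
    simp
  have hcard : Multiset.card S = n := by
    rw [← hfn, ← hfm.natDegree_map (Int.castRingHom ℂ)]
    exact (splits_iff_card_roots.mp (IsAlgClosed.splits F))
  have hSprod : S.prod = (-1) ^ n := by
    have h := Multiset.prod_map_neg S
    rw [hneg, hcard] at h
    have h2 : ((-1 : ℂ) ^ n) * (-1) ^ n = 1 := by rw [← mul_pow]; simp
    calc S.prod = ((-1 : ℂ) ^ n * (-1) ^ n) * S.prod := by rw [h2, one_mul]
      _ = (-1) ^ n := by rw [mul_assoc, ← h, mul_one]
  have hrev : (reflect n f).map (Int.castRingHom ℂ) =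
      ((S.map fun a => a⁻¹).map fun a => X - C a).prod := by
    have h := reverse_multiset_prod_X_sub_C S hS0
    rw [hneg, C_1, one_mul, ← hprod, reverse, hfm.natDegree_map, hfn] at h
    rw [← h, hF, reflect_map]
  have hrm : (reflect n f).Monic := by
    rw [← hfn, ← reverse, Monic, reverse_leadingCoeff, trailingCoeff_eq_coeff_zero,
      coeff_zero_eq_eval_zero, hf0]
    rw [coeff_zero_eq_eval_zero, hf0]
    exact one_ne_zero
  have hroots_g : ((X * f).map (Int.castRingHom ℂ)).roots = 0 ::ₘ S := by
    rw [Polynomial.map_mul, map_X, roots_mul (mul_ne_zero X_ne_zero hFm.ne_zero), roots_X]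
    rfl
  have hroots_h : ((X * reflect n f).map (Int.castRingHom ℂ)).roots =
      0 ::ₘ S.map fun a => a⁻¹ := by
    rw [Polynomial.map_mul, map_X, roots_mul (mul_ne_zero X_ne_zero (hrm.map _).ne_zero),
      roots_X, hrev, roots_multiset_prod_X_sub_C]
    rfl
  have h0 : f.coeff 0 = 1 := by rw [coeff_zero_eq_eval_zero, hf0]
  have hn : f.coeff n = 1 := by rw [← hfn]; exact hfm
  refine ⟨LinearMap.toMatrix' (flipMap n f), ((-1) ^ n) ^ n,
    isUnit_det_toMatrix'_flipMap h0 hn, ?_, ?_⟩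
  · rw [← pow_mul]
    exact neg_one_pow_eq_or ℤ _
  · rw [hermiteForm_of_monic _ (monic_X.mul hrm), hermiteForm_of_monic _ (monic_X.mul hfm),
      hroots_g, hroots_h]
    simp only [sum_toMatrix'_flipMap]
    change flipHom n f _ = _
    rw [Multiset.map_cons, Multiset.prod_cons, Multiset.map_cons, Multiset.prod_cons, map_mul,
      flipHom_rootForm_zero hn, map_multiset_prod, Multiset.map_map, Multiset.map_map]
    have hmap : S.map ((flipHom n f ∘ rootForm (n + 1)) ∘ fun a => a⁻¹) =
        S.map fun α => MvPolynomial.C ((α ^ n)⁻¹) * rootForm (n + 1) α :=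
      Multiset.map_congr rfl fun α hα => flipHom_rootForm_inv hfn
        (fun h => hS0 (h ▸ hα)) (mem_roots'.mp hα).2
    have hC : (S.map fun α => (MvPolynomial.C ((α ^ n)⁻¹) : MvPolynomial (Fin (n + 1)) ℂ)).prod =
        MvPolynomial.C ((((-1) ^ n) ^ n : ℤ) : ℂ) := by
      have h1 : (S.map fun α => (α ^ n)⁻¹).prod = (((-1) ^ n) ^ n : ℂ) := by
        rw [Multiset.prod_map_inv, Multiset.prod_map_pow, Multiset.map_id', hSprod, ← inv_pow,
          ← inv_pow]
        norm_num
      have h2 := map_multiset_prod (MvPolynomial.C (σ := Fin (n + 1)))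
        (S.map fun α => (α ^ n)⁻¹)
      rw [Multiset.map_map, h1] at h2
      push_cast
      exact h2.symm
    rw [hmap, Multiset.prod_map_mul, hC]
    ring

end HermiteEquivalence

section Translate

lemma glTranslate_X_mul (n : ℕ) (f : ℤ[X]) (M : Matrix (Fin 2) (Fin 2) ℤ) :
    glTranslate (n + 1) (X * f) M = (C (M 0 0) * X + C (M 0 1)) * glTranslate n f M := by
  rw [glTranslate, Finset.sum_range_succ', glTranslate, Finset.mul_sum]
  simp only [coeff_X_mul, coeff_X_mul_zero, C_0, zero_mul, add_zero, Nat.add_sub_add_right]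
  exact Finset.sum_congr rfl fun k _ => by ring

lemma eval_zero_glTranslate (n : ℕ) (f : ℤ[X]) (M : Matrix (Fin 2) (Fin 2) ℤ) :
    (glTranslate n f M).eval 0 =
      ∑ k ∈ Finset.range (n + 1), f.coeff k * M 0 1 ^ k * M 1 1 ^ (n - k) := by
  simp [glTranslate, eval_finsetSum]

lemma reflect_pow {R : Type*} [CommRing R] {p : R[X]} (hp : p.natDegree ≤ 1) (k : ℕ) :
    reflect k (p ^ k) = reflect 1 p ^ k := by
  induction k with
  | zero => simp
  | succ k ih =>
    rw [pow_succ, pow_succ, reflect_mul _ _ (natDegree_pow_le_of_le k hp |>.trans (by simp)) hp, ih]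

lemma reflect_glTranslate (n : ℕ) (f : ℤ[X]) (M : Matrix (Fin 2) (Fin 2) ℤ) :
    reflect n (glTranslate n f M) =
      glTranslate n f !![M 0 1, M 0 0; M 1 1, M 1 0] := by
  have hd (a b : ℤ) : (C a * X + C b).natDegree ≤ 1 := natDegree_linear_le
  have hd' (a b : ℤ) (k : ℕ) : ((C a * X + C b) ^ k).natDegree ≤ k :=
    (natDegree_pow_le_of_le k (hd a b)).trans (by simp)
  rw [glTranslate, glTranslate, reflect_finsetSum]
  refine Finset.sum_congr rfl fun k hk => ?_
  have hk' : n = k + (n - k) := by have := Finset.mem_range.mp hk; omega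
  conv_lhs => arg 1; rw [hk']
  rw [mul_assoc, reflect_C_mul, reflect_mul _ _ (hd' _ _ _) (hd' _ _ _), reflect_pow (hd _ _),
    reflect_pow (hd _ _), reflect_one_linear, reflect_one_linear]
  simp [mul_assoc]

/-- The binary form of a monic irreducible polynomial of degree at least `2` has no nontrivial
integral zero. -/
lemma sum_coeff_mul_pow_ne_zero {n : ℕ} (hn : 2 ≤ n) {f : ℤ[X]} (hfm : f.Monic)
    (hfirr : Irreducible f) (hfn : f.natDegree = n) {b d : ℤ} (hbd : b ≠ 0 ∨ d ≠ 0) :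
    ∑ k ∈ Finset.range (n + 1), f.coeff k * b ^ k * d ^ (n - k) ≠ 0 := by
  intro h
  by_cases hd : d = 0
  · subst hd
    rw [Finset.sum_range_succ, Finset.sum_eq_zero] at h
    · have hlc : f.coeff n = 1 := by rw [← hfn]; exact hfm
      have hb : b = 0 := by
        rw [hlc] at h
        exact pow_eq_zero_iff (n := n) (by omega) |>.mp (by simpa using h)
      simp [hb] at hbd
    · intro k hk
      have : n - k ≠ 0 := by have := Finset.mem_range.mp hk; omega
      simp [this]
  · have hirr : Irreducible (f.map (algebraMap ℤ ℚ)) :=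
      hfm.irreducible_iff_irreducible_map_fraction_map.mp hfirr
    have hroot : IsRoot (f.map (algebraMap ℤ ℚ)) ((b : ℚ) / d) := by
      have hd' : (d : ℚ) ≠ 0 := by exact_mod_cast hd
      have hQ : ∑ k ∈ Finset.range (n + 1), (f.coeff k : ℚ) * b ^ k * d ^ (n - k) = 0 := by
        exact_mod_cast h
      rw [IsRoot, eval_map, eval₂_eq_sum_range, hfn]
      refine (mul_eq_zero.mp (?_ : (d : ℚ) ^ n * _ = 0)).resolve_left (pow_ne_zero n hd')
      rw [Finset.mul_sum, ← hQ]
      refine Finset.sum_congr rfl fun k hk => ?_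
      have hk' : k ≤ n := by have := Finset.mem_range.mp hk; omega
      rw [pow_sub₀ _ hd' hk', div_pow, eq_intCast]
      field_simp
    have h1 : natDegree _ = 1 := natDegree_eq_of_degree_eq_some (degree_eq_one_of_irreducible_of_root hirr hroot)
    rw [hfm.natDegree_map, hfn] at h1
    omega

lemma not_gl2Equiv_X_mul_reflect {n : ℕ} (hn : 2 ≤ n) {f : ℤ[X]} (hfm : f.Monic)
    (hfirr : Irreducible f) (hfn : f.natDegree = n)
    (hstab : ∀ M : Matrix (Fin 2) (Fin 2) ℤ, IsUnit M.det →
      (glTranslate n f M = f ∨ glTranslate n f M = -f) → (M = 1 ∨ M = -1)) :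
    ¬ GL2Equiv (n + 1) (X * f) (X * reflect n f) := by
  rintro ⟨M, hM, h⟩
  rw [glTranslate_X_mul] at h
  have hdet := hM
  rw [Matrix.det_fin_two] at hdet
  have hb : M 0 1 = 0 := by
    have hbd : M 0 1 ≠ 0 ∨ M 1 1 ≠ 0 := by
      by_contra! hc
      simp [hc.1, hc.2] at hdet
    have hne := sum_coeff_mul_pow_ne_zero hn hfm hfirr hfn hbd
    rw [← eval_zero_glTranslate] at hne
    have h0 : M 0 1 * (glTranslate n f M).eval 0 = 0 := by
      rcases h with h | h <;> simpa using (congrArg (eval 0) h).symm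
    exact (mul_eq_zero.mp h0).resolve_right hne
  rw [hb, zero_mul, sub_zero] at hdet
  have ha : M 0 0 = 1 ∨ M 0 0 = -1 := Int.isUnit_iff.mp (isUnit_of_mul_isUnit_left hdet)
  have hR : glTranslate n f M = reflect n f ∨ glTranslate n f M = -reflect n f := by
    have hX : X * glTranslate n f M = X * reflect n f ∨
        X * glTranslate n f M = X * -reflect n f := by
      rw [hb] at h
      rcases ha with ha | ha <;> rw [ha] at h <;> simp only [map_neg, C_1, C_0] at h <;>
        rcases h with h | h <;> rw [mul_neg, h] <;> simp
    exact hX.imp (mul_left_cancel₀ X_ne_zero) (mul_left_cancel₀ X_ne_zero)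
  have hstab' := hstab !![M 0 1, M 0 0; M 1 1, M 1 0]
    (by rw [Matrix.det_fin_two_of, hb, zero_mul, zero_sub]; exact hdet.neg) (by
      rw [← reflect_glTranslate]
      rcases hR with h | h <;> rw [h]
      · exact Or.inl reflect_reflect
      · rw [reflect_neg, reflect_reflect]
        exact Or.inr rfl)
  rcases hstab' with h | h <;> simpa [hb] using congrFun (congrFun h 0) 0

end Translate

/-- if `f` is monic irreducible of degree `n ≥ 3` with `f(0) = 1` and
trivial stabilizer in `GL₂(ℤ)`, then `X·f(X)` and `X^(n+1)·f(1/X)` are Hermite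
equivalent but not `GL₂(ℤ)`-equivalent (as polynomials of degree `n+1`). -/
theorem reducible_monic_example (n : ℕ) (hn : 3 ≤ n) (f : Polynomial ℤ)
    (hfm : f.Monic) (hfirr : Irreducible f) (hfn : f.natDegree = n)
    (hf0 : f.eval 0 = 1)
    (hstab : ∀ M : Matrix (Fin 2) (Fin 2) ℤ, IsUnit M.det →
      (glTranslate n f M = f ∨ glTranslate n f M = -f) → (M = 1 ∨ M = -1)) :
    HermiteEquiv (n + 1) (Polynomial.X * f)
        (∑ k ∈ Finset.range (n + 1), Polynomial.C (f.coeff k) * Polynomial.X ^ (n + 1 - k)) ∧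
      ¬ GL2Equiv (n + 1) (Polynomial.X * f)
        (∑ k ∈ Finset.range (n + 1), Polynomial.C (f.coeff k) * Polynomial.X ^ (n + 1 - k)) := by
  rw [sum_coeff_eq_X_mul_reflect, ← reflect_eq_sum hfn]
  exact ⟨hermiteEquiv_X_mul_reflect hfm hfn hf0,
    not_gl2Equiv_X_mul_reflect (by omega) hfm hfirr hfn hstab⟩
end

section
/- Let n ≥ 2 be an integer, let a⁽ⁿ⁾(X) = ∑_{i=0}^{n−2} Cᵢ·Xⁱ ∈ ℤ[X] where Cᵢ is the i-th Catalan number, and suppose h_n, h_{n+1} ∈ ℤ[X] satisfy X^(n−1)·h_n(X) = (1−X)·a⁽ⁿ⁾(X−X²) − 1 and Xⁿ·h_{n+1}(X) = (1−X)·a⁽ⁿ⁺¹⁾(X−X²) − 1. Then X·h_{n+1}(X) − h_n(X) = C_{n−1}·(1−X)ⁿ in ℤ[X]. -/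
open Polynomial

/-- the cofactors `h_n` satisfy the recursion
`X·h_{n+1}(X) - h_n(X) = C_{n-1}·(1-X)ⁿ`. -/
theorem catalan_h_recursion (n : ℕ) (hn : 2 ≤ n) (hpoly hpoly' : Polynomial ℤ)
    (h1 : Polynomial.X ^ (n - 1) * hpoly =
      (1 - Polynomial.X) * (aPoly n).comp (Polynomial.X - Polynomial.X ^ 2) - 1)
    (h2 : Polynomial.X ^ n * hpoly' =
      (1 - Polynomial.X) * (aPoly (n + 1)).comp (Polynomial.X - Polynomial.X ^ 2) - 1) :
    Polynomial.X * hpoly' - hpoly =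
      Polynomial.C ((catalan (n - 1) : ℤ)) * (1 - Polynomial.X) ^ n := by
  obtain ⟨m, rfl⟩ : ∃ m, n = m + 1 := ⟨n - 1, by omega⟩
  have key : aPoly (m + 1 + 1) = aPoly (m + 1) + C ((catalan m : ℤ)) * X ^ m := by
    simp [aPoly, Finset.sum_range_succ]
  rw [Nat.add_sub_cancel] at h1 ⊢
  rw [key, add_comp, mul_comp, C_comp, pow_comp, X_comp] at h2
  have hfactor : (X - X ^ 2 : ℤ[X]) ^ m = X ^ m * (1 - X) ^ m := by
    rw [← mul_pow]
    ring
  rw [hfactor] at h2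
  apply mul_left_cancel₀ (pow_ne_zero m (X_ne_zero (R := ℤ)))
  linear_combination h2 - h1
end
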